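/- Fix an integer r ≥ 3, reals ε > 0 and K ≥ 1, and a function δ : ℕ → (0,∞) with δ(n) → 0. For every σ > 0 and every k > 0 there is n₀ such that for all n ≥ n₀ divisible by r and all integers m with (1+ε)(n/r)·log n < m ≤ C(n,r): P( H^r_{n,m} satisfies A(δ(n)) and R(δ(n),K) but does not satisfy F(σ) ) ≤ n^{−k}. -/

import Mathlib

open Finset

/-- The set of perfect matchings of the `r`-graph `G` on vertex set `W`. -/
def pmSet (W : Finset ℕ) (G : Finset (Finset ℕ)) : Finset (Finset (Finset ℕ)) :=
  G.powerset.filter (fun M => (∀ A ∈ M, ∀ B ∈ M, A ≠ B → A ∩ B = ∅) ∧ M.biUnion id = W)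

/-- The number of perfect matchings of `G` (denoted `Φ(G)`). -/
def pmCount (W : Finset ℕ) (G : Finset (Finset ℕ)) : ℕ := (pmSet W G).card

/-- All `r`-element subsets of `[n]`. -/
def Kn (n r : ℕ) : Finset (Finset ℕ) := Finset.powersetCard r (Finset.range n)

/-- `G − Z`: the set of edges of `G` disjoint from `Z`. -/
def minus (G : Finset (Finset ℕ)) (Z : Finset ℕ) : Finset (Finset ℕ) :=
  G.filter (fun A => A ∩ Z = ∅)

/-- `Φ(G − Z)`, with `G − Z` regarded as an `r`-graph on `W \ Z`. -/
def phiSub (W : Finset ℕ) (G : Finset (Finset ℕ)) (Z : Finset ℕ) : ℕ :=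
  pmCount (W \ Z) (minus G Z)

/-- Degree of `x` in `G`. -/
def deg (G : Finset (Finset ℕ)) (x : ℕ) : ℕ := (G.filter (fun A => x ∈ A)).card

/-- Codegree of `x, y` in `G`. -/
def codeg (G : Finset (Finset ℕ)) (x y : ℕ) : ℕ :=
  (G.filter (fun A => x ∈ A ∧ y ∈ A)).card

/-- Average degree `D_G = r|G|/|W|`. -/
noncomputable def avgDeg (r : ℕ) (W : Finset ℕ) (G : Finset (Finset ℕ)) : ℝ :=
  ((r : ℝ) * G.card) / W.card

/-- Property `R(δ,K)`: all but at most `δ|W|` vertices have degree `(1±δ)D_G`,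
every degree lies in `[D_G/K, K·D_G]`, and all codegrees are at most `δ·D_G`. -/
def propR (r : ℕ) (W : Finset ℕ) (G : Finset (Finset ℕ)) (δ K : ℝ) : Prop :=
  ((W.filter (fun x =>
      ¬((1 - δ) * avgDeg r W G ≤ (deg G x : ℝ) ∧
        (deg G x : ℝ) ≤ (1 + δ) * avgDeg r W G))).card : ℝ) ≤ δ * W.card ∧
  (∀ x ∈ W, (deg G x : ℝ) ≤ K * avgDeg r W G ∧ avgDeg r W G / K ≤ (deg G x : ℝ)) ∧
  ∀ x ∈ W, ∀ y ∈ W, x ≠ y → (codeg G x y : ℝ) ≤ δ * avgDeg r W G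

/-- Property `E(σ)`: all but at most `σ|G|` edges `A` satisfy
`Φ(G−A) = (1±σ)Φ(G)/D_G`. -/
def propE (r : ℕ) (W : Finset ℕ) (G : Finset (Finset ℕ)) (σ : ℝ) : Prop :=
  ((G.filter (fun A =>
      ¬((1 - σ) * (pmCount W G : ℝ) / avgDeg r W G ≤ (phiSub W G A : ℝ) ∧
        (phiSub W G A : ℝ) ≤ (1 + σ) * (pmCount W G : ℝ) / avgDeg r W G))).card : ℝ) ≤
    σ * G.card

/-- Property `F(σ)`: all but at most `σ·C(|W|,r)` of the `r`-subsets `U` of `W`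
satisfy `Φ(G−U) = (1±σ)Φ(G)/D_G`. -/
def propF (r : ℕ) (W : Finset ℕ) (G : Finset (Finset ℕ)) (σ : ℝ) : Prop :=
  (((Finset.powersetCard r W).filter (fun U =>
      ¬((1 - σ) * (pmCount W G : ℝ) / avgDeg r W G ≤ (phiSub W G U : ℝ) ∧
        (phiSub W G U : ℝ) ≤ (1 + σ) * (pmCount W G : ℝ) / avgDeg r W G))).card : ℝ) ≤
    σ * (W.card.choose r)

/-- Property `C(δ,σ)`: for every `r`-subset `Z` of `W` with
`Φ(G−Z) ≥ Φ(G)e^{−δ|W|}` and every `x ∈ Z`, all but at most `σ|W|` vertices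
`y ∈ W∖Z` satisfy `Φ(G−((Z∖{x})∪{y})) ≥ (1−σ)·Φ(G−Z)·d_G(x)/D_G`. -/
def propC (r : ℕ) (W : Finset ℕ) (G : Finset (Finset ℕ)) (δ σ : ℝ) : Prop :=
  ∀ Z ∈ Finset.powersetCard r W,
    (pmCount W G : ℝ) * Real.exp (-δ * W.card) ≤ (phiSub W G Z : ℝ) →
    ∀ x ∈ Z,
      (((W \ Z).filter (fun y =>
          ¬((1 - σ) * (phiSub W G Z : ℝ) * (deg G x : ℝ) / avgDeg r W G ≤
            (phiSub W G (insert y (Z.erase x)) : ℝ)))).card : ℝ) ≤ σ * W.card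

/-- Property `B(C)`: `Φ(G−A) ≤ C·Φ(G)/D_G` for every edge `A ∈ G`. -/
def propB (r : ℕ) (W : Finset ℕ) (G : Finset (Finset ℕ)) (C : ℝ) : Prop :=
  ∀ A ∈ G, (phiSub W G A : ℝ) ≤ C * (pmCount W G : ℝ) / avgDeg r W G

/-- Property `A(δ)` for an `r`-graph `H` on `[n]` with `m` edges:
`log Φ(H) > log Φ₀ − ∑_{i=1}^{t} γ_i − δn`, where `t = C(n,r) − m`,
`γ_i = (n/r)/(C(n,r)−i+1)`, and `Φ₀ = n!/((n/r)!·(r!)^{n/r})`. -/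
def propA (r n : ℕ) (H : Finset (Finset ℕ)) (δ : ℝ) : Prop :=
  Real.log ((n.factorial : ℝ) /
      ((Nat.factorial (n / r) : ℝ) * (Nat.factorial r : ℝ) ^ (n / r)))
    - (∑ i ∈ Finset.Icc 1 (n.choose r - H.card),
        ((n : ℝ) / r) / ((n.choose r : ℝ) - (i : ℝ) + 1))
    - δ * n < Real.log (pmCount (Finset.range n) H)

theorem mem_pmSet_iff {W : Finset ℕ} {G M : Finset (Finset ℕ)} :
    M ∈ pmSet W G ↔ M ⊆ G ∧ (∀ A ∈ M, ∀ B ∈ M, A ≠ B → A ∩ B = ∅) ∧ M.biUnion id = W := by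
  simp [pmSet]

theorem pm_card_mul {r : ℕ} {W : Finset ℕ} {G M : Finset (Finset ℕ)}
    (hG : ∀ A ∈ G, A.card = r) (hM : M ∈ pmSet W G) : M.card * r = W.card := by
  obtain ⟨h1, h2, h3⟩ := mem_pmSet_iff.1 hM
  rw [← h3, Finset.card_biUnion]
  · rw [Finset.sum_congr rfl (fun A hA => by rw [id, hG A (h1 hA)])]
    simp
  · intro A hA B hB hAB
    exact Finset.disjoint_iff_inter_eq_empty.2 (h2 A hA B hB hAB)

theorem pm_sub {W : Finset ℕ} {G M : Finset (Finset ℕ)} (hM : M ∈ pmSet W G)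
    {A : Finset ℕ} (hA : A ∈ M) : A ⊆ W := by
  obtain ⟨h1, h2, h3⟩ := mem_pmSet_iff.1 hM
  rw [← h3]
  exact Finset.subset_biUnion_of_mem id hA

theorem pm_disj {W : Finset ℕ} {G M : Finset (Finset ℕ)} (hM : M ∈ pmSet W G)
    {A B : Finset ℕ} (hA : A ∈ M) (hB : B ∈ M) {v : ℕ} (h1 : v ∈ A) (h2 : v ∈ B) : A = B := by
  obtain ⟨_, h, _⟩ := mem_pmSet_iff.1 hM
  by_contra hne
  have := h A hA B hB hne
  have hv : v ∈ A ∩ B := Finset.mem_inter.2 ⟨h1, h2⟩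
  simp [this] at hv

theorem pm_cover {W : Finset ℕ} {G M : Finset (Finset ℕ)} (hM : M ∈ pmSet W G)
    {v : ℕ} (hv : v ∈ W) : ∃ A ∈ M, v ∈ A := by
  obtain ⟨_, _, h⟩ := mem_pmSet_iff.1 hM
  rw [← h] at hv
  simpa using hv

theorem pm_erase_mem {W : Finset ℕ} {G M : Finset (Finset ℕ)} {A : Finset ℕ}
    (hM : M ∈ pmSet W G) (hA : A ∈ M) : M.erase A ∈ pmSet (W \ A) (minus G A) := by
  obtain ⟨h1, h2, h3⟩ := mem_pmSet_iff.1 hM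
  refine mem_pmSet_iff.2 ⟨?_, ?_, ?_⟩
  · intro B hB
    obtain ⟨hne, hB⟩ := Finset.mem_erase.1 hB
    exact Finset.mem_filter.2 ⟨h1 hB, h2 B hB A hA hne⟩
  · intro B hB C hC hBC
    exact h2 B (Finset.mem_of_mem_erase hB) C (Finset.mem_of_mem_erase hC) hBC
  · ext x
    simp only [Finset.mem_biUnion, Finset.mem_erase, id, Finset.mem_sdiff]
    constructor
    · rintro ⟨B, ⟨hne, hB⟩, hx⟩
      refine ⟨pm_sub hM hB hx, fun hxA => hne (pm_disj hM hB hA hx hxA)⟩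
    · rintro ⟨hx, hxA⟩
      obtain ⟨B, hB, hxB⟩ := pm_cover hM hx
      exact ⟨B, ⟨fun h => hxA (h ▸ hxB), hB⟩, hxB⟩

theorem pm_insert_mem {W : Finset ℕ} {G M : Finset (Finset ℕ)} {A : Finset ℕ}
    (hAW : A ⊆ W) (hAG : A ∈ G) (hM : M ∈ pmSet (W \ A) (minus G A)) :
    insert A M ∈ pmSet W G := by
  obtain ⟨h1, h2, h3⟩ := mem_pmSet_iff.1 hM
  have hd : ∀ B ∈ M, B ∩ A = ∅ := fun B hB => (Finset.mem_filter.1 (h1 hB)).2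
  refine mem_pmSet_iff.2 ⟨?_, ?_, ?_⟩
  · intro B hB
    rcases Finset.mem_insert.1 hB with rfl | hB
    · exact hAG
    · exact (Finset.mem_filter.1 (h1 hB)).1
  · intro B hB C hC hBC
    rcases Finset.mem_insert.1 hB with hB1 | hB1
    · rcases Finset.mem_insert.1 hC with hC1 | hC1
      · exact absurd (hB1.trans hC1.symm) hBC
      · rw [Finset.inter_comm, hB1]; exact hd C hC1
    · rcases Finset.mem_insert.1 hC with hC1 | hC1
      · rw [hC1]; exact hd B hB1
      · exact h2 B hB1 C hC1 hBC
  · rw [Finset.biUnion_insert, h3]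
    simp [hAW]

theorem not_mem_of_pm_minus {W : Finset ℕ} {G M : Finset (Finset ℕ)} {A : Finset ℕ}
    (hA : A.Nonempty) (hM : M ∈ pmSet W (minus G A)) : A ∉ M := by
  intro h
  have := (Finset.mem_filter.1 ((mem_pmSet_iff.1 hM).1 h)).2
  simp at this
  exact hA.ne_empty this

theorem pm_sum_erase {W : Finset ℕ} {G : Finset (Finset ℕ)} {A : Finset ℕ}
    (hA : A.Nonempty) (hAW : A ⊆ W) (hAG : A ∈ G) (f : Finset (Finset ℕ) → ℝ) :
    ∑ M ∈ (pmSet W G).filter (fun M => A ∈ M), f (M.erase A)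
      = ∑ M ∈ pmSet (W \ A) (minus G A), f M := by
  refine Finset.sum_bij' (fun M _ => M.erase A) (fun M _ => insert A M) ?_ ?_ ?_ ?_ ?_
  · intro M hM
    obtain ⟨h1, h2⟩ := Finset.mem_filter.1 hM
    exact pm_erase_mem h1 h2
  · intro M hM
    exact Finset.mem_filter.2 ⟨pm_insert_mem hAW hAG hM, Finset.mem_insert_self _ _⟩
  · intro M hM
    exact Finset.insert_erase (Finset.mem_filter.1 hM).2
  · intro M hM
    exact Finset.erase_insert (not_mem_of_pm_minus hA hM)
  · intro M hM; rfl

theorem card_pm_mem {W : Finset ℕ} {G : Finset (Finset ℕ)} {A : Finset ℕ}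
    (hA : A.Nonempty) (hAW : A ⊆ W) (hAG : A ∈ G) :
    ((pmSet W G).filter (fun M => A ∈ M)).card = phiSub W G A := by
  have := pm_sum_erase hA hAW hAG (fun _ => 1)
  simp at this
  exact_mod_cast this

/-- edges available at `v` -/
def availE (G M : Finset (Finset ℕ)) (key : ℕ → ℕ) (v : ℕ) : Finset (Finset ℕ) :=
  G.filter (fun A => v ∈ A ∧ ∀ f ∈ M, (∃ u ∈ f, key u < key v) → Disjoint A f)

/-- `v` is the first vertex in its edge -/
def leadV (M : Finset (Finset ℕ)) (key : ℕ → ℕ) (v : ℕ) : Prop :=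
  ∀ e ∈ M, v ∈ e → ∀ u ∈ e, key v ≤ key u

open scoped Classical in
/-- vertices which are first in their edge -/
noncomputable def leadS (W : Finset ℕ) (M : Finset (Finset ℕ)) (key : ℕ → ℕ) : Finset ℕ :=
  W.filter (fun v => leadV M key v)

theorem mem_leadS {W : Finset ℕ} {M : Finset (Finset ℕ)} {key : ℕ → ℕ} {v : ℕ} :
    v ∈ leadS W M key ↔ v ∈ W ∧ leadV M key v := by
  classical
  simp [leadS]

theorem greedy (key : ℕ → ℕ) (w : Finset ℕ → ℝ) (hw : ∀ A, 0 < w A) : ∀ (c : ℕ) (W : Finset ℕ)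
    (G : Finset (Finset ℕ)), W.card = c → (∀ A ∈ G, A.Nonempty ∧ A ⊆ W) →
    Set.InjOn key W →
    ∑ M ∈ pmSet W G, (∏ A ∈ M, w A) / ∏ v ∈ leadS W M key, ∑ A ∈ availE G M key v, w A ≤ 1 := by
  intro c
  induction c using Nat.strong_induction_on with
  | _ c ih =>
  intro W G hc hG hinj
  rcases W.eq_empty_or_nonempty with rfl | hne
  · have : pmSet ∅ G ⊆ {∅} := by
      intro M hM
      rw [Finset.mem_singleton]
      rw [Finset.eq_empty_iff_forall_notMem]
      intro A hA
      have h1 := pm_sub hM hA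
      have h2 := (hG A ((mem_pmSet_iff.1 hM).1 hA)).1
      rw [Finset.subset_empty] at h1
      exact h2.ne_empty h1
    calc _ ≤ ∑ M ∈ ({∅} : Finset (Finset (Finset ℕ))), (∏ A ∈ M, w A) /
            ∏ v ∈ leadS ∅ M key, ∑ A ∈ availE G M key v, w A := by
          apply Finset.sum_le_sum_of_subset_of_nonneg this
          intro M _ _
          apply div_nonneg
          · exact Finset.prod_nonneg fun A _ => (hw A).le
          · exact Finset.prod_nonneg fun v _ => Finset.sum_nonneg fun A _ => (hw A).le
      _ = 1 := by simp [leadS]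
  · obtain ⟨v0, hv0, hmin⟩ := Finset.exists_min_image W key hne
    have hlt : ∀ v ∈ W, v ≠ v0 → key v0 < key v := by
      intro v hv hvne
      refine lt_of_le_of_ne (hmin v hv) (fun h => hvne (hinj hv hv0 h.symm))
    set N0 : ℝ := ∑ A ∈ G.filter (fun A => v0 ∈ A), w A with hN0
    have hN0nn : 0 ≤ N0 := Finset.sum_nonneg fun A _ => (hw A).le
    set g : Finset (Finset ℕ) → ℝ := fun M => (∏ A ∈ M, w A) /
      ∏ v ∈ leadS W M key, ∑ A ∈ availE G M key v, w A with hg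
    have step : ∑ M ∈ pmSet W G, g M
        = ∑ A ∈ G.filter (fun A => v0 ∈ A), ∑ M ∈ (pmSet W G).filter (fun M => A ∈ M), g M := by
      rw [Finset.sum_congr rfl (fun A _ => Finset.sum_filter _ _), Finset.sum_comm]
      refine Finset.sum_congr rfl fun M hM => ?_
      obtain ⟨A0, hA0, hvA0⟩ := pm_cover hM hv0
      rw [Finset.sum_eq_single A0]
      · simp [hA0]
      · intro B hB hne'
        rw [if_neg]
        intro hBM
        exact hne' (pm_disj hM hBM hA0 (Finset.mem_filter.1 hB).2 hvA0)
      · intro h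
        exact absurd (Finset.mem_filter.2 ⟨(mem_pmSet_iff.1 hM).1 hA0, hvA0⟩) h
    have key2 : ∀ A ∈ G.filter (fun A => v0 ∈ A),
        ∑ M ∈ (pmSet W G).filter (fun M => A ∈ M), g M ≤ w A / N0 := by
      intro A hA
      obtain ⟨hAG, hv0A⟩ := Finset.mem_filter.1 hA
      obtain ⟨hAne, hAW⟩ := hG A hAG
      set g' : Finset (Finset ℕ) → ℝ := fun M => (∏ B ∈ M, w B) /
        ∏ v ∈ leadS (W \ A) M key, ∑ B ∈ availE (minus G A) M key v, w B with hg'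
      have h1 : ∀ M ∈ (pmSet W G).filter (fun M => A ∈ M), g M = w A / N0 * g' (M.erase A) := by
        intro M hM
        obtain ⟨hM, hAM⟩ := Finset.mem_filter.1 hM
        have e1 : ∏ B ∈ M, w B = w A * ∏ B ∈ M.erase A, w B :=
          (Finset.mul_prod_erase M w hAM).symm
        have e2 : leadS W M key = insert v0 (leadS (W \ A) (M.erase A) key) := by
          ext v
          rw [Finset.mem_insert, mem_leadS, mem_leadS, Finset.mem_sdiff]
          constructor
          · rintro ⟨hvW, hl⟩
            by_cases hvA : v ∈ A
            · left
              by_contra hvne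
              have := hl A hAM hvA v0 hv0A
              exact absurd (hlt v hvW hvne) (not_lt.2 this)
            · right
              exact ⟨⟨hvW, hvA⟩, fun e he => hl e (Finset.mem_of_mem_erase he)⟩
          · rintro (rfl | ⟨⟨hvW, hvA⟩, hl⟩)
            · exact ⟨hv0, fun e he _ u hu => hmin u (pm_sub hM he hu)⟩
            · refine ⟨hvW, fun e he hve => hl e (Finset.mem_erase.2 ⟨?_, he⟩) hve⟩
              rintro rfl
              exact hvA hve
        have e3 : v0 ∉ leadS (W \ A) (M.erase A) key := by
          rw [mem_leadS, Finset.mem_sdiff]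
          tauto
        have e4 : ∑ B ∈ availE G M key v0, w B = N0 := by
          rw [hN0]
          congr 1
          ext B
          simp only [availE, Finset.mem_filter]
          constructor
          · tauto
          · rintro ⟨h1, h2⟩
            refine ⟨h1, h2, ?_⟩
            rintro f hf ⟨u, hu, hlt'⟩
            exact absurd (hmin u (pm_sub hM hf hu)) (not_le.2 hlt')
        have e5 : ∀ v ∈ leadS (W \ A) (M.erase A) key,
            ∑ B ∈ availE G M key v, w B = ∑ B ∈ availE (minus G A) (M.erase A) key v, w B := by
          intro v hv
          rw [mem_leadS, Finset.mem_sdiff] at hv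
          congr 1
          ext B
          simp only [availE, Finset.mem_filter, minus]
          have hvne : v ≠ v0 := by rintro rfl; exact hv.1.2 hv0A
          constructor
          · rintro ⟨hB, hvB, h⟩
            refine ⟨⟨hB, ?_⟩, hvB, fun f hf => h f (Finset.mem_of_mem_erase hf)⟩
            rw [← Finset.disjoint_iff_inter_eq_empty]
            exact h A hAM ⟨v0, hv0A, hlt v hv.1.1 hvne⟩
          · rintro ⟨⟨hB, hBA⟩, hvB, h⟩
            refine ⟨hB, hvB, fun f hf hu => ?_⟩
            by_cases hfA : f = A
            · rw [hfA, Finset.disjoint_iff_inter_eq_empty]; exact hBA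
            · exact h f (Finset.mem_erase.2 ⟨hfA, hf⟩) hu
        simp only [hg, hg']
        rw [e1, e2, Finset.prod_insert e3, e4, Finset.prod_congr rfl e5]
        rw [mul_div_mul_comm]
      rw [Finset.sum_congr rfl h1, ← Finset.mul_sum, pm_sum_erase hAne hAW hAG g']
      have hcard : (W \ A).card < c := by
        rw [← hc]
        apply Finset.card_lt_card
        refine ⟨Finset.sdiff_subset, fun h => ?_⟩
        exact (Finset.mem_sdiff.1 (h hv0)).2 hv0A
      have := ih _ hcard (W \ A) (minus G A) rfl ?_ ?_
      · calc w A / N0 * _ ≤ w A / N0 * 1 :=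
              mul_le_mul_of_nonneg_left this (div_nonneg (hw A).le hN0nn)
          _ = _ := mul_one _
      · intro B hB
        obtain ⟨hB, hBA⟩ := Finset.mem_filter.1 hB
        refine ⟨(hG B hB).1, fun x hx => Finset.mem_sdiff.2 ⟨(hG B hB).2 hx, fun hxA => ?_⟩⟩
        have : x ∈ B ∩ A := Finset.mem_inter.2 ⟨hx, hxA⟩
        simp [hBA] at this
      · exact hinj.mono (by simp)
    rw [step]
    refine (Finset.sum_le_sum key2).trans ?_
    rw [← Finset.sum_div, ← hN0]
    exact div_self_le_one _

/-- the log form -/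
theorem greedy_log (key : ℕ → ℕ) (w : Finset ℕ → ℝ) (hw : ∀ A, 0 < w A) (W : Finset ℕ)
    (G : Finset (Finset ℕ)) (hG : ∀ A ∈ G, A.Nonempty ∧ A ⊆ W) (hinj : Set.InjOn key W)
    (hpos : 0 < pmCount W G) :
    (pmCount W G : ℝ) * Real.log (pmCount W G) + ∑ M ∈ pmSet W G, ∑ A ∈ M, Real.log (w A) ≤
      ∑ M ∈ pmSet W G, ∑ v ∈ leadS W M key, Real.log (∑ A ∈ availE G M key v, w A) := by
  have h := greedy key w hw _ W G rfl hG hinj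
  set Φ : ℝ := (pmCount W G : ℝ) with hΦ
  have hΦpos : 0 < Φ := by rw [hΦ]; exact_mod_cast hpos
  have hcard : ((pmSet W G).card : ℝ) = Φ := rfl
  have hN : ∀ M ∈ pmSet W G, ∀ v ∈ leadS W M key, 0 < ∑ A ∈ availE G M key v, w A := by
    intro M hM v hv
    rw [mem_leadS] at hv
    obtain ⟨A, hA, hvA⟩ := pm_cover hM hv.1
    apply Finset.sum_pos (fun A _ => hw A)
    refine ⟨A, Finset.mem_filter.2 ⟨(mem_pmSet_iff.1 hM).1 hA, hvA, ?_⟩⟩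
    rintro f hf ⟨u, hu, hlt⟩
    rw [Finset.disjoint_iff_inter_eq_empty]
    apply (mem_pmSet_iff.1 hM).2.1 A hA f hf
    rintro rfl
    exact absurd (hv.2 A hA hvA u hu) (not_le.2 hlt)
  have h2 : ∀ M ∈ pmSet W G, Real.log Φ + ∑ A ∈ M, Real.log (w A)
      - ∑ v ∈ leadS W M key, Real.log (∑ A ∈ availE G M key v, w A) ≤
      Φ * ((∏ A ∈ M, w A) / ∏ v ∈ leadS W M key, ∑ A ∈ availE G M key v, w A) - 1 := by
    intro M hM
    have p1 : 0 < ∏ A ∈ M, w A := Finset.prod_pos fun A _ => hw A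
    have p2 : 0 < ∏ v ∈ leadS W M key, ∑ A ∈ availE G M key v, w A :=
      Finset.prod_pos (hN M hM)
    rw [← Real.log_prod (fun A _ => (hw A).ne'), ← Real.log_prod (fun v hv => (hN M hM v hv).ne'),
      ← Real.log_mul hΦpos.ne' p1.ne', ← Real.log_div (mul_pos hΦpos p1).ne' p2.ne', mul_div_assoc]
    exact Real.log_le_sub_one_of_pos (mul_pos hΦpos (div_pos p1 p2))
  have h3 := Finset.sum_le_sum h2
  rw [Finset.sum_sub_distrib, Finset.sum_sub_distrib, Finset.sum_add_distrib, ← Finset.mul_sum] at h3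
  simp only [Finset.sum_const, nsmul_eq_mul, mul_one, hcard] at h3
  have h4 := mul_le_mul_of_nonneg_left h hΦpos.le
  linarith

/-- extension of a labelling by zero -/
def extL (W : Finset ℕ) (T : ℕ) (ω : W → Fin T) (x : ℕ) : ℕ :=
  if h : x ∈ W then (ω ⟨x, h⟩ : ℕ) else 0

theorem card_lab (W : Finset ℕ) (T : ℕ) (S : ℕ → Finset ℕ) (hS : ∀ x, S x ⊆ Finset.range T) :
    ((Finset.univ : Finset (W → Fin T)).filter (fun ω => ∀ x ∈ W, extL W T ω x ∈ S x)).card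
      = ∏ x ∈ W, (S x).card := by
  classical
  have : ((Finset.univ : Finset (W → Fin T)).filter (fun ω => ∀ x ∈ W, extL W T ω x ∈ S x))
      = Fintype.piFinset (fun x : W => (Finset.univ : Finset (Fin T)).filter
          (fun i : Fin T => (i : ℕ) ∈ S (x : ℕ))) := by
    ext ω
    simp only [Finset.mem_filter, Finset.mem_univ, true_and, Fintype.mem_piFinset]
    constructor
    · intro h x
      have := h x x.2
      simpa [extL] using this
    · intro h x hx
      have := h ⟨x, hx⟩
      simpa [extL, hx] using this
  rw [this, Fintype.card_piFinset, ← Finset.prod_coe_sort W (fun x => (S x).card)]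
  refine Finset.prod_congr rfl fun x _ => ?_
  refine Finset.card_bij (fun i _ => (i : ℕ)) ?_ ?_ ?_
  · intro i hi; simpa using hi
  · intro i _ j _ h; exact Fin.ext h
  · intro b hb
    have := Finset.mem_range.1 (hS x hb)
    exact ⟨⟨b, this⟩, by simpa using hb, rfl⟩

theorem card_lab_ge (W : Finset ℕ) (T j : ℕ) (hj : j < T) (Z : Finset ℕ) (hZ : Z ⊆ W) (v : ℕ)
    (hv : v ∈ Z) :
    (((Finset.univ : Finset (W → Fin T)).filter (fun ω => extL W T ω v = j ∧
      ∀ x ∈ Z, j ≤ extL W T ω x)).card : ℝ)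
      = (T : ℝ) ^ W.card * (1 / T) * (((T : ℝ) - j) / T) ^ (Z.card - 1) := by
  classical
  set S : ℕ → Finset ℕ := fun x => if x = v then {j} else
    if x ∈ Z then Finset.Ico j T else Finset.range T with hS
  have hsub : ∀ x, S x ⊆ Finset.range T := by
    intro x y
    simp only [hS]
    split_ifs
    · simp; rintro rfl; exact hj
    · simp
    · simp
  have hlt : ∀ (ω : W → Fin T) x, extL W T ω x < T := by
    intro ω x
    unfold extL
    split_ifs
    · exact (ω _).2
    · omega
  have h := card_lab W T S hsub
  have heq : ((Finset.univ : Finset (W → Fin T)).filter (fun ω => extL W T ω v = j ∧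
      ∀ x ∈ Z, j ≤ extL W T ω x))
      = ((Finset.univ : Finset (W → Fin T)).filter (fun ω => ∀ x ∈ W, extL W T ω x ∈ S x)) := by
    ext ω
    simp only [Finset.mem_filter, Finset.mem_univ, true_and, hS]
    constructor
    · rintro ⟨h1, h2⟩ x hx
      split_ifs with h3 h4
      · rw [h3]; simpa using h1
      · simp [h2 x h4, hlt]
      · simp [hlt]
    · intro h
      refine ⟨by simpa using h v (hZ hv), fun x hx => ?_⟩
      have := h x (hZ hx)
      by_cases hxv : x = v
      · rw [if_pos hxv] at this; simp at this; omega
      · rw [if_neg hxv, if_pos hx] at this; simp at this; exact this.1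
  rw [heq, h]
  have hT : (T : ℝ) ≠ 0 := by
    have : 0 < T := by omega
    positivity
  have c1 : ∏ x ∈ W, ((S x).card) = (T - j) ^ (Z.card - 1) * T ^ (W.card - Z.card) := by
    rw [← Finset.prod_sdiff hZ, mul_comm]
    congr 1
    · rw [← Finset.mul_prod_erase Z _ hv]
      have : (S v).card = 1 := by simp [hS]
      rw [this, one_mul, ← Finset.card_erase_of_mem hv, ← Finset.prod_const]
      refine Finset.prod_congr rfl fun x hx => ?_
      obtain ⟨h1, h2⟩ := Finset.mem_erase.1 hx
      simp [hS, h1, h2]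
    · rw [← Finset.card_sdiff_of_subset hZ, ← Finset.prod_const]
      refine Finset.prod_congr rfl fun x hx => ?_
      obtain ⟨h1, h2⟩ := Finset.mem_sdiff.1 hx
      have h3 : x ≠ v := by rintro rfl; exact h2 hv
      simp [hS, h3, h2]
  rw [c1]
  have hzw := Finset.card_le_card hZ
  have hz1 : 1 ≤ Z.card := Finset.card_pos.2 ⟨v, hv⟩
  push_cast [Nat.cast_sub hj.le]
  rw [div_pow]
  have : (T : ℝ) ^ W.card = (T : ℝ) ^ (W.card - Z.card) * ((T : ℝ) ^ (Z.card - 1) * T) := by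
    rw [← pow_succ, ← pow_add]; congr 1; omega
  rw [this]
  field_simp

theorem improper_count {r : ℕ} {W : Finset ℕ} {G M : Finset (Finset ℕ)}
    (hG : ∀ A ∈ G, A.card = r ∧ A ⊆ W) (hM : M ∈ pmSet W G) (c : ℝ) (hcnn : 0 ≤ c)
    (hc : ∀ x ∈ W, ∀ y ∈ W, x ≠ y → (codeg G x y : ℝ) ≤ c) :
    ((G.filter (fun A => ∃ e ∈ M, ∃ x ∈ e, ∃ y ∈ e, x ≠ y ∧ x ∈ A ∧ y ∈ A)).card : ℝ)
      ≤ W.card * r * c := by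
  classical
  have hcard := pm_card_mul (fun A hA => (hG A hA).1) hM
  have hsub : G.filter (fun A => ∃ e ∈ M, ∃ x ∈ e, ∃ y ∈ e, x ≠ y ∧ x ∈ A ∧ y ∈ A) ⊆
      M.biUnion (fun e => e.offDiag.biUnion (fun p =>
        G.filter (fun A => p.1 ∈ A ∧ p.2 ∈ A))) := by
    intro A hA
    obtain ⟨hAG, e, he, x, hx, y, hy, hxy, hxA, hyA⟩ := Finset.mem_filter.1 hA
    simp only [Finset.mem_biUnion, Finset.mem_filter]
    exact ⟨e, he, (x, y), by simp [hx, hy, hxy], hAG, hxA, hyA⟩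
  have h1 : ((G.filter (fun A => ∃ e ∈ M, ∃ x ∈ e, ∃ y ∈ e, x ≠ y ∧ x ∈ A ∧ y ∈ A)).card : ℝ)
      ≤ ∑ e ∈ M, ∑ p ∈ e.offDiag, (codeg G p.1 p.2 : ℝ) := by
    have a := Finset.card_le_card hsub
    have b : (M.biUnion (fun e => e.offDiag.biUnion (fun p =>
        G.filter (fun A => p.1 ∈ A ∧ p.2 ∈ A)))).card ≤
        ∑ e ∈ M, ∑ p ∈ e.offDiag, codeg G p.1 p.2 :=
      Finset.card_biUnion_le.trans (Finset.sum_le_sum fun e _ => Finset.card_biUnion_le)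
    exact_mod_cast a.trans b
  refine h1.trans ?_
  have h2 : ∀ e ∈ M, ∑ p ∈ e.offDiag, (codeg G p.1 p.2 : ℝ) ≤ (r * r : ℝ) * c := by
    intro e he
    have heG := (mem_pmSet_iff.1 hM).1 he
    calc ∑ p ∈ e.offDiag, (codeg G p.1 p.2 : ℝ) ≤ ∑ p ∈ e.offDiag, c := by
          refine Finset.sum_le_sum fun p hp => ?_
          rw [Finset.mem_offDiag] at hp
          exact hc p.1 (pm_sub hM he hp.1) p.2 (pm_sub hM he hp.2.1) hp.2.2
      _ = (e.offDiag.card : ℝ) * c := by simp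
      _ ≤ (r * r : ℝ) * c := by
          apply mul_le_mul_of_nonneg_right _ hcnn
          have : e.offDiag.card ≤ r * r := by
            rw [Finset.offDiag_card, (hG e heG).1]; omega
          exact_mod_cast this
  refine (Finset.sum_le_sum h2).trans ?_
  rw [Finset.sum_const, nsmul_eq_mul, ← hcard]
  push_cast
  apply le_of_eq; ring

theorem ent_M {r : ℕ} (hr : 1 ≤ r) {W : Finset ℕ} {G M : Finset (Finset ℕ)}
    (hG : ∀ A ∈ G, A.card = r ∧ A ⊆ W) (hM : M ∈ pmSet W G) (hW : 0 < W.card)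
    (c : ℝ) (hcnn : 0 ≤ c)
    (hc : ∀ x ∈ W, ∀ y ∈ W, x ≠ y → (codeg G x y : ℝ) ≤ c)
    (w : Finset ℕ → ℝ) (hw1 : ∀ A, 1 ≤ w A) (hw2 : ∀ A, w A ≤ 2)
    (T : ℕ) (B : ℕ) (hB : ∀ x ∈ W, x < B) :
    ∑ ω : W → Fin T, ∑ v ∈ leadS W M (fun x => extL W T ω x * B + x),
        Real.log (∑ A ∈ availE G M (fun x => extL W T ω x * B + x) v, w A)
      ≤ (T : ℝ) ^ W.card * W.card * ∑ j ∈ Finset.range T, (1 / (T : ℝ)) *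
        (((T : ℝ) - j) / T) ^ (r - 1) *
        Real.log (r * (∑ A ∈ G, w A) / W.card * (((T : ℝ) - j) / T) ^ (r * r - r)
          + 2 * r * r * c) := by
  classical
  have hw : ∀ A, 0 < w A := fun A => lt_of_lt_of_le one_pos (hw1 A)
  have hex : ∀ v, ∃ e, v ∈ W → e ∈ M ∧ v ∈ e := by
    intro v
    by_cases hv : v ∈ W
    · obtain ⟨A, hA, hvA⟩ := pm_cover hM hv
      exact ⟨A, fun _ => ⟨hA, hvA⟩⟩
    · exact ⟨∅, fun h => absurd h hv⟩
  choose e he using hex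
  have heG : ∀ v ∈ W, e v ∈ G := fun v hv => (mem_pmSet_iff.1 hM).1 (he v hv).1
  set F : ℕ → ℕ → Finset (W → Fin T) := fun v j => (Finset.univ : Finset (W → Fin T)).filter
    (fun ω => extL W T ω v = j ∧ ∀ x ∈ e v, j ≤ extL W T ω x) with hF
  set Nh : (W → Fin T) → ℕ → ℝ := fun ω v => ∑ A ∈ availE G M (extL W T ω) v, w A with hNh
  have hNh1 : ∀ ω, ∀ v ∈ W, (∀ x ∈ e v, extL W T ω v ≤ extL W T ω x) → 1 ≤ Nh ω v := by
    intro ω v hv hle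
    have hmem : e v ∈ availE G M (extL W T ω) v := by
      refine Finset.mem_filter.2 ⟨heG v hv, (he v hv).2, ?_⟩
      rintro f hf ⟨u, hu, hlt⟩
      rw [Finset.disjoint_iff_inter_eq_empty]
      apply (mem_pmSet_iff.1 hM).2.1 _ (he v hv).1 f hf
      rintro rfl
      exact absurd (hle u hu) (not_le.2 hlt)
    exact (hw1 (e v)).trans (Finset.single_le_sum (f := w) (fun A _ => (hw A).le) hmem)
  have hltT : ∀ (ω : W → Fin T) x, x ∈ W → extL W T ω x < T := by
    intro ω x hx
    unfold extL
    rw [dif_pos hx]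
    exact (ω _).2
  -- step 1
  have step1 : ∀ ω : W → Fin T, ∑ v ∈ leadS W M (fun x => extL W T ω x * B + x),
        Real.log (∑ A ∈ availE G M (fun x => extL W T ω x * B + x) v, w A)
      ≤ ∑ v ∈ W, ∑ j ∈ Finset.range T, if ω ∈ F v j then Real.log (Nh ω v) else 0 := by
    intro ω
    have hnn : ∀ v ∈ W, ∀ j ∈ Finset.range T,
        0 ≤ (if ω ∈ F v j then Real.log (Nh ω v) else 0) := by
      intro v hv j _
      split_ifs with h
      · simp only [hF, Finset.mem_filter, Finset.mem_univ, true_and] at h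
        apply Real.log_nonneg
        apply hNh1 ω v hv
        intro x hx
        rw [h.1]; exact h.2 x hx
      · exact le_rfl
    have hsub : leadS W M (fun x => extL W T ω x * B + x) ⊆ W := fun v hv => (mem_leadS.1 hv).1
    refine le_trans ?_ (Finset.sum_le_sum_of_subset_of_nonneg hsub
      (fun v hv _ => Finset.sum_nonneg (hnn v hv)))
    refine Finset.sum_le_sum fun v hv => ?_
    obtain ⟨hvW, hl⟩ := mem_leadS.1 hv
    have hle : ∀ x ∈ e v, extL W T ω v ≤ extL W T ω x := by
      intro x hx
      have h1 := hl (e v) (he v hvW).1 (he v hvW).2 x hx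
      simp only at h1
      have h2 : x < B := hB x (pm_sub hM (he v hvW).1 hx)
      by_contra hlt
      rw [not_le] at hlt
      have : (extL W T ω x + 1) * B ≤ extL W T ω v * B := Nat.mul_le_mul_right _ hlt
      rw [add_mul, one_mul] at this
      omega
    have hmemF : ω ∈ F v (extL W T ω v) := by
      simp only [hF, Finset.mem_filter, Finset.mem_univ, true_and]
      exact hle
    refine le_trans ?_ (Finset.single_le_sum (hnn v hvW) (Finset.mem_range.2 (hltT ω v hvW)))
    rw [if_pos hmemF]
    have hsub2 : availE G M (fun x => extL W T ω x * B + x) v ⊆ availE G M (extL W T ω) v := by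
      intro A hA
      obtain ⟨h1, h2, h3⟩ := Finset.mem_filter.1 hA
      refine Finset.mem_filter.2 ⟨h1, h2, ?_⟩
      rintro f hf ⟨u, hu, hlt⟩
      refine h3 f hf ⟨u, hu, ?_⟩
      have hub : u < B := hB u (pm_sub hM hf hu)
      have : (extL W T ω u + 1) * B ≤ extL W T ω v * B := Nat.mul_le_mul_right _ hlt
      rw [add_mul, one_mul] at this
      simp only
      omega
    apply Real.log_le_log
    · refine Finset.sum_pos (fun A _ => hw A) ⟨e v, Finset.mem_filter.2 ⟨heG v hvW,
        (he v hvW).2, ?_⟩⟩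
      rintro f hf ⟨u, hu, hlt⟩
      rw [Finset.disjoint_iff_inter_eq_empty]
      apply (mem_pmSet_iff.1 hM).2.1 _ (he v hvW).1 f hf
      rintro rfl
      exact absurd (hl (e v) (he v hvW).1 (he v hvW).2 u hu) (not_le.2 hlt)
    · exact Finset.sum_le_sum_of_subset_of_nonneg hsub2 (fun A _ _ => (hw A).le)
  refine (Finset.sum_le_sum fun ω _ => step1 ω).trans ?_
  have swap : ∑ ω : W → Fin T, ∑ v ∈ W, ∑ j ∈ Finset.range T,
      (if ω ∈ F v j then Real.log (Nh ω v) else 0)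
      = ∑ j ∈ Finset.range T, ∑ v ∈ W, ∑ ω ∈ F v j, Real.log (Nh ω v) := by
    rw [Finset.sum_comm]
    rw [Finset.sum_congr rfl (fun v _ => Finset.sum_comm)]
    rw [Finset.sum_comm]
    refine Finset.sum_congr rfl fun j _ => Finset.sum_congr rfl fun v _ => ?_
    rw [← Finset.sum_filter]
    congr 1
    ext ω; simp
  rw [swap, Finset.mul_sum]
  refine Finset.sum_le_sum fun j hj => ?_
  rw [Finset.mem_range] at hj
  have hT : (0 : ℝ) < T := by
    have : 0 < T := by omega
    positivity
  have hjT : (j : ℝ) < T := by exact_mod_cast hj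
  set μ : ℝ := ((T : ℝ) - j) / T with hμ
  have hμ0 : 0 < μ := div_pos (by linarith) hT
  set f : ℝ := (T : ℝ) ^ W.card * (1 / T) * μ ^ (r - 1) with hf
  have hf0 : 0 < f := by positivity
  have hW' : (0 : ℝ) < W.card := by exact_mod_cast hW
  set Sw : ℝ := ∑ A ∈ G, w A with hSw
  have hSw0 : 0 < Sw := by
    obtain ⟨v, hv⟩ := Finset.card_pos.1 hW
    exact Finset.sum_pos (fun A _ => hw A) ⟨e v, heG v hv⟩
  have hr0 : (0 : ℝ) < r := by exact_mod_cast hr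
  set z : ℝ := r * Sw / W.card * μ ^ (r * r - r) + 2 * r * r * c with hz
  have hz0 : 0 < z := by positivity
  have hFcard : ∀ v ∈ W, ((F v j).card : ℝ) = f := by
    intro v hv
    rw [hF]
    simp only
    rw [card_lab_ge W T j hj (e v) (pm_sub hM (he v hv).1) v (he v hv).2, (hG _ (heG v hv)).1]
  set Imp : Finset ℕ → Prop := fun A => ∃ e ∈ M, ∃ x ∈ e, ∃ y ∈ e, x ≠ y ∧ x ∈ A ∧ y ∈ A with hImp
  have hcount : ∀ v ∈ W, ∀ A ∈ G, v ∈ A →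
      (((F v j).filter (fun ω => A ∈ availE G M (extL W T ω) v)).card : ℝ)
        ≤ f * (μ ^ (r * r - r) + if Imp A then 1 else 0) := by
    intro v hv A hA hvA
    have hpn : 0 ≤ μ ^ (r * r - r) := by positivity
    by_cases hi : Imp A
    · rw [if_pos hi]
      calc (((F v j).filter (fun ω => A ∈ availE G M (extL W T ω) v)).card : ℝ)
          ≤ ((F v j).card : ℝ) := by exact_mod_cast Finset.card_filter_le _ _
        _ = f := hFcard v hv
        _ ≤ _ := by nlinarith
    · rw [if_neg hi, add_zero]
      have hAW := (hG A hA).2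
      have hZ : (A.biUnion e) ⊆ W := by
        intro x hx
        obtain ⟨u, hu, hxu⟩ := Finset.mem_biUnion.1 hx
        exact pm_sub hM (he u (hAW hu)).1 hxu
      have hZc : (A.biUnion e).card = r * r := by
        rw [Finset.card_biUnion]
        · rw [Finset.sum_congr rfl (fun u hu => (hG _ (heG u (hAW hu))).1)]
          simp [(hG A hA).1]
        · intro u hu u' hu' hne
          change Disjoint (e u) (e u')
          rw [Finset.disjoint_iff_inter_eq_empty]
          apply (mem_pmSet_iff.1 hM).2.1 _ (he u (hAW hu)).1 _ (he u' (hAW hu')).1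
          intro heq
          apply hi
          refine ⟨e u, (he u (hAW hu)).1, u, (he u (hAW hu)).2, u', ?_, hne, hu, hu'⟩
          rw [heq]; exact (he u' (hAW hu')).2
      have hvZ : v ∈ A.biUnion e := Finset.mem_biUnion.2 ⟨v, hvA, (he v hv).2⟩
      have h1 := card_lab_ge W T j hj (A.biUnion e) hZ v hvZ
      have hsub : (F v j).filter (fun ω => A ∈ availE G M (extL W T ω) v) ⊆
          (Finset.univ : Finset (W → Fin T)).filter (fun ω => extL W T ω v = j ∧
            ∀ x ∈ A.biUnion e, j ≤ extL W T ω x) := by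
        intro ω hω
        obtain ⟨hω1, hω2⟩ := Finset.mem_filter.1 hω
        simp only [hF, Finset.mem_filter, Finset.mem_univ, true_and] at hω1
        obtain ⟨_, _, hav⟩ := Finset.mem_filter.1 hω2
        refine Finset.mem_filter.2 ⟨Finset.mem_univ _, hω1.1, fun x hx => ?_⟩
        obtain ⟨u, hu, hxu⟩ := Finset.mem_biUnion.1 hx
        by_contra hlt
        rw [not_le, ← hω1.1] at hlt
        have hd := hav (e u) (he u (hAW hu)).1 ⟨x, hxu, hlt⟩
        exact (Finset.disjoint_left.1 hd hu) (he u (hAW hu)).2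
      have h2 : (((F v j).filter (fun ω => A ∈ availE G M (extL W T ω) v)).card : ℝ) ≤
          (T : ℝ) ^ W.card * (1 / T) * μ ^ (r * r - 1) := by
        rw [← hZc, hμ, ← h1]
        exact_mod_cast Finset.card_le_card hsub
      refine h2.trans (le_of_eq ?_)
      rw [hf, mul_assoc _ (μ ^ (r - 1)), ← pow_add]
      congr 2
      have : r ≤ r * r := Nat.le_mul_of_pos_left r (by omega)
      omega
  have hdc : ∀ h : Finset ℕ → ℝ, ∑ v ∈ W, ∑ A ∈ G.filter (fun A => v ∈ A), h A
      = r * ∑ A ∈ G, h A := by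
    intro h
    rw [Finset.sum_congr rfl (fun v _ => Finset.sum_filter _ _), Finset.sum_comm, Finset.mul_sum]
    refine Finset.sum_congr rfl fun A hA => ?_
    rw [← Finset.sum_filter, Finset.sum_const, nsmul_eq_mul]
    congr 2
    rw [← (hG A hA).1]
    congr 1
    ext x
    simp only [Finset.mem_filter]
    exact ⟨fun h => h.2, fun h => ⟨(hG A hA).2 h, h⟩⟩
  have hsumN : ∑ v ∈ W, ∑ ω ∈ F v j, Nh ω v ≤ W.card * f * z := by
    have h1 : ∀ v ∈ W, ∑ ω ∈ F v j, Nh ω v ≤ ∑ A ∈ G.filter (fun A => v ∈ A),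
        w A * (f * (μ ^ (r * r - r) + if Imp A then 1 else 0)) := by
      intro v hv
      have : ∀ ω ∈ F v j, Nh ω v = ∑ A ∈ G.filter (fun A => v ∈ A),
          if A ∈ availE G M (extL W T ω) v then w A else 0 := by
        intro ω _
        rw [hNh, ← Finset.sum_filter]
        simp only
        congr 1
        ext A
        simp only [availE, Finset.mem_filter]
        tauto
      rw [Finset.sum_congr rfl this, Finset.sum_comm]
      refine Finset.sum_le_sum fun A hA => ?_
      obtain ⟨hA, hvA⟩ := Finset.mem_filter.1 hA
      rw [← Finset.sum_filter, Finset.sum_const, nsmul_eq_mul, mul_comm]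
      exact mul_le_mul_of_nonneg_left (hcount v hv A hA hvA) (hw A).le
    refine (Finset.sum_le_sum h1).trans ?_
    rw [hdc]
    have h2 : ∑ A ∈ G, w A * (f * (μ ^ (r * r - r) + if Imp A then 1 else 0))
        = f * (μ ^ (r * r - r) * Sw + ∑ A ∈ G.filter Imp, w A) := by
      rw [hSw, Finset.sum_filter, Finset.mul_sum, ← Finset.sum_add_distrib, Finset.mul_sum]
      refine Finset.sum_congr rfl fun A _ => ?_
      split_ifs <;> ring
    have h3 : ∑ A ∈ G.filter Imp, w A ≤ 2 * (W.card * r * c) := by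
      calc ∑ A ∈ G.filter Imp, w A ≤ ∑ A ∈ G.filter Imp, (2 : ℝ) :=
            Finset.sum_le_sum fun A _ => hw2 A
        _ = 2 * ((G.filter Imp).card : ℝ) := by rw [Finset.sum_const, nsmul_eq_mul, mul_comm]
        _ ≤ _ := by
            have := improper_count hG hM c hcnn hc
            have h5 : (G.filter Imp).card = (G.filter (fun A => ∃ e ∈ M, ∃ x ∈ e, ∃ y ∈ e,
              x ≠ y ∧ x ∈ A ∧ y ∈ A)).card := by
              congr 1
            rw [h5]
            linarith
    rw [h2]
    have h4 : (W.card : ℝ) * f * z = r * (f * (μ ^ (r * r - r) * Sw + 2 * (W.card * r * c))) := by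
      rw [hz]; field_simp
    rw [h4]
    apply mul_le_mul_of_nonneg_left _ hr0.le
    apply mul_le_mul_of_nonneg_left _ hf0.le
    linarith
  have hlog : ∀ v ∈ W, ∀ ω ∈ F v j, Real.log (Nh ω v) ≤ Real.log z + (Nh ω v / z - 1) := by
    intro v hv ω hω
    simp only [hF, Finset.mem_filter, Finset.mem_univ, true_and] at hω
    have hpos : 0 < Nh ω v := lt_of_lt_of_le one_pos (hNh1 ω v hv (by
      intro x hx; rw [hω.1]; exact hω.2 x hx))
    have := Real.log_le_sub_one_of_pos (div_pos hpos hz0)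
    rw [Real.log_div hpos.ne' hz0.ne'] at this
    linarith
  calc ∑ v ∈ W, ∑ ω ∈ F v j, Real.log (Nh ω v)
      ≤ ∑ v ∈ W, ∑ ω ∈ F v j, (Real.log z + (Nh ω v / z - 1)) :=
        Finset.sum_le_sum fun v hv => Finset.sum_le_sum fun ω hω => hlog v hv ω hω
    _ = W.card * f * Real.log z + ((∑ v ∈ W, ∑ ω ∈ F v j, Nh ω v) / z - W.card * f) := by
        have : ∀ v ∈ W, ∑ ω ∈ F v j, (Real.log z + (Nh ω v / z - 1))
            = f * Real.log z + ((∑ ω ∈ F v j, Nh ω v) / z - f) := by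
          intro v hv
          rw [Finset.sum_add_distrib, Finset.sum_sub_distrib, Finset.sum_const, Finset.sum_const,
            nsmul_eq_mul, nsmul_eq_mul, hFcard v hv, Finset.sum_div, mul_one]
        rw [Finset.sum_congr rfl this, Finset.sum_add_distrib, Finset.sum_sub_distrib,
          Finset.sum_const, Finset.sum_const, nsmul_eq_mul, nsmul_eq_mul, Finset.sum_div]
        ring
    _ ≤ W.card * f * Real.log z := by
        have : (∑ v ∈ W, ∑ ω ∈ F v j, Nh ω v) / z ≤ W.card * f := by
          rw [div_le_iff₀ hz0]; exact hsumN
        linarith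
    _ = _ := by rw [hf]; ring

theorem ent_main {r : ℕ} (hr : 1 ≤ r) {W : Finset ℕ} {G : Finset (Finset ℕ)}
    (hG : ∀ A ∈ G, A.card = r ∧ A ⊆ W) (hW : 0 < W.card) (hpos : 0 < pmCount W G)
    (c : ℝ) (hcnn : 0 ≤ c)
    (hc : ∀ x ∈ W, ∀ y ∈ W, x ≠ y → (codeg G x y : ℝ) ≤ c)
    (w : Finset ℕ → ℝ) (hw1 : ∀ A, 1 ≤ w A) (hw2 : ∀ A, w A ≤ 2)
    (T : ℕ) (hT : 1 ≤ T) :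
    (pmCount W G : ℝ) * Real.log (pmCount W G) + ∑ M ∈ pmSet W G, ∑ A ∈ M, Real.log (w A)
      ≤ (pmCount W G : ℝ) * (W.card * ∑ j ∈ Finset.range T, (1 / (T : ℝ)) *
        (((T : ℝ) - j) / T) ^ (r - 1) *
        Real.log (r * (∑ A ∈ G, w A) / W.card * (((T : ℝ) - j) / T) ^ (r * r - r)
          + 2 * r * r * c)) := by
  classical
  have hw : ∀ A, 0 < w A := fun A => lt_of_lt_of_le one_pos (hw1 A)
  obtain ⟨B, hB⟩ : ∃ B, ∀ x ∈ W, x < B :=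
    ⟨W.sup id + 1, fun x hx => Nat.lt_succ_of_le (Finset.le_sup (f := id) hx)⟩
  set R : ℝ := ∑ j ∈ Finset.range T, (1 / (T : ℝ)) *
        (((T : ℝ) - j) / T) ^ (r - 1) *
        Real.log (r * (∑ A ∈ G, w A) / W.card * (((T : ℝ) - j) / T) ^ (r * r - r)
          + 2 * r * r * c) with hR
  have h1 : ∀ ω : W → Fin T, _ := fun ω =>
    greedy_log (fun x => extL W T ω x * B + x) w hw W G
      (fun A hA => ⟨Finset.card_pos.1 (by rw [(hG A hA).1]; omega), (hG A hA).2⟩) (by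
        intro x hx y hy hxy
        simp only at hxy
        have hx' := hB x hx
        have hy' := hB y hy
        have e1 : (extL W T ω x * B + x) % B = x := by
          rw [mul_comm, Nat.mul_add_mod, Nat.mod_eq_of_lt hx']
        have e2 : (extL W T ω y * B + y) % B = y := by
          rw [mul_comm, Nat.mul_add_mod, Nat.mod_eq_of_lt hy']
        rw [← e1, hxy, e2]) hpos
  have h2 := Finset.sum_le_sum (s := (Finset.univ : Finset (W → Fin T))) (fun ω _ => h1 ω)
  rw [Finset.sum_const, nsmul_eq_mul, Finset.sum_comm (s := (Finset.univ : Finset (W → Fin T)))] at h2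
  have hcu : ((Finset.univ : Finset (W → Fin T)).card : ℝ) = (T : ℝ) ^ W.card := by
    simp
  rw [hcu] at h2
  have h3 := h2.trans (Finset.sum_le_sum fun M hM =>
    ent_M hr hG hM hW c hcnn hc w hw1 hw2 T B hB)
  rw [Finset.sum_const, nsmul_eq_mul, ← hR] at h3
  have hT0 : (0 : ℝ) < (T : ℝ) ^ W.card := by
    have : (0 : ℝ) < T := by exact_mod_cast hT
    positivity
  have h4 : ((pmSet W G).card : ℝ) * ((T : ℝ) ^ W.card * W.card * R)
      = (T : ℝ) ^ W.card * ((pmCount W G : ℝ) * (W.card * R)) := by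
    rw [pmCount]; ring
  rw [h4] at h3
  exact le_of_mul_le_mul_left h3 hT0

theorem riemann_mono (f : ℝ → ℝ) (hf : MonotoneOn f (Set.Icc 0 1)) :
    Filter.Tendsto (fun T : ℕ => ∑ j ∈ Finset.range T, (1 / (T : ℝ)) * f (((T : ℝ) - j) / T))
      Filter.atTop (nhds (∫ x in (0:ℝ)..1, f x)) := by
  have hrefl : ∀ T : ℕ, ∑ j ∈ Finset.range T, (1 / (T : ℝ)) * f (((T : ℝ) - j) / T)
      = ∑ i ∈ Finset.range T, (1 / (T : ℝ)) * f (((i + 1 : ℕ) : ℝ) / T) := by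
    intro T
    rw [← Finset.sum_range_reflect]
    refine Finset.sum_congr rfl fun j hj => ?_
    have := Finset.mem_range.1 hj
    congr 3
    rw [Nat.sub_sub, Nat.cast_sub (by omega)]
    push_cast
    ring
  have hmono : ∀ T : ℕ, 1 ≤ T → MonotoneOn (fun x : ℝ => (1 / (T : ℝ)) * f (x / T))
      (Set.Icc 0 (0 + (T : ℝ))) := by
    intro T hT x hx y hy hxy
    have hT0 : (0 : ℝ) < T := by exact_mod_cast hT
    apply mul_le_mul_of_nonneg_left _ (by positivity)
    rw [zero_add] at hx hy
    apply hf
    · exact ⟨div_nonneg hx.1 hT0.le, (div_le_one hT0).2 hx.2⟩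
    · exact ⟨div_nonneg hy.1 hT0.le, (div_le_one hT0).2 hy.2⟩
    · gcongr
  have hIntg : ∀ T : ℕ, 1 ≤ T → ∫ x in (0:ℝ)..(0 + (T:ℝ)), (1 / (T : ℝ)) * f (x / T)
      = ∫ x in (0:ℝ)..1, f x := by
    intro T hT
    have hT0 : (T : ℝ) ≠ 0 := by
      have : (0 : ℝ) < T := by exact_mod_cast hT
      exact this.ne'
    rw [intervalIntegral.integral_const_mul, intervalIntegral.integral_comp_div _ hT0, zero_add,
      div_self hT0, zero_div, smul_eq_mul, ← mul_assoc, one_div, inv_mul_cancel₀ hT0, one_mul]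
  have lower : ∀ T : ℕ, 1 ≤ T → (∫ x in (0:ℝ)..1, f x) ≤
      ∑ j ∈ Finset.range T, (1 / (T : ℝ)) * f (((T : ℝ) - j) / T) := by
    intro T hT
    rw [hrefl, ← hIntg T hT]
    have := (hmono T hT).integral_le_sum
    simpa using this
  have upper : ∀ T : ℕ, 1 ≤ T →
      ∑ j ∈ Finset.range T, (1 / (T : ℝ)) * f (((T : ℝ) - j) / T) ≤
      (∫ x in (0:ℝ)..1, f x) + (f 1 - f 0) * (1 / (T : ℝ)) := by
    intro T hT
    have hT0 : (T : ℝ) ≠ 0 := by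
      have : (0 : ℝ) < T := by exact_mod_cast hT
      exact this.ne'
    rw [hrefl, ← hIntg T hT]
    have h1 := (hmono T hT).sum_le_integral
    have h2 := Finset.sum_range_succ (fun i : ℕ => (1 / (T : ℝ)) * f ((i : ℝ) / T)) T
    rw [Finset.sum_range_succ'] at h2
    simp only [zero_add] at h1 ⊢
    simp only [div_self hT0, Nat.cast_zero, zero_div] at h2
    linarith
  have hlim : Filter.Tendsto (fun T : ℕ => (∫ x in (0:ℝ)..1, f x) + (f 1 - f 0) * (1 / (T : ℝ)))
      Filter.atTop (nhds (∫ x in (0:ℝ)..1, f x)) := by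
    have := (tendsto_one_div_atTop_nhds_zero_nat (𝕜 := ℝ)).const_mul (f 1 - f 0)
    simpa using this.const_add (∫ x in (0:ℝ)..1, f x)
  refine tendsto_of_tendsto_of_tendsto_of_le_of_le' tendsto_const_nhds hlim ?_ ?_
  · filter_upwards [Filter.eventually_ge_atTop 1] with T hT using lower T hT
  · filter_upwards [Filter.eventually_ge_atTop 1] with T hT using upper T hT

theorem int_pow_log (r : ℕ) (hr : 2 ≤ r) :
    ∫ x in (0:ℝ)..1, x ^ (r - 1) * Real.log x = -1 / (r : ℝ) ^ 2 := by
  have hr0 : (r : ℝ) ≠ 0 := by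
    have : 0 < r := by omega
    positivity
  have hcont : ∀ k : ℕ, 1 ≤ k → Continuous (fun x : ℝ => x ^ k * Real.log x) := by
    intro k hk
    have : (fun x : ℝ => x ^ k * Real.log x) = fun x => x ^ (k - 1) * (x * Real.log x) := by
      ext x
      rw [← mul_assoc, ← pow_succ]
      congr 2
      omega
    rw [this]
    exact (continuous_pow _).mul Real.continuous_mul_log
  have := intervalIntegral.integral_eq_sub_of_hasDerivAt_of_le (a := (0:ℝ)) (b := 1)
    (f := fun x : ℝ => x ^ r * Real.log x / r - x ^ r / (r : ℝ) ^ 2)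
    (f' := fun x => x ^ (r - 1) * Real.log x) zero_le_one ?_ ?_ ?_
  · rw [this]
    have : r ≠ 0 := by omega
    simp [this]
    ring
  · apply Continuous.continuousOn
    exact ((hcont r (by omega)).div_const _).sub ((continuous_pow r).div_const _)
  · intro x hx
    have h1 := hasDerivAt_pow r x
    have h2 := Real.hasDerivAt_log hx.1.ne'
    have h3 := ((h1.mul h2).div_const (r : ℝ)).sub (h1.div_const ((r : ℝ) ^ 2))
    refine h3.congr_deriv ?_
    have hx0 : x ≠ 0 := hx.1.ne'
    have : x ^ r = x ^ (r - 1) * x := by rw [← pow_succ]; congr 1; omega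
    rw [this]
    field_simp
    ring
  · exact (hcont (r - 1) (by omega)).intervalIntegrable _ _

theorem int_kappa (r : ℕ) (hr : 2 ≤ r) (η : ℝ) (hη : 0 < η) :
    ∃ κ : ℝ, 0 < κ ∧ ∫ x in (0:ℝ)..1, x ^ (r - 1) * Real.log (x ^ (r * r - r) + κ)
      ≤ -((r : ℝ) - 1) / r + η := by
  set a := r * r - r with ha
  have hlim : Filter.Tendsto (fun k : ℕ => ∫ x in (0:ℝ)..1, x ^ (r - 1) *
      Real.log (x ^ a + 1 / ((k : ℝ) + 1))) Filter.atTop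
      (nhds (∫ x in (0:ℝ)..1, x ^ (r - 1) * Real.log (x ^ a))) := by
    apply intervalIntegral.tendsto_integral_filter_of_dominated_convergence
      (fun x => 1 + a * |x ^ (r - 1) * Real.log x|)
    · filter_upwards with k
      apply Measurable.aestronglyMeasurable
      fun_prop
    · filter_upwards with k
      filter_upwards with x hx
      rw [Set.uIoc_of_le zero_le_one] at hx
      have hx0 : 0 < x := hx.1
      have hk0 : (0:ℝ) < 1 / ((k : ℝ) + 1) := by positivity
      have hk1 : 1 / ((k : ℝ) + 1) ≤ 1 := by
        rw [div_le_one (by positivity)]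
        have : (0:ℝ) ≤ k := Nat.cast_nonneg k
        linarith
      have hxa : 0 < x ^ a := pow_pos hx0 _
      have hxa1 : x ^ a ≤ 1 := pow_le_one₀ hx0.le hx.2
      have hxr : 0 < x ^ (r - 1) := pow_pos hx0 _
      have hxr1 : x ^ (r - 1) ≤ 1 := pow_le_one₀ hx0.le hx.2
      have hlogx : Real.log x ≤ 0 := Real.log_nonpos hx0.le hx.2
      rw [Real.norm_eq_abs, abs_mul, abs_mul, abs_of_pos hxr, abs_of_nonpos hlogx]
      have hup : Real.log (x ^ a + 1 / ((k : ℝ) + 1)) ≤ 1 := by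
        have := Real.log_le_sub_one_of_pos (x := x ^ a + 1 / ((k : ℝ) + 1)) (by linarith)
        linarith
      have hlo : a * Real.log x ≤ Real.log (x ^ a + 1 / ((k : ℝ) + 1)) := by
        rw [← Real.log_pow]
        exact Real.log_le_log hxa (by linarith)
      have ha0 : (0:ℝ) ≤ a := Nat.cast_nonneg a
      have h1 : |Real.log (x ^ a + 1 / ((k : ℝ) + 1))| ≤ 1 + a * (-Real.log x) := by
        rw [abs_le]
        have : 0 ≤ a * (-Real.log x) := mul_nonneg ha0 (by linarith)
        constructor <;> linarith
      have h2 := mul_le_mul_of_nonneg_left h1 hxr.le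
      nlinarith
    · apply Continuous.intervalIntegrable
      have : (fun x : ℝ => x ^ (r - 1) * Real.log x) = fun x => x ^ (r - 2) * (x * Real.log x) := by
        ext x
        rw [← mul_assoc, ← pow_succ]
        congr 2
        omega
      have hc : Continuous (fun x : ℝ => x ^ (r - 1) * Real.log x) := by
        rw [this]
        exact (continuous_pow _).mul Real.continuous_mul_log
      exact continuous_const.add (continuous_const.mul hc.abs)
    · filter_upwards with x hx
      rw [Set.uIoc_of_le zero_le_one] at hx
      apply Filter.Tendsto.const_mul
      have hxa : x ^ a ≠ 0 := (pow_pos hx.1 _).ne'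
      have h1 := (tendsto_one_div_add_atTop_nhds_zero_nat (𝕜 := ℝ)).const_add (x ^ a)
      rw [add_zero] at h1
      exact h1.log hxa
  have hval : ∫ x in (0:ℝ)..1, x ^ (r - 1) * Real.log (x ^ a) = -((r : ℝ) - 1) / r := by
    have : ∀ x : ℝ, x ^ (r - 1) * Real.log (x ^ a) = a * (x ^ (r - 1) * Real.log x) := by
      intro x; rw [Real.log_pow]; ring
    simp only [this]
    rw [intervalIntegral.integral_const_mul, int_pow_log r hr, ha,
      Nat.cast_sub (Nat.le_mul_of_pos_left r (by omega))]
    have hr0 : (r : ℝ) ≠ 0 := by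
      have : 0 < r := by omega
      positivity
    push_cast
    field_simp
  rw [hval] at hlim
  obtain ⟨k, hk⟩ := ((hlim.eventually (gt_mem_nhds (lt_add_of_pos_right _ hη)))).exists
  exact ⟨1 / ((k : ℝ) + 1), by positivity, hk.le⟩

theorem rie (r : ℕ) (hr : 2 ≤ r) (η : ℝ) (hη : 0 < η) :
    ∃ κ : ℝ, 0 < κ ∧ ∀ L : ℝ, ∃ T : ℕ, 1 ≤ T ∧
      ∑ j ∈ Finset.range T, (1 / (T : ℝ)) * (((T : ℝ) - j) / T) ^ (r - 1) *
        (L + Real.log ((((T : ℝ) - j) / T) ^ (r * r - r) + κ)) ≤ (L - ((r : ℝ) - 1)) / r + η := by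
  obtain ⟨κ, hκ, hI⟩ := int_kappa r hr (η / 2) (by positivity)
  refine ⟨κ, hκ, fun L => ?_⟩
  set a := r * r - r with ha
  have m1 : MonotoneOn (fun x : ℝ => x ^ (r - 1)) (Set.Icc 0 1) := by
    intro x hx y hy hxy
    exact pow_le_pow_left₀ hx.1 hxy _
  have m2 : MonotoneOn (fun x : ℝ => x ^ (r - 1) * (Real.log (x ^ a + κ) - Real.log κ))
      (Set.Icc 0 1) := by
    intro x hx y hy hxy
    have hx0 := hx.1
    have hxa : 0 ≤ x ^ a := pow_nonneg hx0 _
    have hy0 : 0 ≤ y := hy.1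
    have h1 : Real.log κ ≤ Real.log (x ^ a + κ) := Real.log_le_log hκ (by linarith)
    have h2 : Real.log (x ^ a + κ) ≤ Real.log (y ^ a + κ) :=
      Real.log_le_log (by linarith) (by gcongr)
    apply mul_le_mul (pow_le_pow_left₀ hx0 hxy _) (by linarith) (by linarith) (by positivity)
  have t1 := (riemann_mono _ m1).const_mul (L + Real.log κ)
  have t2 := t1.add (riemann_mono _ m2)
  have e1 : ∫ x in (0:ℝ)..1, x ^ (r - 1) = 1 / r := by
    rw [integral_pow]
    have : r ≠ 0 := by omega
    simp only [one_pow, zero_pow (Nat.succ_ne_zero _), sub_zero]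
    congr 1
    rw [Nat.cast_sub (by omega)]; push_cast; ring
  have hi1 : IntervalIntegrable (fun x : ℝ => x ^ (r - 1)) MeasureTheory.volume 0 1 :=
    (continuous_pow _).intervalIntegrable _ _
  have hi2 : IntervalIntegrable (fun x : ℝ => x ^ (r - 1) * (Real.log (x ^ a + κ) - Real.log κ))
      MeasureTheory.volume 0 1 := by
    apply MonotoneOn.intervalIntegrable
    rwa [Set.uIcc_of_le zero_le_one]
  have e2 : ∫ x in (0:ℝ)..1, x ^ (r - 1) * (Real.log (x ^ a + κ) - Real.log κ)
      = (∫ x in (0:ℝ)..1, x ^ (r - 1) * Real.log (x ^ a + κ)) - Real.log κ * (1 / r) := by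
    have : ∫ x in (0:ℝ)..1, x ^ (r - 1) * Real.log (x ^ a + κ)
        = ∫ x in (0:ℝ)..1, (x ^ (r - 1) * (Real.log (x ^ a + κ) - Real.log κ)
          + Real.log κ * x ^ (r - 1)) := by
      congr 1; ext x; ring
    rw [this, intervalIntegral.integral_add hi2 (hi1.const_mul _),
      intervalIntegral.integral_const_mul, e1]
    ring
  rw [e1, e2] at t2
  have hlt : (L + Real.log κ) * (1 / (r : ℝ)) +
      ((∫ x in (0:ℝ)..1, x ^ (r - 1) * Real.log (x ^ a + κ)) - Real.log κ * (1 / r))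
      < (L - ((r : ℝ) - 1)) / r + η := by
    have : (L - ((r : ℝ) - 1)) / r = L * (1 / r) + -((r : ℝ) - 1) / r := by ring
    rw [this]
    linarith
  obtain ⟨T, hT1, hT2⟩ := ((Filter.eventually_ge_atTop 1).and
    (t2.eventually (gt_mem_nhds hlt))).exists
  refine ⟨T, hT1, le_trans (le_of_eq ?_) hT2.le⟩
  rw [Finset.mul_sum, ← Finset.sum_add_distrib]
  refine Finset.sum_congr rfl fun j _ => ?_
  ring

theorem lemU (r : ℕ) (hr : 2 ≤ r) (η : ℝ) (hη : 0 < η) :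
    ∃ θ : ℝ, 0 < θ ∧ ∃ c0 : ℝ, 0 < c0 ∧ ∀ (W : Finset ℕ) (G : Finset (Finset ℕ)) (m : ℝ),
      (∀ A ∈ G, A.card = r ∧ A ⊆ W) → 0 < W.card → 0 < m → (G.card : ℝ) ≤ m →
      0 < pmCount W G →
      (∀ x ∈ W, ∀ y ∈ W, x ≠ y → (codeg G x y : ℝ) ≤ c0 * (r * m / W.card)) →
      ((W.card : ℝ) / r) * (Real.log (r * m / W.card) - ((r : ℝ) - 1)) - θ * W.card
        ≤ Real.log (pmCount W G) →
      ∀ Y ⊆ G, ∑ M ∈ pmSet W G, ((M ∩ Y).card : ℝ)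
        ≤ ((W.card : ℝ) / r) * (Y.card / m + η) * pmCount W G := by
  have hr0 : (0:ℝ) < r := by
    have : 0 < r := by omega
    positivity
  set ξ : ℝ := min 1 η with hξ
  have hξ0 : 0 < ξ := lt_min one_pos hη
  have hξ1 : ξ ≤ 1 := min_le_left _ _
  have hξη : ξ ≤ η := min_le_right _ _
  obtain ⟨κ, hκ, hrie⟩ := rie r hr (η * ξ / (4 * r)) (by positivity)
  refine ⟨η * ξ / (4 * r), by positivity, κ / (2 * r * r), by positivity, ?_⟩
  intro W G m hG hW hm hGm hpos hcod hlow Y hY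
  have hn : (0:ℝ) < W.card := by exact_mod_cast hW
  set n0 : ℝ := (W.card : ℝ) with hn0
  set Φ : ℝ := (pmCount W G : ℝ) with hΦ
  have hΦ0 : 0 < Φ := by rw [hΦ]; exact_mod_cast hpos
  set y : ℝ := Y.card / m with hy
  have hy0 : 0 ≤ y := by positivity
  set D : ℝ := r * m / n0 with hD
  have hD0 : 0 < D := by positivity
  set B : ℝ := D * (1 + ξ * y) with hB
  have hB1 : D ≤ B := by
    have : 0 ≤ ξ * y := by positivity
    nlinarith
  have hB0 : 0 < B := by linarith
  have hlogB : Real.log B ≤ Real.log D + ξ * y := by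
    rw [hB, Real.log_mul hD0.ne' (by positivity)]
    have := Real.log_le_sub_one_of_pos (x := 1 + ξ * y) (by positivity)
    linarith
  obtain ⟨T, hT, hTs⟩ := hrie (Real.log B)
  let w : Finset ℕ → ℝ := fun A => if A ∈ Y then 1 + ξ else 1
  have hent := ent_main (by omega : 1 ≤ r) hG hW hpos (κ / (2 * r * r) * D) (by positivity) hcod w
    (by intro A; simp only [w]; split_ifs <;> linarith)
    (by intro A; simp only [w]; split_ifs <;> linarith) T hT
  have hsumw : r * (∑ A ∈ G, w A) / n0 ≤ B := by
    have h1 : ∑ A ∈ G, w A = G.card + ξ * Y.card := by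
      have : ∀ A, w A = 1 + (if A ∈ Y then ξ else 0) := by
        intro A; simp only [w]; split_ifs <;> ring
      simp only [this]
      rw [Finset.sum_add_distrib, ← Finset.sum_filter, Finset.sum_const, Finset.sum_const]
      have : G.filter (fun A => A ∈ Y) = Y := by
        ext A; simp only [mem_filter]; exact ⟨fun h => h.2, fun h => ⟨hY h, h⟩⟩
      rw [this]; simp; ring
    rw [h1]
    have h2 : B = r * (m + ξ * Y.card) / n0 := by
      rw [hB, hD, hy]; field_simp
    rw [h2]
    gcongr
  have hlogw : ∀ M, ∑ A ∈ M, Real.log (w A) = ((M ∩ Y).card : ℝ) * Real.log (1 + ξ) := by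
    intro M
    have : ∀ A, Real.log (w A) = if A ∈ Y then Real.log (1 + ξ) else 0 := by
      intro A; simp only [w]; split_ifs <;> simp
    simp only [this]
    rw [← Finset.sum_filter, Finset.sum_const, Finset.filter_mem_eq_inter, nsmul_eq_mul]
  simp only [hlogw] at hent
  rw [← Finset.sum_mul] at hent
  set S : ℝ := ∑ M ∈ pmSet W G, ((M ∩ Y).card : ℝ) with hS
  have hS0 : 0 ≤ S := Finset.sum_nonneg fun _ _ => Nat.cast_nonneg _
  have hTpos : (0:ℝ) < T := by exact_mod_cast hT
  have hsum : ∑ j ∈ range T, (1/(T:ℝ))*(((T:ℝ)-j)/T)^(r-1)*Real.log (r*(∑ A∈G, w A)/n0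
      *(((T:ℝ)-j)/T)^(r*r-r) + 2*r*r*(κ / (2 * r * r) * D)) ≤ (Real.log B - ((r:ℝ)-1))/r
        + η * ξ / (4 * r) := by
    refine le_trans (Finset.sum_le_sum fun j hj => ?_) hTs
    have hj : (j:ℝ) < T := by exact_mod_cast Finset.mem_range.mp hj
    have hμ : 0 < ((T:ℝ)-j)/T := div_pos (by linarith) hTpos
    refine mul_le_mul_of_nonneg_left ?_ (by positivity)
    have hμa : 0 < (((T:ℝ)-j)/T)^(r*r-r) := pow_pos hμ _
    rw [← Real.log_mul hB0.ne' (by positivity)]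
    have hκD : 2*r*r*(κ / (2 * r * r) * D) = κ * D := by field_simp
    rw [hκD]
    have hw0 : 0 ≤ r*(∑ A∈G, w A)/n0 := by
      have : 0 ≤ ∑ A∈G, w A := Finset.sum_nonneg fun A _ => by
        simp only [w]; split_ifs <;> linarith
      positivity
    apply Real.log_le_log (by positivity)
    rw [mul_add]
    have h1 := mul_le_mul_of_nonneg_right hsumw hμa.le
    have h2 := mul_le_mul_of_nonneg_left hB1 hκ.le
    linarith
  have hent2 : Φ * Real.log Φ + S * Real.log (1 + ξ) ≤ Φ * (n0 * ((Real.log B - ((r:ℝ)-1))/r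
        + η * ξ / (4 * r))) := by
    refine hent.trans ?_
    gcongr
  have hl : ξ * (1 - ξ / 2) ≤ Real.log (1 + ξ) := by
    refine le_trans ?_ (Real.le_log_one_add_of_nonneg hξ0.le)
    rw [le_div_iff₀ (by linarith)]
    nlinarith [mul_pos hξ0 hξ0, mul_pos (mul_pos hξ0 hξ0) hξ0]
  have hSle : S ≤ Φ * (n0 / r) := by
    have : ∀ M ∈ pmSet W G, ((M ∩ Y).card : ℝ) ≤ n0 / r := by
      intro M hM
      rw [le_div_iff₀ hr0]
      have h1 := pm_card_mul (fun A hA => (hG A hA).1) hM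
      have h2 : (M ∩ Y).card ≤ M.card := Finset.card_le_card Finset.inter_subset_left
      rw [hn0, ← h1]
      push_cast
      have : ((M ∩ Y).card : ℝ) ≤ M.card := by exact_mod_cast h2
      gcongr
    have := Finset.sum_le_card_nsmul _ _ _ this
    rw [nsmul_eq_mul] at this
    exact this
  have hlow2 : Φ * ((n0 / r) * (Real.log D - ((r : ℝ) - 1)) - η * ξ / (4 * r) * n0) ≤ Φ * Real.log Φ :=
    mul_le_mul_of_nonneg_left hlow hΦ0.le
  have hlB2 : Φ * (n0 * (Real.log B / r)) ≤ Φ * (n0 * ((Real.log D + ξ * y) / r)) := by gcongr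
  have h1 : S * (ξ * (1 - ξ / 2)) ≤ S * Real.log (1 + ξ) := mul_le_mul_of_nonneg_left hl hS0
  have h2 : S * (ξ * ξ / 2) ≤ Φ * (n0 / r) * (ξ * ξ / 2) := by gcongr
  have key : S * ξ ≤ ξ * ((n0 / r) * (y + η) * Φ) := by
    have e1 : Φ * (n0 * ((Real.log B - ((r:ℝ)-1))/r + η * ξ / (4 * r)))
      = Φ * (n0 * (Real.log B / r)) - Φ * (n0 / r) * ((r:ℝ)-1) + Φ * (n0 / r) * (η * ξ / 4) := by
      field_simp
    have e2 : Φ * (n0 * ((Real.log D + ξ * y) / r)) = Φ * (n0 / r) * Real.log D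
      + ξ * ((n0 / r) * y * Φ) := by field_simp
    have e3 : Φ * ((n0 / r) * (Real.log D - ((r : ℝ) - 1)) - η * ξ / (4 * r) * n0)
      = Φ * (n0 / r) * Real.log D - Φ * (n0 / r) * ((r:ℝ)-1) - Φ * (n0 / r) * (η * ξ / 4) := by
      field_simp
    rw [e1] at hent2
    rw [e2] at hlB2
    rw [e3] at hlow2
    have h3 : Φ * (n0 / r) * (ξ * ξ / 2) ≤ Φ * (n0 / r) * (η * ξ / 2) := by gcongr
    have h4 : ξ * ((n0 / r) * (y + η) * Φ) = ξ * ((n0 / r) * y * Φ) + Φ * (n0 / r) * (η * ξ / 2)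
       + Φ * (n0 / r) * (η * ξ / 4) + Φ * (n0 / r) * (η * ξ / 4) := by ring
    rw [h4]
    linarith
  rw [mul_comm] at key
  exact le_of_mul_le_mul_left key hξ0

theorem log_fact_upper (k : ℕ) (hk : 1 ≤ k) :
    Real.log (k.factorial : ℝ) ≤ k * Real.log k - k + Real.log k + 1 := by
  induction k, hk using Nat.le_induction with
  | base => simp
  | succ k hk ih =>
    rw [Nat.factorial_succ]
    have hk0 : (0:ℝ) < k := by exact_mod_cast hk
    push_cast
    rw [Real.log_mul (by positivity) (by positivity)]
    -- need (k+1) (log (k+1) - log k) ≥ 1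
    have h1 : 1 ≤ ((k:ℝ) + 1) * (Real.log (k + 1) - Real.log k) := by
      rw [← Real.log_div (by positivity) hk0.ne']
      have := Real.one_sub_inv_le_log_of_pos (x := ((k:ℝ)+1)/k) (by positivity)
      have e : 1 - (((k:ℝ)+1)/k)⁻¹ = 1 / (k + 1) := by field_simp; ring
      rw [e] at this
      have h := mul_le_mul_of_nonneg_left this (by positivity : (0:ℝ) ≤ k + 1)
      rwa [mul_one_div_cancel (by positivity)] at h
    nlinarith

theorem log_fact_lower (n : ℕ) : n * Real.log n - n ≤ Real.log (n.factorial : ℝ) := by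
  rcases Nat.eq_zero_or_pos n with rfl | hn
  · simp
  have h := Real.pow_div_factorial_le_exp (n : ℝ) (Nat.cast_nonneg n) n
  have hn0 : (0:ℝ) < n := by exact_mod_cast hn
  have h2 := Real.log_le_log (by positivity) h
  rw [Real.log_exp, Real.log_div (by positivity) (by positivity), Real.log_pow] at h2
  linarith

theorem sum_inv_le (N t : ℕ) (ht : t < N) :
    ∑ i ∈ Finset.Icc 1 t, 1 / ((N : ℝ) - (i : ℝ) + 1) ≤ Real.log N - Real.log ((N : ℝ) - t) := by
  induction t with
  | zero => simp
  | succ t ih =>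
    rw [Finset.sum_Icc_succ_top (by omega)]
    have h := ih (by omega)
    have ht' : ((t + 1 : ℕ) : ℝ) < N := by exact_mod_cast ht
    push_cast at ht' ⊢
    have h1 : 1 / ((N : ℝ) - (t + 1) + 1) ≤ Real.log ((N : ℝ) - t) - Real.log ((N : ℝ) - (t + 1)) := by
      rw [← Real.log_div (by linarith) (by linarith)]
      have := Real.one_sub_inv_le_log_of_pos (x := ((N : ℝ) - t) / ((N : ℝ) - (t + 1)))
        (div_pos (by linarith) (by linarith))
      refine le_trans (le_of_eq ?_) this
      have h3 : (N : ℝ) - t ≠ 0 := by linarith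
      rw [inv_div]
      have : (N : ℝ) - (t + 1) + 1 = N - t := by ring
      rw [this]
      field_simp
      ring
    linarith

theorem lemH0 (r n : ℕ) (hr : 2 ≤ r) (hn : 0 < n) (hrn : r ∣ n) (H : Finset (Finset ℕ))
    (hH : H ⊆ Kn n r) (hm : 0 < H.card) (δ : ℝ) (hA : propA r n H δ) :
    ((n : ℝ) / r) * (Real.log (r * H.card / n) - ((r : ℝ) - 1)) - δ * n - Real.log n - 1
      ≤ Real.log (pmCount (Finset.range n) H) := by
  obtain ⟨k, rfl⟩ := hrn
  have hr0 : 0 < r := by omega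
  have hk : 0 < k := Nat.pos_of_mul_pos_left hn
  have hrR : (0:ℝ) < r := by exact_mod_cast hr0
  have hkR : (0:ℝ) < k := by exact_mod_cast hk
  set m := H.card with hmdef
  have hmR : (0:ℝ) < m := by exact_mod_cast hm
  set N := (r * k).choose r with hN
  have hmN : m ≤ N := by
    have := Finset.card_le_card hH
    rwa [Kn, Finset.card_powersetCard, Finset.card_range] at this
  have hNR : (0:ℝ) < N := by
    have : 0 < N := by omega
    exact_mod_cast this
  unfold propA at hA
  rw [Nat.mul_div_cancel_left k hr0, ← hN, ← hmdef] at hA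
  refine le_trans ?_ hA.le
  have hs := sum_inv_le N (N - m) (by omega)
  have hs2 : ∑ i ∈ Finset.Icc 1 (N - m), (((r * k : ℕ) : ℝ) / r) / ((N : ℝ) - (i : ℝ) + 1)
      ≤ k * (Real.log N - Real.log m) := by
    have e : (((r * k : ℕ) : ℝ) / r) = k := by push_cast; field_simp
    rw [e]
    rw [Nat.cast_sub hmN, sub_sub_cancel] at hs
    have := mul_le_mul_of_nonneg_left hs hkR.le
    rw [Finset.mul_sum] at this
    refine le_trans (le_of_eq ?_) this
    exact Finset.sum_congr rfl fun i _ => by ring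
  have hNle : Real.log N ≤ r * Real.log ((r * k : ℕ) : ℝ) - Real.log (r.factorial : ℝ) := by
    have h := Nat.choose_le_pow_div (α := ℝ) r (r * k)
    have h2 := Real.log_le_log hNR h
    rwa [Real.log_div (by positivity) (by positivity), Real.log_pow] at h2
  have hf1 := log_fact_lower (r * k)
  have hf2 := log_fact_upper k hk
  have hlk : Real.log k ≤ Real.log ((r * k : ℕ) : ℝ) := by
    apply Real.log_le_log hkR
    exact_mod_cast Nat.le_mul_of_pos_left k hr0
  have e1 : (((r * k : ℕ) : ℝ) / r) = k := by push_cast; field_simp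
  have e2 : (r * (m : ℝ) / ((r * k : ℕ) : ℝ)) = m / k := by push_cast; field_simp
  rw [e1] at hs2
  rw [e1, e2, Real.log_div hmR.ne' hkR.ne', Real.log_div (by positivity) (by positivity),
    Real.log_mul (by positivity) (by positivity), Real.log_pow]
  have h3 := mul_le_mul_of_nonneg_left hNle hkR.le
  push_cast at *
  nlinarith

theorem lemH (r : ℕ) (hr : 2 ≤ r) (θ : ℝ) (hθ : 0 < θ) :
    ∃ d0 : ℝ, 0 < d0 ∧ ∀ᶠ n : ℕ in Filter.atTop, r ∣ n → ∀ H : Finset (Finset ℕ), H ⊆ Kn n r →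
      ((n : ℝ) / r) * Real.log n ≤ H.card → ∀ δ : ℝ, δ ≤ d0 → propA r n H δ →
      0 < pmCount (Finset.range n) H ∧
      ((n : ℝ) / r) * (Real.log (r * H.card / n) - ((r : ℝ) - 1)) - θ * n
      ≤ Real.log (pmCount (Finset.range n) H) := by
  refine ⟨θ / 2, by positivity, ?_⟩
  have hr0 : 0 < r := by omega
  have hrR : (0:ℝ) < r := by exact_mod_cast hr0
  have t1 : ∀ᶠ n : ℕ in Filter.atTop, Real.log n + 1 ≤ θ / 2 * n := by
    have h1 := (Real.isLittleO_log_id_atTop.comp_tendsto tendsto_natCast_atTop_atTop).bound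
      (show 0 < θ / 4 by positivity)
    have h2 := (tendsto_natCast_atTop_atTop (R := ℝ)).eventually_ge_atTop (4 / θ)
    filter_upwards [h1, h2] with n h1 h2
    simp only [Function.comp, id, Real.norm_eq_abs] at h1
    rw [abs_of_nonneg (Nat.cast_nonneg n : (0:ℝ) ≤ n)] at h1
    rw [div_le_iff₀ hθ] at h2
    have := le_abs_self (Real.log n)
    nlinarith
  have t2 : ∀ᶠ n : ℕ in Filter.atTop, r * θ + r ≤ Real.log (Real.log n) :=
    ((Real.tendsto_log_atTop.comp (Real.tendsto_log_atTop.comp tendsto_natCast_atTop_atTop))).eventually_ge_atTop _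
  have t3 : ∀ᶠ n : ℕ in Filter.atTop, 1 ≤ Real.log n :=
    (Real.tendsto_log_atTop.comp tendsto_natCast_atTop_atTop).eventually_ge_atTop 1
  filter_upwards [t1, t2, t3, Filter.eventually_gt_atTop 0] with n h1 h2 h3 hn hrn H hH hHm δ hδ hA
  have hnR : (0:ℝ) < n := by exact_mod_cast hn
  have hm : (0:ℝ) < H.card := lt_of_lt_of_le (by positivity) hHm
  have h0 := lemH0 r n hr hn hrn H hH (by exact_mod_cast hm) δ hA
  have hδn : δ * n ≤ θ / 2 * n := by gcongr
  have hfin : ((n : ℝ) / r) * (Real.log (r * H.card / n) - ((r : ℝ) - 1)) - θ * n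
      ≤ Real.log (pmCount (Finset.range n) H) := by linarith
  refine ⟨?_, hfin⟩
  by_contra hcon
  have hz : pmCount (Finset.range n) H = 0 := by omega
  rw [hz] at hfin
  simp only [Nat.cast_zero, Real.log_zero] at hfin
  have hD : Real.log n ≤ r * H.card / n := by
    rw [le_div_iff₀ hnR]
    have := mul_le_mul_of_nonneg_left hHm hrR.le
    have e : (r:ℝ) * (n / r * Real.log n) = Real.log n * n := by field_simp
    linarith
  have h4 := Real.log_le_log (by linarith) hD
  have h5 : ((n : ℝ) / r) * (r * θ + 1) ≤
      ((n : ℝ) / r) * (Real.log (r * H.card / n) - ((r : ℝ) - 1)) := by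
    gcongr; linarith
  have e : ((n : ℝ) / r) * (r * θ + 1) = n * θ + n / r := by field_simp
  have : 0 < (n : ℝ) / r := by positivity
  linarith

theorem choose_upper (m s u : ℕ) (hu : u ≤ m) (hm : 0 < m) :
    ((m - u).choose s : ℝ) ≤ (m.choose s : ℝ) * Real.exp (-((s : ℝ) * u / m)) := by
  have hmR : (0:ℝ) < m := by exact_mod_cast hm
  induction u with
  | zero => simp
  | succ u ih =>
    have ih := ih (by omega)
    by_cases hs : s ≤ m - (u + 1)
    · have h1 := Nat.choose_mul_succ_eq (m - (u + 1)) s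
      have e : m - (u + 1) + 1 = m - u := by omega
      rw [e] at h1
      have hcast : ((m - (u+1)).choose s : ℝ) * ((m : ℝ) - u) = ((m - u).choose s : ℝ) * ((m : ℝ) - u - s) := by
        have : (((m - u : ℕ)) : ℝ) = (m : ℝ) - u := by rw [Nat.cast_sub (by omega)]
        have h2 : (((m - u - s : ℕ)) : ℝ) = (m : ℝ) - u - s := by
          rw [Nat.cast_sub (by omega), this]
        rw [← h2, ← this]
        exact_mod_cast h1
      have hmu : (0:ℝ) < (m : ℝ) - u := by
        have : ((u + 1 : ℕ) : ℝ) ≤ m := by exact_mod_cast hu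
        push_cast at this; linarith
      have h3 : ((m : ℝ) - u - s) / ((m : ℝ) - u) ≤ Real.exp (-((s : ℝ) / m)) := by
        have h4 := Real.add_one_le_exp (-((s : ℝ) / m))
        refine le_trans ?_ h4
        have : ((m : ℝ) - u - s) / ((m : ℝ) - u) = 1 - s / ((m : ℝ) - u) := by field_simp
        rw [this]
        have h5 : (s : ℝ) / m ≤ s / ((m : ℝ) - u) := by
          apply div_le_div_of_nonneg_left (Nat.cast_nonneg s) hmu
          have : (0:ℝ) ≤ u := Nat.cast_nonneg u
          linarith
        linarith
      have h6 : ((m - (u+1)).choose s : ℝ) = ((m - u).choose s : ℝ) * (((m : ℝ) - u - s) / ((m : ℝ) - u)) := by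
        field_simp
        exact hcast
      rw [h6]
      have h7 : Real.exp (-((s : ℝ) * ((u + 1 : ℕ) : ℝ) / m)) =
          Real.exp (-((s : ℝ) * u / m)) * Real.exp (-((s : ℝ) / m)) := by
        rw [← Real.exp_add]; congr 1; push_cast; ring
      rw [h7, ← mul_assoc]
      calc _ ≤ ((m - u).choose s : ℝ) * Real.exp (-((s : ℝ) / m)) := by gcongr
        _ ≤ _ := by gcongr
    · rw [Nat.choose_eq_zero_of_lt (by omega)]
      simp only [Nat.cast_zero]
      positivity

theorem choose_lower (m k s t : ℕ) (hst : s ≤ t) (htm : t < m) (hk : k ≤ m - t) :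
    (m.choose s : ℝ) * (1 - (k : ℝ) / ((m : ℝ) - t)) ^ s ≤ ((m - k).choose s : ℝ) := by
  have htR : (t : ℝ) < m := by exact_mod_cast htm
  have hkR : (k : ℝ) ≤ (m : ℝ) - t := by
    rw [← Nat.cast_sub htm.le]; exact_mod_cast hk
  set y : ℝ := 1 - (k : ℝ) / ((m : ℝ) - t) with hy
  have hy0 : 0 ≤ y := by
    rw [hy, sub_nonneg, div_le_one (by linarith)]; exact hkR
  induction s with
  | zero => simp
  | succ s ih =>
    have ih := ih (by omega)
    have h1 := Nat.choose_succ_right_eq m s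
    have h2 := Nat.choose_succ_right_eq (m - k) s
    have h1' : (m.choose (s+1) : ℝ) * (s + 1) = (m.choose s : ℝ) * ((m : ℝ) - s) := by
      rw [← Nat.cast_sub (by omega)]; exact_mod_cast h1
    have h2' : ((m-k).choose (s+1) : ℝ) * (s + 1) = ((m-k).choose s : ℝ) * ((m : ℝ) - k - s) := by
      rw [← Nat.cast_sub (by omega), ← Nat.cast_sub (by omega)]; exact_mod_cast h2
    have hs1 : (0:ℝ) < (s : ℝ) + 1 := by positivity
    have hst' : (s : ℝ) ≤ t := by exact_mod_cast (by omega : s ≤ t)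
    have hms : (0:ℝ) < (m : ℝ) - s := by linarith
    have h3 : ((m : ℝ) - s) * y ≤ (m : ℝ) - k - s := by
      have : (k : ℝ) / ((m : ℝ) - s) ≤ (k : ℝ) / ((m : ℝ) - t) := by
        apply div_le_div_of_nonneg_left (Nat.cast_nonneg k) (by linarith) (by linarith)
      have h4 := mul_le_mul_of_nonneg_left this hms.le
      rw [mul_div_cancel₀ _ hms.ne'] at h4
      rw [hy]; linarith
    have h5 : (0:ℝ) ≤ (m : ℝ) - k - s := by
      linarith
    have : (m.choose (s+1) : ℝ) * y ^ (s+1) * (s + 1) ≤ ((m-k).choose (s+1) : ℝ) * (s + 1) := by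
      rw [h2']
      calc (m.choose (s+1) : ℝ) * y ^ (s+1) * (s + 1) = ((m.choose (s+1) : ℝ) * (s + 1)) * y^(s+1) := by ring
        _ = ((m.choose s : ℝ) * y ^ s) * (((m : ℝ) - s) * y) := by rw [h1', pow_succ]; ring
        _ ≤ ((m-k).choose s : ℝ) * ((m : ℝ) - k - s) := by
          apply mul_le_mul ih h3 (by positivity) (by positivity)
    exact le_of_mul_le_mul_right this hs1

theorem one_sub_ge_exp (x : ℝ) (h0 : 0 ≤ x) (h1 : x ≤ 1 / 2) :
    Real.exp (-(x + x ^ 2)) ≤ 1 - x := by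
  have hp : 0 < 1 - x := by linarith
  rw [Real.exp_neg, inv_le_comm₀ (Real.exp_pos _) hp]
  refine le_trans ?_ (Real.quadratic_le_exp_of_nonneg (by positivity))
  rw [inv_le_iff_one_le_mul₀ hp]
  nlinarith [mul_nonneg h0 h0, mul_nonneg (mul_nonneg h0 h0) h0, pow_nonneg h0 4, pow_nonneg h0 5,
    mul_nonneg (mul_nonneg h0 h0) (by linarith : 0 ≤ 1 - 2 * x), mul_nonneg (pow_nonneg h0 3) (by linarith : 0 ≤ 1 - 2 * x), mul_nonneg (pow_nonneg h0 4) (by linarith : 0 ≤ 1 - 2 * x)]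

theorem card_disj {α : Type*} [DecidableEq α] (E0 Z : Finset α) (s0 : ℕ) (hZ : Z ⊆ E0) :
    ((powersetCard s0 E0).filter (fun S => Disjoint Z S)).card = (E0.card - Z.card).choose s0 := by
  rw [← Finset.card_sdiff_of_subset hZ, ← Finset.card_powersetCard]
  congr 1
  ext S
  simp only [mem_filter, mem_powersetCard, subset_sdiff]
  constructor
  · rintro ⟨⟨a, b⟩, c⟩; exact ⟨⟨a, c.symm⟩, b⟩
  · rintro ⟨⟨a, b⟩, c⟩; exact ⟨⟨a, c⟩, b.symm⟩

theorem conc0 {α : Type*} [DecidableEq α] (E0 : Finset α) (k s0 : ℕ) (F : Finset (Finset α))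
    (hF : ∀ M ∈ F, M ⊆ E0 ∧ M.card = k) (q ζ : ℝ) (hq : 0 ≤ q)
    (h1 : (1 - ζ) * q * (E0.card.choose s0 : ℝ) ≤ ((E0.card - k).choose s0 : ℝ))
    (h2 : ∑ M ∈ F, ∑ M' ∈ F, ((E0.card - (M ∪ M').card).choose s0 : ℝ)
      ≤ (1 + ζ) * q ^ 2 * (F.card : ℝ) ^ 2 * (E0.card.choose s0 : ℝ)) :
    ∑ S ∈ powersetCard s0 E0, (((F.filter (fun M => Disjoint M S)).card : ℝ) - q * F.card) ^ 2
      ≤ 3 * ζ * q ^ 2 * (F.card : ℝ) ^ 2 * (E0.card.choose s0 : ℝ) := by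
  have hX : ∀ S, ((F.filter (fun M => Disjoint M S)).card : ℝ)
      = ∑ M ∈ F, if Disjoint M S then (1:ℝ) else 0 := by
    intro S; rw [Finset.card_filter]; push_cast; rfl
  have s1 : ∑ S ∈ powersetCard s0 E0, ((F.filter (fun M => Disjoint M S)).card : ℝ)
      = F.card * ((E0.card - k).choose s0 : ℝ) := by
    simp only [hX]
    rw [Finset.sum_comm, ← nsmul_eq_mul, ← Finset.sum_const]
    refine Finset.sum_congr rfl fun M hM => ?_
    rw [← (hF M hM).2, ← card_disj E0 M s0 (hF M hM).1, Finset.card_filter]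
    push_cast; rfl
  have s2 : ∑ S ∈ powersetCard s0 E0, ((F.filter (fun M => Disjoint M S)).card : ℝ) ^ 2
      = ∑ M ∈ F, ∑ M' ∈ F, ((E0.card - (M ∪ M').card).choose s0 : ℝ) := by
    simp only [hX, sq, Finset.sum_mul_sum]
    rw [Finset.sum_comm]
    refine Finset.sum_congr rfl fun M hM => ?_
    rw [Finset.sum_comm]
    refine Finset.sum_congr rfl fun M' hM' => ?_
    rw [← card_disj E0 (M ∪ M') s0 (union_subset (hF M hM).1 (hF M' hM').1), Finset.card_filter]
    push_cast
    refine Finset.sum_congr rfl fun S _ => ?_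
    simp only [disjoint_union_left]
    split_ifs <;> simp_all
  have e : ∑ S ∈ powersetCard s0 E0, (((F.filter (fun M => Disjoint M S)).card : ℝ) - q * F.card) ^ 2
      = ∑ M ∈ F, ∑ M' ∈ F, ((E0.card - (M ∪ M').card).choose s0 : ℝ)
        - 2 * (q * F.card) * (F.card * ((E0.card - k).choose s0 : ℝ))
        + (q * F.card) ^ 2 * (E0.card.choose s0 : ℝ) := by
    rw [← s1, ← s2, Finset.mul_sum, ← Finset.sum_sub_distrib]
    have : (q * F.card) ^ 2 * (E0.card.choose s0 : ℝ) = ∑ S ∈ powersetCard s0 E0, (q * (F.card:ℝ)) ^ 2 := by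
      rw [Finset.sum_const, card_powersetCard, nsmul_eq_mul]; ring
    rw [this, ← Finset.sum_add_distrib]
    refine Finset.sum_congr rfl fun S _ => by ring
  rw [e]
  have h3 := mul_le_mul_of_nonneg_left h1 (by positivity : 0 ≤ 2 * q * (F.card : ℝ) ^ 2)
  nlinarith

theorem conc1 {α : Type*} [DecidableEq α] (E0 : Finset α) (k s0 : ℕ) (F : Finset (Finset α))
    (hF : ∀ M ∈ F, M ⊆ E0 ∧ M.card = k) (q ζ lam : ℝ) (hq : 0 < q) (hlam : 0 < lam)
    (hζ : 0 ≤ ζ)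
    (h1 : (1 - ζ) * q * (E0.card.choose s0 : ℝ) ≤ ((E0.card - k).choose s0 : ℝ))
    (h2 : ∑ M ∈ F, ∑ M' ∈ F, ((E0.card - (M ∪ M').card).choose s0 : ℝ)
      ≤ (1 + ζ) * q ^ 2 * (F.card : ℝ) ^ 2 * (E0.card.choose s0 : ℝ)) :
    (((powersetCard s0 E0).filter (fun S => lam * (q * F.card) <
      |((F.filter (fun M => Disjoint M S)).card : ℝ) - q * F.card|)).card : ℝ)
      ≤ 3 * ζ / lam ^ 2 * (E0.card.choose s0 : ℝ) := by
  rcases Nat.eq_zero_or_pos F.card with h0 | h0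
  · have : F = ∅ := Finset.card_eq_zero.mp h0
    subst this
    simp
    positivity
  have h0R : (0:ℝ) < F.card := by exact_mod_cast h0
  have hc := conc0 E0 k s0 F hF q ζ hq.le h1 h2
  have hsub : (((powersetCard s0 E0).filter (fun S => lam * (q * F.card) <
      |((F.filter (fun M => Disjoint M S)).card : ℝ) - q * F.card|)).card : ℝ) * (lam * (q * F.card)) ^ 2
      ≤ ∑ S ∈ powersetCard s0 E0, (((F.filter (fun M => Disjoint M S)).card : ℝ) - q * F.card) ^ 2 := by
    rw [← nsmul_eq_mul]
    refine le_trans (Finset.card_nsmul_le_sum _ _ _ ?_)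
      (Finset.sum_le_sum_of_subset_of_nonneg (Finset.filter_subset _ _) (fun _ _ _ => sq_nonneg _))
    intro S hS
    have := (mem_filter.mp hS).2
    rw [← sq_abs (((F.filter (fun M => Disjoint M S)).card : ℝ) - q * F.card)]
    gcongr
  have h5 := hsub.trans hc
  have hpos : 0 < (lam * (q * F.card)) ^ 2 := by positivity
  refine le_of_mul_le_mul_right (h5.trans (le_of_eq ?_)) hpos
  field_simp

theorem exp_le_one_add_mul (u : ℝ) : Real.exp u ≤ 1 + u * Real.exp u := by
  have h := Real.add_one_le_exp (-u)
  have h2 := mul_le_mul_of_nonneg_right h (Real.exp_pos u).le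
  rw [← Real.exp_add, neg_add_cancel, Real.exp_zero] at h2
  linarith

theorem conc2_alg (N E F ov q z : ℝ) (hN : 0 ≤ N) (hE : 0 ≤ E) (hF : 0 ≤ F) (hq : 0 ≤ q)
    (hz0 : 0 < z) (hz1 : z ≤ 1) (h5 : ov ≤ z / 4 * F) (h6 : E ≤ q * (1 + z / 2)) :
    N * (E * (F + ov)) ≤ (1 + z) * q * F * N := by
  calc N * (E * (F + ov)) ≤ N * (E * (F + z / 4 * F)) := by gcongr
    _ ≤ N * ((q * (1 + z / 2)) * (F + z / 4 * F)) := by gcongr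
    _ = ((1 + z / 2) * (1 + z / 4)) * (q * F * N) := by ring
    _ ≤ (1 + z) * (q * F * N) := by
        gcongr; nlinarith
    _ = _ := by ring

theorem conc2_alg2 (z C' k F s m e : ℝ) (hz : 0 < z) (hC : 0 < C') (hm : 0 < m) (he : 0 < e)
    (hF : 0 ≤ F) (hP : s * k / m ≤ C') (hs : 0 ≤ s)
    (ov : ℝ) (hov : ov ≤ z / (4 * C' * e) * k * F) : ov * (s / m * e) ≤ z / 4 * F := by
  calc _ ≤ (z / (4 * C' * e) * k * F) * (s / m * e) := by gcongr
    _ = (s * k / m) * (z / (4 * C') * F) := by field_simp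
    _ ≤ C' * (z / (4 * C') * F) := by gcongr
    _ = _ := by field_simp

set_option maxHeartbeats 2000000 in
theorem conc2 (C' ρ lam : ℝ) (hC : 0 < C') (hρ : 0 < ρ) (hlam : 0 < lam) :
    ∃ ζ : ℝ, 0 < ζ ∧ ∃ η : ℝ, 0 < η ∧ ∀ m s k0 : ℕ, 1 ≤ s → 1 ≤ k0 →
      (s : ℝ) * k0 ≤ C' * m → (s : ℝ) ≤ ζ * m → (k0 : ℝ) ≤ ζ * m →
      ∀ (E0 : Finset (Finset ℕ)) (k s0 : ℕ) (F : Finset (Finset (Finset ℕ))),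
        (∀ M ∈ F, M ⊆ E0 ∧ M.card = k) → E0.card + s = m + s0 → s0 ≤ s → s ≤ s0 + 1 →
        k ≤ k0 → k0 ≤ k + 1 →
        ∑ M ∈ F, ∑ M' ∈ F, ((M ∩ M').card : ℝ) ≤ η * k0 * (F.card : ℝ) ^ 2 →
        (((powersetCard s0 E0).filter (fun S =>
          lam * (Real.exp (-((s : ℝ) * k0 / m)) * F.card) <
          |((F.filter (fun M => Disjoint M S)).card : ℝ) -
            Real.exp (-((s : ℝ) * k0 / m)) * F.card|)).card : ℝ)
          ≤ ρ * (E0.card.choose s0 : ℝ) := by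
  set z : ℝ := min 1 (ρ * lam ^ 2 / 3) with hz
  have hz0 : 0 < z := lt_min one_pos (by positivity)
  have hz1 : z ≤ 1 := min_le_left _ _
  have hz2 : z ≤ ρ * lam ^ 2 / 3 := min_le_right _ _
  set ζ : ℝ := min (1 / 8) (z / (16 * (1 + C'))) with hζ
  have hζ0 : 0 < ζ := lt_min (by norm_num) (by positivity)
  have hζ1 : ζ ≤ 1 / 8 := min_le_left _ _
  have hζ2 : ζ * (16 * (1 + C')) ≤ z := by
    have : ζ ≤ z / (16 * (1 + C')) := min_le_right _ _
    rwa [le_div_iff₀ (by positivity)] at this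
  refine ⟨ζ, hζ0, z / (4 * C' * Real.exp C'), by positivity, ?_⟩
  intro m s k0 hs1 hk1 hsk hsm hkm E0 k s0 F hF hcard hs0 hs0' hk hk' hov
  have hs1R : (1:ℝ) ≤ s := by exact_mod_cast hs1
  have hk1R : (1:ℝ) ≤ k0 := by exact_mod_cast hk1
  have hmR : (8:ℝ) ≤ m := by nlinarith
  have hm8 : 8 ≤ m := by exact_mod_cast hmR
  have hm0R : (0:ℝ) < m := by linarith
  have hm0 : 0 < E0.card := by omega
  have hMR : (0:ℝ) < E0.card := by exact_mod_cast hm0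
  set q : ℝ := Real.exp (-((s : ℝ) * k0 / m)) with hq
  have hq0 : 0 < q := Real.exp_pos _
  have hkR : (k : ℝ) ≤ k0 := by exact_mod_cast hk
  have hkR' : (k0 : ℝ) ≤ k + 1 := by exact_mod_cast hk'
  have hsR : (s0 : ℝ) ≤ s := by exact_mod_cast hs0
  have hsR' : (s : ℝ) ≤ s0 + 1 := by exact_mod_cast hs0'
  have hcR : (E0.card : ℝ) + s = m + s0 := by exact_mod_cast hcard
  have hs00 : (0:ℝ) ≤ s0 := Nat.cast_nonneg _
  have hk00 : (0:ℝ) ≤ k := Nat.cast_nonneg _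
  have hP : (s : ℝ) * k0 / m ≤ C' := by rwa [div_le_iff₀ hm0R]
  have hP0 : 0 ≤ (s : ℝ) * k0 / m := by positivity
  -- h1
  have h1 : (1 - z) * q * (E0.card.choose s0 : ℝ) ≤ ((E0.card - k).choose s0 : ℝ) := by
    have hlt : s0 < E0.card := by
      have : (s0 : ℝ) < E0.card := by nlinarith
      exact_mod_cast this
    have hkle : k ≤ E0.card - s0 := by
      have : (k : ℝ) + s0 ≤ E0.card := by nlinarith
      have : k + s0 ≤ E0.card := by exact_mod_cast this
      omega
    have hl := choose_lower E0.card k s0 s0 le_rfl hlt hkle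
    have hms : (E0.card : ℝ) - s0 = m - s := by linarith
    rw [hms] at hl
    have hmspos : (0:ℝ) < (m : ℝ) - s := by nlinarith
    set x : ℝ := (k : ℝ) / ((m : ℝ) - s) with hx
    have hx0 : 0 ≤ x := by positivity
    have hinv : 1 ≤ (1 + 2 * ζ) * (((m : ℝ) - s) / m) := by
      have : 1 - ζ ≤ ((m : ℝ) - s) / m := by
        rw [le_div_iff₀ hm0R]; linarith
      have h3 := mul_le_mul_of_nonneg_left this (by linarith : 0 ≤ 1 + 2 * ζ)
      have h4 : 1 ≤ (1 + 2 * ζ) * (1 - ζ) := by nlinarith only [hζ0, hζ1]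
      linarith
    have hx1 : x * m ≤ k0 * (1 + 2 * ζ) := by
      rw [hx, div_mul_eq_mul_div, div_le_iff₀ hmspos]
      have h3 := mul_le_mul_of_nonneg_right hinv hm0R.le
      rw [mul_assoc, div_mul_cancel₀ _ hm0R.ne', one_mul] at h3
      calc (k : ℝ) * m ≤ k0 * m := by gcongr
        _ ≤ k0 * ((1 + 2 * ζ) * ((m : ℝ) - s)) := by gcongr
        _ = _ := by ring
    have hx2 : x ≤ 2 * ζ := by
      have : x * m ≤ (2 * ζ) * m := by
        have h3 : (k0 : ℝ) * (1 + 2 * ζ) ≤ ζ * m * (1 + 2 * ζ) := by gcongr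
        have h4 : ζ * m * (1 + 2 * ζ) ≤ ζ * m * 2 := by gcongr; linarith
        linarith
      exact le_of_mul_le_mul_right this hm0R
    have hx3 : x ≤ 1 / 2 := by linarith
    have hexp := one_sub_ge_exp x hx0 hx3
    have hpow : Real.exp (-(s0 * (x + x ^ 2))) ≤ (1 - x) ^ s0 := by
      have := pow_le_pow_left₀ (Real.exp_pos _).le hexp s0
      rw [← Real.exp_nat_mul] at this
      refine le_trans (le_of_eq ?_) this
      congr 1; ring
    have hsx : (s : ℝ) * x ≤ (s : ℝ) * k0 / m * (1 + 2 * ζ) := by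
      rw [div_mul_eq_mul_div, le_div_iff₀ hm0R]
      have := mul_le_mul_of_nonneg_left hx1 (by linarith : (0:ℝ) ≤ s)
      linarith
    have hexpo : s0 * (x + x ^ 2) ≤ (s : ℝ) * k0 / m + z := by
      calc s0 * (x + x ^ 2) ≤ s * (x + x ^ 2) := by gcongr
        _ = s * x * (1 + x) := by ring
        _ ≤ ((s : ℝ) * k0 / m * (1 + 2 * ζ)) * (1 + 2 * ζ) := by gcongr
        _ = (s : ℝ) * k0 / m + (s : ℝ) * k0 / m * (4 * ζ + 4 * ζ ^ 2) := by ring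
        _ ≤ (s : ℝ) * k0 / m + C' * (4 * ζ + 4 * ζ ^ 2) := by gcongr
        _ ≤ (s : ℝ) * k0 / m + z := by
            have : C' * (4 * ζ + 4 * ζ ^ 2) ≤ z := by
              nlinarith only [mul_pos hC hζ0, hζ1, hζ0, hζ2]
            linarith
    have hfin : (1 - z) * q ≤ (1 - x) ^ s0 := by
      refine le_trans ?_ hpow
      calc (1 - z) * q ≤ Real.exp (-z) * q := by
            gcongr
            linarith [Real.add_one_le_exp (-z)]
        _ = Real.exp (-((s : ℝ) * k0 / m + z)) := by
            rw [hq, ← Real.exp_add]; congr 1; ring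
        _ ≤ _ := by
            apply Real.exp_le_exp.mpr; linarith
    refine le_trans ?_ hl
    rw [mul_comm]
    gcongr
  -- h2
  have h2 : ∑ M ∈ F, ∑ M' ∈ F, ((E0.card - (M ∪ M').card).choose s0 : ℝ)
      ≤ (1 + z) * q ^ 2 * (F.card : ℝ) ^ 2 * (E0.card.choose s0 : ℝ) := by
    set a : ℝ := (s0 : ℝ) / E0.card with ha
    have ha0 : 0 ≤ a := by positivity
    have has : a ≤ s / m := by
      rw [ha, div_le_div_iff₀ hMR hm0R]
      have : (E0.card : ℝ) = m + s0 - s := by linarith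
      rw [this]
      have hms : (s : ℝ) ≤ m := by
        have : ζ * (m : ℝ) ≤ 1 * m := by gcongr; linarith
        linarith
      have h3 := mul_nonneg (sub_nonneg.mpr hsR) (sub_nonneg.mpr hms)
      linarith
    have hka : (s : ℝ) * k0 / m - 2 * ζ ≤ a * k := by
      have h3 : ((s : ℝ) - 1) * ((k0 : ℝ) - 1) ≤ s0 * k := by
        apply mul_le_mul <;> linarith
      have h4 : (s0 : ℝ) * k / m ≤ a * k := by
        rw [ha, div_mul_eq_mul_div]
        apply div_le_div_of_nonneg_left (by positivity) hMR (by linarith)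
      refine le_trans ?_ h4
      rw [le_div_iff₀ hm0R, sub_mul, div_mul_cancel₀ _ hm0R.ne']
      nlinarith
    have hterm : ∀ M ∈ F, ∀ M' ∈ F, ((E0.card - (M ∪ M').card).choose s0 : ℝ)
        ≤ (E0.card.choose s0 : ℝ) * (Real.exp (-(2 * (a * k))) *
          (1 + (M ∩ M').card * (s / m * Real.exp C'))) := by
      intro M hM M' hM'
      have hu := choose_upper E0.card s0 (M ∪ M').card
        (Finset.card_le_card (union_subset (hF M hM).1 (hF M' hM').1)) hm0
      refine hu.trans ?_
      gcongr
      have hc := Finset.card_union_add_card_inter M M'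
      rw [(hF M hM).2, (hF M' hM').2] at hc
      have hcR' : ((M ∪ M').card : ℝ) = 2 * k - (M ∩ M').card := by
        have : ((M ∪ M').card : ℝ) + (M ∩ M').card = k + k := by exact_mod_cast hc
        linarith
      have hi : ((M ∩ M').card : ℝ) ≤ k0 := by
        have : (M ∩ M').card ≤ k := by
          rw [← (hF M hM).2]; exact Finset.card_le_card inter_subset_left
        have : ((M ∩ M').card : ℝ) ≤ k := by exact_mod_cast this
        linarith
      set i : ℝ := ((M ∩ M').card : ℝ) with hidef
      have hi0 : 0 ≤ i := Nat.cast_nonneg _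
      have e : -((s0 : ℝ) * ((M ∪ M').card : ℝ) / E0.card) = -(2 * (a * k)) + i * a := by
        rw [hcR', ha]; field_simp; ring
      rw [e, Real.exp_add]
      gcongr
      have hia : i * a ≤ C' := by
        calc i * a ≤ k0 * (s / m) := by gcongr
          _ = s * k0 / m := by ring
          _ ≤ C' := hP
      calc Real.exp (i * a) ≤ 1 + (i * a) * Real.exp (i * a) := exp_le_one_add_mul _
        _ ≤ 1 + (i * (s / m)) * Real.exp C' := by gcongr
        _ = _ := by ring
    have hsum := Finset.sum_le_sum fun M hM => Finset.sum_le_sum fun M' hM' => hterm M hM M' hM'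
    refine hsum.trans ?_
    have e1 : ∑ M ∈ F, ∑ M' ∈ F, (E0.card.choose s0 : ℝ) * (Real.exp (-(2 * (a * k))) *
          (1 + ((M ∩ M').card : ℝ) * (s / m * Real.exp C')))
        = (E0.card.choose s0 : ℝ) * (Real.exp (-(2 * (a * k))) * ((F.card : ℝ) ^ 2 +
          (∑ M ∈ F, ∑ M' ∈ F, ((M ∩ M').card : ℝ)) * (s / m * Real.exp C'))) := by
      simp only [← Finset.mul_sum, Finset.sum_add_distrib, ← Finset.sum_mul, Finset.sum_const,
        nsmul_eq_mul, mul_one]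
      ring
    rw [e1]
    have h5 : (∑ M ∈ F, ∑ M' ∈ F, ((M ∩ M').card : ℝ)) * (s / m * Real.exp C')
        ≤ z / 4 * (F.card : ℝ) ^ 2 := by
      exact conc2_alg2 z C' k0 _ s m _ hz0 hC hm0R (Real.exp_pos _) (sq_nonneg _) hP (by linarith) _ hov
    have h6 : Real.exp (-(2 * (a * k))) ≤ q ^ 2 * (1 + z / 2) := by
      have h7 : Real.exp (4 * ζ) ≤ 1 + z / 2 := by
        have h8 : Real.exp (4 * ζ) ≤ 2 := by
          have : 4 * ζ ≤ 1 / 2 := by linarith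
          have h9 := exp_le_one_add_mul (4 * ζ)
          have := Real.exp_pos (4 * ζ)
          nlinarith
        have h9 := exp_le_one_add_mul (4 * ζ)
        have : 4 * ζ * Real.exp (4 * ζ) ≤ 4 * ζ * 2 := by gcongr
        nlinarith [mul_pos hζ0 hC]
      calc Real.exp (-(2 * (a * k))) ≤ Real.exp (-(s * k0 / m) + -(s * k0 / m) + 4 * ζ) := by
            apply Real.exp_le_exp.mpr; linarith
        _ = q ^ 2 * Real.exp (4 * ζ) := by rw [Real.exp_add, Real.exp_add, hq]; ring
        _ ≤ _ := by gcongr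
    exact conc2_alg _ _ _ _ _ _ (Nat.cast_nonneg _) (Real.exp_pos _).le (sq_nonneg _) (sq_nonneg _) hz0 hz1 h5 h6
  have hfin := conc1 E0 k s0 F hF q z lam hq0 hlam hz0.le h1 h2
  refine hfin.trans ?_
  gcongr
  rw [div_le_iff₀ (by positivity)]
  linarith

theorem sum_inter_eq {α : Type*} [DecidableEq α] (F : Finset (Finset α)) (Y : Finset α) :
    ∑ M ∈ F, ((M ∩ Y).card : ℝ) = ∑ A ∈ Y, ((F.filter (fun M => A ∈ M)).card : ℝ) := by
  have h1 : ∀ M, ((M ∩ Y).card : ℝ) = ∑ A ∈ Y, if A ∈ M then (1:ℝ) else 0 := by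
    intro M
    rw [inter_comm, ← Finset.filter_mem_eq_inter, Finset.card_filter]; push_cast; rfl
  have h2 : ∀ A, ((F.filter (fun M => A ∈ M)).card : ℝ) = ∑ M ∈ F, if A ∈ M then (1:ℝ) else 0 := by
    intro M
    rw [Finset.card_filter]; push_cast; rfl
  simp only [h1, h2]
  rw [Finset.sum_comm]

theorem overlap_eq {α : Type*} [DecidableEq α] (F : Finset (Finset α)) (G : Finset α)
    (hF : ∀ M ∈ F, M ⊆ G) :
    ∑ M ∈ F, ∑ M' ∈ F, ((M ∩ M').card : ℝ) = ∑ A ∈ G, ((F.filter (fun M => A ∈ M)).card : ℝ) ^ 2 := by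
  have h1 : ∀ M' ∈ F, ∑ M ∈ F, ((M ∩ M').card : ℝ)
      = ∑ A ∈ G, if A ∈ M' then ((F.filter (fun M => A ∈ M)).card : ℝ) else 0 := by
    intro M' hM'
    rw [sum_inter_eq, ← Finset.sum_filter]
    congr 1
    ext A; simp only [mem_filter]
    exact ⟨fun h => ⟨hF M' hM' h, h⟩, fun h => h.2⟩
  rw [Finset.sum_comm, Finset.sum_congr rfl h1, Finset.sum_comm]
  refine Finset.sum_congr rfl fun A _ => ?_
  rw [← Finset.sum_filter, Finset.sum_const, nsmul_eq_mul, sq]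

theorem lemV0 {α : Type*} [DecidableEq α] (F : Finset (Finset α)) (G : Finset α) (kk m η L : ℝ)
    (hF : ∀ M ∈ F, M ⊆ G ∧ (M.card : ℝ) ≤ kk) (hk : 0 < kk) (hm : 0 < m) (hL : 0 < L)
    (hsp : ∀ Y ⊆ G, ∑ M ∈ F, ((M ∩ Y).card : ℝ) ≤ kk * (Y.card / m + η) * F.card) :
    ∑ M ∈ F, ∑ M' ∈ F, ((M ∩ M').card : ℝ) ≤ kk * (1 / L + η + L * kk / m) * (F.card : ℝ) ^ 2 := by
  rcases Nat.eq_zero_or_pos F.card with h0 | h0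
  · have : F = ∅ := Finset.card_eq_zero.mp h0
    subst this
    simp
  have hΦ : (0:ℝ) < F.card := by exact_mod_cast h0
  rw [overlap_eq F G (fun M hM => (hF M hM).1)]
  set Φ : ℝ := (F.card : ℝ) with hΦd
  set c : α → ℝ := fun A => ((F.filter (fun M => A ∈ M)).card : ℝ) with hc
  have hc0 : ∀ A, 0 ≤ c A := fun A => Nat.cast_nonneg _
  have hcΦ : ∀ A, c A ≤ Φ := fun A => by
    simp only [hc, hΦd]; exact_mod_cast Finset.card_filter_le _ _
  set τ : ℝ := L * Φ * kk / m with hτ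
  have hτ0 : 0 < τ := by positivity
  have htot : ∑ A ∈ G, c A ≤ kk * Φ := by
    rw [← sum_inter_eq]
    have : ∀ M ∈ F, ((M ∩ G).card : ℝ) ≤ kk := fun M hM => by
      rw [inter_eq_left.mpr (hF M hM).1]; exact (hF M hM).2
    have h := Finset.sum_le_card_nsmul _ _ _ this
    rw [nsmul_eq_mul] at h
    linarith
  set Y := G.filter (fun A => τ < c A) with hY
  have hYG : Y ⊆ G := Finset.filter_subset _ _
  have hYsum := hsp Y hYG
  rw [sum_inter_eq] at hYsum
  have hYc : (Y.card : ℝ) * τ ≤ kk * Φ := by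
    rw [← nsmul_eq_mul]
    refine le_trans (Finset.card_nsmul_le_sum Y c τ fun A hA => (mem_filter.mp hA).2.le) ?_
    exact (Finset.sum_le_sum_of_subset_of_nonneg hYG fun A _ _ => hc0 A).trans htot
  have hYm : (Y.card : ℝ) / m ≤ 1 / L := by
    rw [div_le_div_iff₀ hm hL]
    rw [hτ] at hYc
    have : ((Y.card : ℝ) * L) * (kk * Φ / m) ≤ (1 * m) * (kk * Φ / m) := by
      have e : (1 * m) * (kk * Φ / m) = kk * Φ := by field_simp
      rw [e]
      refine le_trans (le_of_eq ?_) hYc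
      ring
    exact le_of_mul_le_mul_right this (by positivity)
  have e : ∑ A ∈ G, c A ^ 2 = ∑ A ∈ Y, c A ^ 2 + ∑ A ∈ G.filter (fun A => ¬ τ < c A), c A ^ 2 := by
    rw [hY, Finset.sum_filter_add_sum_filter_not]
  rw [e]
  have p1 : ∑ A ∈ Y, c A ^ 2 ≤ Φ * (kk * (1 / L + η) * Φ) := by
    calc ∑ A ∈ Y, c A ^ 2 ≤ ∑ A ∈ Y, Φ * c A := Finset.sum_le_sum fun A _ => by
          rw [sq]; exact mul_le_mul_of_nonneg_right (hcΦ A) (hc0 A)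
      _ = Φ * ∑ A ∈ Y, c A := by rw [Finset.mul_sum]
      _ ≤ Φ * (kk * (Y.card / m + η) * Φ) := by gcongr
      _ ≤ _ := by gcongr
  have p2 : ∑ A ∈ G.filter (fun A => ¬ τ < c A), c A ^ 2 ≤ τ * (kk * Φ) := by
    calc _ ≤ ∑ A ∈ G.filter (fun A => ¬ τ < c A), τ * c A := Finset.sum_le_sum fun A hA => by
          rw [sq]; exact mul_le_mul_of_nonneg_right (not_lt.mp (mem_filter.mp hA).2) (hc0 A)
      _ = τ * ∑ A ∈ G.filter (fun A => ¬ τ < c A), c A := by rw [Finset.mul_sum]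
      _ ≤ τ * ∑ A ∈ G, c A := by
          refine mul_le_mul_of_nonneg_left ?_ hτ0.le
          exact Finset.sum_le_sum_of_subset_of_nonneg (Finset.filter_subset _ _) fun A _ _ => hc0 A
      _ ≤ _ := by gcongr
  refine (add_le_add p1 p2).trans (le_of_eq ?_)
  rw [hτ]; ring

theorem lemE0 {α : Type*} [DecidableEq α] (F : Finset (Finset α)) (G : Finset α) (kk η σ : ℝ)
    (hF : ∀ M ∈ F, M ⊆ G ∧ (M.card : ℝ) = kk) (hk : 0 < kk) (hm : 0 < G.card) (hσ : 0 < σ)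
    (hΦ : 0 < F.card)
    (hsp : ∀ Y ⊆ G, ∑ M ∈ F, ((M ∩ Y).card : ℝ) ≤ kk * (Y.card / G.card + η) * F.card) :
    ((G.filter (fun A => ¬ ((1 - σ) * F.card * (kk / G.card) ≤ ((F.filter (fun M => A ∈ M)).card : ℝ)
      ∧ ((F.filter (fun M => A ∈ M)).card : ℝ) ≤ (1 + σ) * F.card * (kk / G.card)))).card : ℝ)
      ≤ 2 * (η / σ) * G.card := by
  have hΦ0 : (0:ℝ) < F.card := by exact_mod_cast hΦ
  have hm0 : (0:ℝ) < G.card := by exact_mod_cast hm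
  simp only [sum_inter_eq] at hsp
  set Φ : ℝ := (F.card : ℝ) with hΦd
  set m : ℝ := (G.card : ℝ) with hmd
  set c : α → ℝ := fun A => ((F.filter (fun M => A ∈ M)).card : ℝ) with hc
  have hP : 0 < Φ * kk / m := by positivity
  set X1 := G.filter (fun A => c A < (1 - σ) * Φ * (kk / m)) with hX1
  set X2 := G.filter (fun A => (1 + σ) * Φ * (kk / m) < c A) with hX2
  have htot : ∑ A ∈ G, c A = kk * Φ := by
    rw [← sum_inter_eq]
    have : ∀ M ∈ F, ((M ∩ G).card : ℝ) = kk := fun M hM => by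
      rw [inter_eq_left.mpr (hF M hM).1]; exact (hF M hM).2
    rw [Finset.sum_congr rfl this, Finset.sum_const, nsmul_eq_mul]; ring
  have h2 : (X2.card : ℝ) ≤ η / σ * m := by
    have a1 := hsp X2 (Finset.filter_subset _ _)
    have a2 := Finset.card_nsmul_le_sum X2 c ((1 + σ) * Φ * (kk / m))
      (fun A hA => (mem_filter.mp hA).2.le)
    rw [nsmul_eq_mul] at a2
    have a3 := a2.trans a1
    have e1 : (X2.card : ℝ) * ((1 + σ) * Φ * (kk / m)) = (X2.card * (1 + σ)) * (Φ * kk / m) := by ring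
    have e2 : kk * (X2.card / m + η) * Φ = (X2.card + η * m) * (Φ * kk / m) := by field_simp
    rw [e1, e2] at a3
    have a4 := le_of_mul_le_mul_right a3 hP
    rw [div_mul_eq_mul_div, le_div_iff₀ hσ]
    linarith
  have h1 : (X1.card : ℝ) ≤ η / σ * m := by
    have hX1G : X1 ⊆ G := Finset.filter_subset _ _
    have a1 := hsp (G \ X1) Finset.sdiff_subset
    have a2 := Finset.sum_le_card_nsmul X1 c ((1 - σ) * Φ * (kk / m))
      (fun A hA => (mem_filter.mp hA).2.le)
    rw [nsmul_eq_mul] at a2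
    have a0 := Finset.sum_sdiff (f := c) hX1G
    have hcard : ((G \ X1).card : ℝ) = m - X1.card := by
      rw [Finset.card_sdiff_of_subset hX1G, Nat.cast_sub (Finset.card_le_card hX1G)]
    rw [hcard] at a1
    have e1 : (X1.card : ℝ) * ((1 - σ) * Φ * (kk / m)) = (X1.card * (1 - σ)) * (Φ * kk / m) := by ring
    have e2 : kk * ((m - X1.card) / m + η) * Φ = (m - X1.card + η * m) * (Φ * kk / m) := by field_simp
    have e3 : kk * Φ = m * (Φ * kk / m) := by field_simp
    have a3 : m * (Φ * kk / m) ≤ (m - X1.card + η * m + X1.card * (1 - σ)) * (Φ * kk / m) := by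
      rw [← e3, add_mul, ← e1, ← e2, ← htot, ← a0]
      exact add_le_add a1 a2
    have a4 := le_of_mul_le_mul_right a3 hP
    rw [div_mul_eq_mul_div, le_div_iff₀ hσ]
    linarith
  have hsub : G.filter (fun A => ¬ ((1 - σ) * Φ * (kk / m) ≤ c A ∧ c A ≤ (1 + σ) * Φ * (kk / m)))
      ⊆ X1 ∪ X2 := by
    intro A hA
    rw [mem_filter, not_and_or, not_le, not_le] at hA
    rw [mem_union, hX1, hX2, mem_filter, mem_filter]
    rcases hA.2 with h | h
    · exact Or.inl ⟨hA.1, h⟩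
    · exact Or.inr ⟨hA.1, h⟩
  have h3 := (Finset.card_le_card hsub).trans (Finset.card_union_le _ _)
  have h4 : ((G.filter (fun A => ¬ ((1 - σ) * Φ * (kk / m) ≤ c A ∧ c A ≤ (1 + σ) * Φ * (kk / m)))).card : ℝ)
      ≤ X1.card + X2.card := by exact_mod_cast h3
  linarith

theorem tail_count {α : Type*} [DecidableEq α] (Ω B : Finset α) (hB : B ⊆ Ω) (s j : ℕ) (hj : j ≤ s)
    (hΩ : 0 < Ω.card) :
    (((powersetCard s Ω).filter (fun S => (S ∩ B).card ≤ j)).card : ℝ) ≤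
      (Ω.card.choose s : ℝ) * (s.choose j : ℝ) *
        Real.exp (-(((s - j : ℕ) : ℝ) * B.card / Ω.card)) := by
  by_cases hsΩ : s ≤ Ω.card
  swap
  · rw [powersetCard_eq_empty.mpr (by omega)]
    simp only [filter_empty, card_empty, Nat.cast_zero]
    positivity
  have hsub : (powersetCard s Ω).filter (fun S => (S ∩ B).card ≤ j) ⊆
      (powersetCard (s - j) (Ω \ B)).biUnion (fun T => (powersetCard j (Ω \ T)).image (fun R => T ∪ R)) := by
    intro S hS
    rw [mem_filter, mem_powersetCard] at hS
    obtain ⟨⟨hS1, hS2⟩, hS3⟩ := hS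
    have h1 : s - j ≤ (S \ B).card := by
      have := Finset.card_sdiff_add_card_inter S B
      omega
    obtain ⟨T, hT, hTc⟩ := Finset.exists_subset_card_eq h1
    have hTS : T ⊆ S := hT.trans sdiff_subset
    rw [mem_biUnion]
    refine ⟨T, mem_powersetCard.mpr ⟨?_, hTc⟩, ?_⟩
    · exact hT.trans (Finset.sdiff_subset_sdiff hS1 le_rfl)
    · rw [mem_image]
      refine ⟨S \ T, mem_powersetCard.mpr ⟨Finset.sdiff_subset_sdiff hS1 le_rfl, ?_⟩, ?_⟩
      · rw [Finset.card_sdiff_of_subset hTS]; omega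
      · exact Finset.union_sdiff_of_subset hTS
  have h1 := Finset.card_le_card hsub
  have h2 : ((powersetCard (s - j) (Ω \ B)).biUnion
      (fun T => (powersetCard j (Ω \ T)).image (fun R => T ∪ R))).card
      ≤ (powersetCard (s - j) (Ω \ B)).card * ((Ω.card - (s - j)).choose j) := by
    apply Finset.card_biUnion_le_card_mul
    intro T hT
    rw [mem_powersetCard] at hT
    refine Finset.card_image_le.trans ?_
    rw [card_powersetCard, Finset.card_sdiff_of_subset (hT.1.trans sdiff_subset), hT.2]
  rw [card_powersetCard, Finset.card_sdiff_of_subset hB] at h2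
  have h3 := choose_upper Ω.card (s - j) B.card (Finset.card_le_card hB) hΩ
  have h4 := Nat.choose_mul (n := Ω.card) (k := s) (s := s - j) (by omega)
  have e : s - (s - j) = j := by omega
  rw [e, Nat.choose_symm hj] at h4
  have h4R : (Ω.card.choose s : ℝ) * (s.choose j : ℝ)
      = (Ω.card.choose (s - j) : ℝ) * ((Ω.card - (s - j)).choose j : ℝ) := by exact_mod_cast h4
  rw [h4R]
  calc _ ≤ (((Ω.card - B.card).choose (s - j) * (Ω.card - (s - j)).choose j : ℕ) : ℝ) := by
        exact_mod_cast h1.trans h2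
    _ = ((Ω.card - B.card).choose (s - j) : ℝ) * ((Ω.card - (s - j)).choose j : ℝ) := by push_cast; rfl
    _ ≤ (Ω.card.choose (s - j) * Real.exp (-(((s - j : ℕ) : ℝ) * B.card / Ω.card)))
        * ((Ω.card - (s - j)).choose j : ℝ) := by gcongr
    _ = _ := by ring

theorem count_main {α : Type*} [DecidableEq α] (Ω : Finset α) (m s j : ℕ) (hj : j ≤ s) (hs : 0 < s)
    (hsm : s ≤ m) (hmN : m ≤ Ω.card) (𝓑 : Finset (Finset α)) (h𝓑 : 𝓑 ⊆ powersetCard m Ω)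
    (Bad : Finset α → Finset α) (hBad : ∀ H', Bad H' ⊆ Ω \ H') (b : ℝ) (hb : 0 ≤ b)
    (hhalf : ∀ H ∈ 𝓑, (1 / 2 : ℝ) * (m.choose s : ℝ) ≤ (((powersetCard s H).filter
      (fun S => b * Ω.card ≤ ((Bad (H \ S)).card : ℝ) ∧ (S ∩ Bad (H \ S)).card ≤ j)).card : ℝ)) :
    (𝓑.card : ℝ) ≤ 2 * (Ω.card.choose m : ℝ) * (s.choose j : ℝ) *
      Real.exp (-(((s - j : ℕ) : ℝ) * b)) := by
  set P1 := 𝓑.sigma (fun H => (powersetCard s H).filter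
      (fun S => b * Ω.card ≤ ((Bad (H \ S)).card : ℝ) ∧ (S ∩ Bad (H \ S)).card ≤ j)) with hP1
  set P2 := (powersetCard (m - s) Ω).sigma (fun H' => (powersetCard s (Ω \ H')).filter
      (fun S => b * Ω.card ≤ ((Bad H').card : ℝ) ∧ (S ∩ Bad H').card ≤ j)) with hP2
  have hinj : P1.card ≤ P2.card := by
    apply Finset.card_le_card_of_injOn (fun p => ⟨p.1 \ p.2, p.2⟩)
    · rintro ⟨H, S⟩ hp
      simp only [hP1, hP2, coe_sigma, Set.mem_sigma_iff, mem_coe, mem_filter, mem_powersetCard] at hp ⊢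
      obtain ⟨hH, ⟨hS1, hS2⟩, h3, h4⟩ := hp
      have hHm := mem_powersetCard.mp (h𝓑 hH)
      refine ⟨⟨sdiff_subset.trans hHm.1, ?_⟩, ⟨⟨?_, hS2⟩, h3, h4⟩⟩
      · rw [Finset.card_sdiff_of_subset hS1, hS2, hHm.2]
      · rw [subset_sdiff]
        exact ⟨hS1.trans hHm.1, disjoint_sdiff⟩
    · rintro ⟨H, S⟩ hp ⟨H', S'⟩ hp' heq
      simp only [hP1, coe_sigma, Set.mem_sigma_iff, mem_coe, mem_filter, mem_powersetCard] at hp hp'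
      simp only [Sigma.mk.injEq, heq_eq_eq] at heq
      obtain ⟨h1, h2⟩ := heq
      subst h2
      have : H = H' := by
        rw [← Finset.sdiff_union_of_subset hp.2.1.1, h1, Finset.sdiff_union_of_subset hp'.2.1.1]
      subst this; rfl
  have hlow : (𝓑.card : ℝ) * ((1 / 2 : ℝ) * (m.choose s : ℝ)) ≤ P1.card := by
    rw [hP1, Finset.card_sigma]
    push_cast
    rw [← nsmul_eq_mul]
    exact Finset.card_nsmul_le_sum _ _ _ hhalf
  have hN0 : 0 < Ω.card := by omega
  have hN0R : (0:ℝ) < Ω.card := by exact_mod_cast hN0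
  have hup : (P2.card : ℝ) ≤ (Ω.card.choose (m - s) : ℝ) * (((Ω.card - (m - s)).choose s : ℝ) * (s.choose j : ℝ) *
        Real.exp (-(((s - j : ℕ) : ℝ) * b))) := by
    rw [hP2, Finset.card_sigma]
    push_cast
    rw [← Finset.card_powersetCard (m - s) Ω, ← nsmul_eq_mul]
    refine Finset.sum_le_card_nsmul _ _ _ ?_
    intro H' hH'
    rw [mem_powersetCard] at hH'
    have hc : (Ω \ H').card = Ω.card - (m - s) := by
      rw [Finset.card_sdiff_of_subset hH'.1, hH'.2]
    by_cases hbb : b * Ω.card ≤ ((Bad H').card : ℝ)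
    · simp only [hbb, true_and]
      have ht := tail_count (Ω \ H') (Bad H') (hBad H') s j hj (by omega)
      rw [hc] at ht
      refine ht.trans ?_
      gcongr
      have h5 : b ≤ ((Bad H').card : ℝ) / ((Ω.card - (m - s) : ℕ) : ℝ) := by
        have hpos : (0:ℝ) < ((Ω.card - (m - s) : ℕ) : ℝ) := by
          have : 0 < Ω.card - (m - s) := by omega
          exact_mod_cast this
        rw [le_div_iff₀ hpos]
        refine le_trans ?_ hbb
        gcongr
        exact Nat.sub_le _ _
      rw [mul_div_assoc]
      gcongr
    · simp only [hbb, false_and, filter_false, card_empty, Nat.cast_zero]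
      positivity
  have hid : (Ω.card.choose (m - s) : ℝ) * ((Ω.card - (m - s)).choose s : ℝ)
      = (Ω.card.choose m : ℝ) * (m.choose s : ℝ) := by
    have h4 := Nat.choose_mul (n := Ω.card) (k := m) (s := m - s) (by omega)
    have e : m - (m - s) = s := by omega
    rw [e, Nat.choose_symm hsm] at h4
    exact_mod_cast h4.symm
  have hmain : (𝓑.card : ℝ) * ((1 / 2 : ℝ) * (m.choose s : ℝ)) ≤ (Ω.card.choose m : ℝ) * (m.choose s : ℝ)
      * ((s.choose j : ℝ) * Real.exp (-(((s - j : ℕ) : ℝ) * b))) := by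
    refine hlow.trans (le_trans (by exact_mod_cast hinj) (hup.trans (le_of_eq ?_)))
    rw [← hid]; ring
  have hpos : (0:ℝ) < (1 / 2 : ℝ) * (m.choose s : ℝ) := by
    have := Nat.choose_pos hsm
    positivity
  refine le_of_mul_le_mul_right (hmain.trans (le_of_eq ?_)) hpos
  ring

theorem choose_le_y (s j : ℕ) (hj : j ≤ s) (y : ℝ) (hy : 0 < y) :
    (s.choose j : ℝ) ≤ Real.exp (y * s) * Real.exp (j * Real.log (1 / y)) := by
  have h1 : y ^ j * (s.choose j : ℝ) ≤ (y + 1) ^ s := by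
    rw [add_pow]
    have := Finset.single_le_sum (f := fun i => y ^ i * 1 ^ (s - i) * (s.choose i : ℝ))
      (fun i _ => by positivity) (mem_range.mpr (by omega : j < s + 1))
    simpa using this
  have h2 : (y + 1) ^ s ≤ Real.exp (y * s) := by
    rw [mul_comm, Real.exp_nat_mul]
    gcongr
    exact Real.add_one_le_exp y
  have h3 : Real.exp (j * Real.log (1 / y)) = (y ^ j)⁻¹ := by
    rw [Real.exp_nat_mul, Real.exp_log (by positivity), one_div, inv_pow]
  rw [h3, ← div_eq_mul_inv, le_div_iff₀ (by positivity)]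
  linarith

/-- `x` is within relative error `σ` of `Φ / D`. -/
def nearB (σ Φ D x : ℝ) : Prop := (1 - σ) * Φ / D ≤ x ∧ x ≤ (1 + σ) * Φ / D

theorem near_bad (σ lam Φ Φ' D q x x' : ℝ) (hσ : 0 < σ) (hσ1 : σ ≤ 1 / 2) (hl : lam = σ / 16)
    (hq : 0 < q) (hΦ : 0 < Φ) (hD : 0 < D) (hx : 0 ≤ x)
    (h1 : |Φ' - q * Φ| ≤ lam * (q * Φ)) (h2 : |x' - q * x| ≤ lam * (q * x))
    (hbad : ¬ nearB σ Φ D x) : ¬ nearB (σ / 2) Φ' D x' := by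
  intro hn
  apply hbad
  obtain ⟨ha, hb⟩ := hn
  rw [abs_le] at h1 h2
  rw [div_le_iff₀ hD] at ha
  rw [le_div_iff₀ hD] at hb
  have hqΦ : 0 < q * Φ := by positivity
  have hqx : 0 ≤ q * (x * D) := by positivity
  constructor
  · rw [div_le_iff₀ hD]
    have a1 : (1 - σ / 2) * ((1 - lam) * (q * Φ)) ≤ (1 - σ / 2) * Φ' := by
      apply mul_le_mul_of_nonneg_left <;> linarith
    have a2 : x' * D ≤ (1 + lam) * (q * x) * D := by
      apply mul_le_mul_of_nonneg_right _ hD.le; linarith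
    have a3 : (1 - σ / 2) * (1 - lam) * Φ ≤ (1 + lam) * (x * D) := by
      have : q * ((1 - σ / 2) * (1 - lam) * Φ) ≤ q * ((1 + lam) * (x * D)) := by linarith
      exact le_of_mul_le_mul_left this hq
    have a4 : (1 + lam) * (1 - σ) ≤ (1 - σ / 2) * (1 - lam) := by rw [hl]; nlinarith
    have a5 : (1 + lam) * ((1 - σ) * Φ) ≤ (1 + lam) * (x * D) := by
      have := mul_le_mul_of_nonneg_right a4 hΦ.le
      linarith
    exact le_of_mul_le_mul_left a5 (by rw [hl]; linarith)
  · rw [le_div_iff₀ hD]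
    have a1 : (1 + σ / 2) * Φ' ≤ (1 + σ / 2) * ((1 + lam) * (q * Φ)) := by
      apply mul_le_mul_of_nonneg_left <;> linarith
    have a2 : (1 - lam) * (q * x) * D ≤ x' * D := by
      apply mul_le_mul_of_nonneg_right _ hD.le; linarith
    have a3 : (1 - lam) * (x * D) ≤ (1 + σ / 2) * (1 + lam) * Φ := by
      have : q * ((1 - lam) * (x * D)) ≤ q * ((1 + σ / 2) * (1 + lam) * Φ) := by linarith
      exact le_of_mul_le_mul_left this hq
    have a4 : (1 + σ / 2) * (1 + lam) ≤ (1 - lam) * (1 + σ) := by rw [hl]; nlinarith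
    have a5 : (1 - lam) * (x * D) ≤ (1 - lam) * ((1 + σ) * Φ) := by
      have := mul_le_mul_of_nonneg_right a4 hΦ.le
      linarith
    exact le_of_mul_le_mul_left a5 (by rw [hl]; linarith)

theorem near_good (σ lam Φ Φ' D q x x' : ℝ) (hσ : 0 < σ) (hσ1 : σ ≤ 1 / 2) (hl : lam = σ / 16)
    (hq : 0 < q) (hΦ : 0 < Φ) (hD : 0 < D)
    (h1 : |Φ' - q * Φ| ≤ lam * (q * Φ)) (h2 : |x' - q * x| ≤ lam * (q * x))
    (hgood : nearB (σ / 4) Φ D x) : nearB (σ / 2) Φ' D x' := by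
  obtain ⟨ha, hb⟩ := hgood
  rw [abs_le] at h1 h2
  rw [div_le_iff₀ hD] at ha
  rw [le_div_iff₀ hD] at hb
  have hqΦ : 0 < q * Φ := by positivity
  constructor
  · rw [div_le_iff₀ hD]
    have a1 : (1 - σ / 2) * Φ' ≤ (1 - σ / 2) * ((1 + lam) * (q * Φ)) := by
      apply mul_le_mul_of_nonneg_left <;> linarith
    have a2 : (1 - lam) * (q * x) * D ≤ x' * D := by
      apply mul_le_mul_of_nonneg_right _ hD.le; linarith
    have a4 : (1 - σ / 2) * (1 + lam) ≤ (1 - lam) * (1 - σ / 4) := by rw [hl]; nlinarith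
    have a5 := mul_le_mul_of_nonneg_right a4 hqΦ.le
    have a6 : (1 - lam) * q * ((1 - σ / 4) * Φ) ≤ (1 - lam) * q * (x * D) := by
      apply mul_le_mul_of_nonneg_left ha
      apply mul_nonneg _ hq.le
      rw [hl]; linarith
    linarith
  · rw [le_div_iff₀ hD]
    have a1 : (1 + σ / 2) * ((1 - lam) * (q * Φ)) ≤ (1 + σ / 2) * Φ' := by
      apply mul_le_mul_of_nonneg_left <;> linarith
    have a2 : x' * D ≤ (1 + lam) * (q * x) * D := by
      apply mul_le_mul_of_nonneg_right _ hD.le; linarith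
    have a4 : (1 + lam) * (1 + σ / 4) ≤ (1 + σ / 2) * (1 - lam) := by rw [hl]; nlinarith
    have a5 := mul_le_mul_of_nonneg_right a4 hqΦ.le
    have a6 : (1 + lam) * q * (x * D) ≤ (1 + lam) * q * ((1 + σ / 4) * Φ) := by
      apply mul_le_mul_of_nonneg_left hb
      apply mul_nonneg _ hq.le
      rw [hl]; linarith
    linarith

theorem near_small (σ lam Φ Φ' D q x' e : ℝ) (hσ : 0 < σ) (hσ1 : σ ≤ 1 / 2) (hl : lam = σ / 16)
    (hq : 0 < q) (hΦ : 0 < Φ) (hD : 0 < D) (he : e ≤ q / (4 * D))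
    (h1 : |Φ' - q * Φ| ≤ lam * (q * Φ)) (hx : x' < e * Φ) : ¬ nearB (σ / 2) Φ' D x' := by
  rintro ⟨ha, -⟩
  rw [div_le_iff₀ hD] at ha
  rw [le_div_iff₀ (by positivity)] at he
  rw [abs_le] at h1
  have hqΦ : 0 < q * Φ := by positivity
  have a1 : (1 - σ / 2) * ((1 - lam) * (q * Φ)) ≤ (1 - σ / 2) * Φ' := by
    apply mul_le_mul_of_nonneg_left <;> linarith
  have a2 : x' * D < e * Φ * D := mul_lt_mul_of_pos_right hx hD
  have a3 : e * (4 * D) * Φ ≤ q * Φ := mul_le_mul_of_nonneg_right he hΦ.le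
  have a4 : 1 / 4 ≤ (1 - σ / 2) * (1 - lam) := by rw [hl]; nlinarith
  have a5 := mul_le_mul_of_nonneg_right a4 hqΦ.le
  linarith

theorem markov_count {β : Type*} (S : Finset β) (f : β → ℝ) (hf : ∀ x ∈ S, 0 ≤ f x) (a t : ℝ) (ha : 0 < a)
    (hsum : ∑ x ∈ S, f x ≤ a * t) : ((S.filter (fun x => a < f x)).card : ℝ) ≤ t := by
  have h1 := Finset.card_nsmul_le_sum (S.filter (fun x => a < f x)) f a
    (fun x hx => (mem_filter.mp hx).2.le)
  have h2 := Finset.sum_le_sum_of_subset_of_nonneg (Finset.filter_subset (fun x => a < f x) S)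
    (fun x hx _ => hf x hx)
  rw [nsmul_eq_mul] at h1
  have h3 : a * ((S.filter (fun x => a < f x)).card : ℝ) ≤ a * t := by linarith
  exact le_of_mul_le_mul_left h3 ha

theorem double_count {β γ : Type*} (S : Finset β) (T : Finset γ) (R : β → γ → Prop)
    [∀ x y, Decidable (R x y)] :
    ∑ x ∈ S, ((T.filter (fun y => R x y)).card : ℝ) = ∑ y ∈ T, ((S.filter (fun x => R x y)).card : ℝ) := by
  simp only [Finset.card_filter]
  push_cast
  rw [Finset.sum_comm]

open scoped Classical in
/-- The non-edges of `H'` whose count is off by more than a factor `1 ± σ`. -/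
noncomputable def badSet (Ω : Finset (Finset ℕ)) (f : Finset (Finset ℕ) → ℝ)
    (g : Finset (Finset ℕ) → Finset ℕ → ℝ) (σ D : ℝ) (H' : Finset (Finset ℕ)) : Finset (Finset ℕ) :=
  (Ω \ H').filter (fun U => ¬ nearB σ (f H') D (g H' U))

open scoped Classical in
theorem erase_count (H : Finset (Finset ℕ)) (A : Finset ℕ) (s : ℕ) (hs : 1 ≤ s)
    (P Q : Finset (Finset ℕ) → Prop) (hPQ : ∀ S, A ∈ S → P S → Q (S.erase A)) :
    ((powersetCard s H).filter (fun S => A ∈ S ∧ P S)).card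
      ≤ ((powersetCard (s - 1) (H.erase A)).filter Q).card := by
  apply Finset.card_le_card_of_injOn (fun S => S.erase A)
  · intro S hS
    simp only [coe_filter, Set.mem_ofPred_eq, mem_powersetCard] at hS ⊢
    obtain ⟨⟨h1, h2⟩, h3, h4⟩ := hS
    refine ⟨⟨Finset.erase_subset_erase A h1, ?_⟩, hPQ S h3 h4⟩
    rw [Finset.card_erase_of_mem h3, h2]
  · intro S hS S' hS' h
    simp only [coe_filter, Set.mem_ofPred_eq] at hS hS' h
    rw [← Finset.insert_erase hS.2.1, h, Finset.insert_erase hS'.2.1]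

open scoped Classical in
theorem half_lem (Ω H : Finset (Finset ℕ)) (hH : H ⊆ Ω) (f : Finset (Finset ℕ) → ℝ)
    (g : Finset (Finset ℕ) → Finset ℕ → ℝ) (m s j : ℕ) (hm : H.card = m) (hs : 1 ≤ s) (hsm : s ≤ m)
    (D q σ lam e ρ η1 η : ℝ) (hσ : 0 < σ) (hσ1 : σ ≤ 1 / 2) (hl : lam = σ / 16) (hq : 0 < q)
    (hq1 : q ≤ 1) (hD : 0 < D) (hη : 0 < η) (hη0 : 0 ≤ η1) (hρ : 0 ≤ ρ)
    (hΦ : 0 < f H) (hg0 : ∀ U, 0 ≤ g H U) (hg : ∀ S U, g (H \ S) U ≤ g H U)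
    (he : e ≤ q / (4 * D))
    (hE : ((H.filter (fun A => ¬ nearB (σ / 4) (f H) D (g H A))).card : ℝ) ≤ η1 * m)
    (hF : σ * Ω.card < ((Ω.filter (fun U => ¬ nearB σ (f H) D (g H U))).card : ℝ))
    (C0 : (((powersetCard s H).filter (fun S => lam * (q * f H) < |f (H \ S) - q * f H|)).card : ℝ)
      ≤ ρ * (m.choose s : ℝ))
    (CU : ∀ U ∈ Ω, e * f H ≤ g H U → (((powersetCard s H).filter
      (fun S => lam * (q * g H U) < |g (H \ S) U - q * g H U|)).card : ℝ) ≤ ρ * (m.choose s : ℝ))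
    (CA : ∀ A ∈ H, e * f H ≤ g H A → (((powersetCard (s - 1) (H.erase A)).filter
      (fun S => lam * (q * g H A) < |g (H \ S) A - q * g H A|)).card : ℝ)
        ≤ ρ * ((m - 1).choose (s - 1) : ℝ))
    (hgA : ∀ S, ∀ A ∈ H, A ∈ S → g (H \ S) A = g (H \ S.erase A) A)
    (hj : η * s < j + 1) (hη1 : η1 ≤ σ / 4) (htot : ρ + 4 * ρ / σ + (η1 + ρ) / η ≤ 1 / 2) :
    (1 / 2 : ℝ) * (m.choose s : ℝ) ≤ (((powersetCard s H).filter
      (fun S => σ / 2 * Ω.card ≤ ((badSet Ω f g (σ / 2) D (H \ S)).card : ℝ) ∧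
        (S ∩ badSet Ω f g (σ / 2) D (H \ S)).card ≤ j)).card : ℝ) := by
  have hN : 0 < Ω.card := by
    have := Finset.card_le_card hH
    omega
  have hNR : (0:ℝ) < Ω.card := by exact_mod_cast hN
  have hmN : (m : ℝ) ≤ Ω.card := by
    rw [← hm]; exact_mod_cast Finset.card_le_card hH
  have hsR : (0:ℝ) < s := by exact_mod_cast hs
  set NC : Finset (Finset ℕ) → Finset ℕ → Prop :=
    fun S U => lam * (q * g H U) < |g (H \ S) U - q * g H U| with hNC
  set C : ℝ := (m.choose s : ℝ) with hC
  have hC0 : 0 ≤ C := Nat.cast_nonneg _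
  -- event 1
  set E1 := (powersetCard s H).filter (fun S => lam * (q * f H) < |f (H \ S) - q * f H|) with hE1
  -- event 2
  set FB := (Ω \ H).filter (fun U => ¬ nearB σ (f H) D (g H U) ∧ e * f H ≤ g H U) with hFB
  set E2 := (powersetCard s H).filter
    (fun S => σ / 4 * Ω.card < ((FB.filter (fun U => NC S U)).card : ℝ)) with hE2
  have hE2c : (E2.card : ℝ) ≤ 4 * ρ / σ * C := by
    apply markov_count _ _ (fun _ _ => Nat.cast_nonneg _) _ _ (by positivity)
    rw [double_count]
    have h1 : ∀ U ∈ FB, (((powersetCard s H).filter (fun S => NC S U)).card : ℝ) ≤ ρ * C := by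
      intro U hU
      rw [hFB, mem_filter] at hU
      exact CU U (sdiff_subset hU.1) hU.2.2
    have h2 := Finset.sum_le_card_nsmul _ _ _ h1
    rw [nsmul_eq_mul] at h2
    have h3 : (FB.card : ℝ) ≤ Ω.card := by
      exact_mod_cast Finset.card_le_card ((Finset.filter_subset _ _).trans sdiff_subset)
    calc _ ≤ (FB.card : ℝ) * (ρ * C) := h2
      _ ≤ Ω.card * (ρ * C) := by gcongr
      _ = _ := by field_simp
  -- event 3
  set E3 := (powersetCard s H).filter
    (fun S => η * s < ((H.filter (fun A => A ∈ S ∧ (¬ nearB (σ / 4) (f H) D (g H A) ∨ NC S A))).card : ℝ))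
    with hE3
  have hmul : (m : ℝ) * ((m - 1).choose (s - 1) : ℝ) = s * C := by
    have := Nat.add_one_mul_choose_eq (m - 1) (s - 1)
    rw [show m - 1 + 1 = m by omega, show s - 1 + 1 = s by omega] at this
    have h2 : (m : ℝ) * ((m - 1).choose (s - 1) : ℝ) = (m.choose s : ℝ) * s := by exact_mod_cast this
    rw [h2, hC]; ring
  have hE3c : (E3.card : ℝ) ≤ (η1 + ρ) / η * C := by
    apply markov_count _ _ (fun _ _ => Nat.cast_nonneg _) _ _ (by positivity)
    rw [double_count]
    have hb : ∀ A ∈ H, (((powersetCard s H).filter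
        (fun S => A ∈ S ∧ (¬ nearB (σ / 4) (f H) D (g H A) ∨ NC S A))).card : ℝ)
        ≤ (if ¬ nearB (σ / 4) (f H) D (g H A) then ((m - 1).choose (s - 1) : ℝ) else 0)
          + ρ * ((m - 1).choose (s - 1) : ℝ) := by
      intro A hA
      have hcard : (H.erase A).card = m - 1 := by rw [Finset.card_erase_of_mem hA, hm]
      by_cases hn : nearB (σ / 4) (f H) D (g H A)
      · simp only [hn, not_true_eq_false, false_or, if_false, zero_add]
        have h1 := erase_count H A s hs (fun S => NC S A)
          (fun S => lam * (q * g H A) < |g (H \ S) A - q * g H A|) (by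
            intro S hAS hP
            simp only [hNC] at hP
            rwa [hgA S A hA hAS] at hP)
        refine le_trans (by exact_mod_cast h1) (CA A hA ?_)
        refine le_trans ?_ hn.1
        rw [mul_div_right_comm]
        apply mul_le_mul_of_nonneg_right _ hΦ.le
        refine he.trans ?_
        rw [div_le_div_iff₀ (by positivity) hD]
        have : q * D ≤ 1 * D := by gcongr
        nlinarith
      · simp only [hn, not_false_eq_true, true_or, and_true, if_true]
        have h1 := erase_count H A s hs (fun _ => True) (fun _ => True) (fun _ _ _ => trivial)
        simp only [and_true, filter_true, card_powersetCard, hcard] at h1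
        have h1R : (((powersetCard s H).filter (fun S => A ∈ S)).card : ℝ)
            ≤ ((m - 1).choose (s - 1) : ℝ) := by exact_mod_cast h1
        have : 0 ≤ ρ * ((m - 1).choose (s - 1) : ℝ) := by positivity
        linarith
    refine (Finset.sum_le_sum hb).trans ?_
    rw [Finset.sum_add_distrib, ← Finset.sum_filter, Finset.sum_const, Finset.sum_const, nsmul_eq_mul,
      nsmul_eq_mul, hm]
    calc _ ≤ (η1 * m) * ((m - 1).choose (s - 1) : ℝ) + m * (ρ * ((m - 1).choose (s - 1) : ℝ)) := by
          gcongr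
      _ = (η1 + ρ) * (m * ((m - 1).choose (s - 1) : ℝ)) := by ring
      _ = (η1 + ρ) * (s * C) := by rw [hmul]
      _ = _ := by field_simp
  -- covering
  set Gd := (powersetCard s H).filter
      (fun S => σ / 2 * Ω.card ≤ ((badSet Ω f g (σ / 2) D (H \ S)).card : ℝ) ∧
        (S ∩ badSet Ω f g (σ / 2) D (H \ S)).card ≤ j) with hGd
  have hcover : powersetCard s H ⊆ Gd ∪ (E1 ∪ (E2 ∪ E3)) := by
    intro S hS
    by_contra hcon
    simp only [mem_union, not_or] at hcon
    obtain ⟨c0, c1, c2, c3⟩ := hcon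
    rw [hE1, mem_filter, not_and] at c1
    rw [hE2, mem_filter, not_and] at c2
    rw [hE3, mem_filter, not_and] at c3
    have c1 := not_lt.mp (c1 hS)
    have c2 := not_lt.mp (c2 hS)
    have c3 := not_lt.mp (c3 hS)
    apply c0
    rw [hGd, mem_filter]
    have hS' := mem_powersetCard.mp hS
    refine ⟨hS, ?_, ?_⟩
    · -- many bad
      set FA := Ω.filter (fun U => ¬ nearB σ (f H) D (g H U)) with hFA
      have hsub : FA ⊆ H.filter (fun A => ¬ nearB (σ / 4) (f H) D (g H A)) ∪
          (FB.filter (fun U => NC S U) ∪ badSet Ω f g (σ / 2) D (H \ S)) := by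
        intro U hU
        rw [hFA, mem_filter] at hU
        obtain ⟨hUΩ, hUb⟩ := hU
        rw [mem_union, mem_union]
        by_cases hUH : U ∈ H
        · left
          rw [mem_filter]
          refine ⟨hUH, fun hn => hUb ?_⟩
          constructor
          · refine le_trans ?_ hn.1
            gcongr; linarith
          · refine le_trans hn.2 ?_
            gcongr; linarith
        · right
          have hUd : U ∈ Ω \ (H \ S) := by
            rw [mem_sdiff, mem_sdiff]; exact ⟨hUΩ, fun h => hUH h.1⟩
          by_cases hsm' : e * f H ≤ g H U
          · by_cases hnc : NC S U
            · left
              rw [mem_filter, hFB, mem_filter]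
              exact ⟨⟨mem_sdiff.mpr ⟨hUΩ, hUH⟩, hUb, hsm'⟩, hnc⟩
            · right
              rw [badSet, mem_filter]
              exact ⟨hUd, near_bad σ lam (f H) _ D q (g H U) _ hσ hσ1 hl hq hΦ hD (hg0 U) c1
                (not_lt.mp hnc) hUb⟩
          · right
            rw [badSet, mem_filter]
            exact ⟨hUd, near_small σ lam (f H) _ D q _ e hσ hσ1 hl hq hΦ hD he c1
              (lt_of_le_of_lt (hg S U) (not_le.mp hsm'))⟩
      have h1 := (Finset.card_le_card hsub).trans ((Finset.card_union_le _ _).trans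
        (Nat.add_le_add_left (Finset.card_union_le _ _) _))
      have h1R : (FA.card : ℝ) ≤ (H.filter (fun A => ¬ nearB (σ / 4) (f H) D (g H A))).card +
          ((FB.filter (fun U => NC S U)).card + (badSet Ω f g (σ / 2) D (H \ S)).card) := by
        exact_mod_cast h1
      have h2 : η1 * m ≤ σ / 4 * Ω.card := by gcongr
      linarith
    · -- few bad in S
      have hsub : S ∩ badSet Ω f g (σ / 2) D (H \ S) ⊆
          H.filter (fun A => A ∈ S ∧ (¬ nearB (σ / 4) (f H) D (g H A) ∨ NC S A)) := by
        intro A hA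
        rw [mem_inter, badSet, mem_filter] at hA
        obtain ⟨hAS, -, hAb⟩ := hA
        rw [mem_filter]
        refine ⟨hS'.1 hAS, hAS, ?_⟩
        by_contra hcon
        rw [not_or, not_not] at hcon
        exact hAb (near_good σ lam (f H) _ D q (g H A) _ hσ hσ1 hl hq hΦ hD c1
          (not_lt.mp hcon.2) hcon.1)
      have h1 := Finset.card_le_card hsub
      have h2 : ((S ∩ badSet Ω f g (σ / 2) D (H \ S)).card : ℝ) < j + 1 := by
        refine lt_of_le_of_lt ?_ hj
        exact le_trans (by exact_mod_cast h1) c3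
      have h3 : (S ∩ badSet Ω f g (σ / 2) D (H \ S)).card < j + 1 := by exact_mod_cast h2
      omega
  have hfin := (Finset.card_le_card hcover).trans ((Finset.card_union_le _ _).trans
    (Nat.add_le_add_left ((Finset.card_union_le _ _).trans
      (Nat.add_le_add_left (Finset.card_union_le _ _) _)) _))
  rw [card_powersetCard, hm] at hfin
  have hfinR : C ≤ Gd.card + (E1.card + (E2.card + E3.card)) := by
    rw [hC]; exact_mod_cast hfin
  have h4 := mul_le_mul_of_nonneg_right htot hC0
  linarith

theorem lowU_num (n r m θ LΦ LU : ℝ) (hr : 0 < r) (hrn : r < n) (hm : 0 < m)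
    (hD : 0 ≤ Real.log (r * m / n))
    (h1 : (n / r) * (Real.log (r * m / n) - (r - 1)) - θ / 4 * n ≤ LΦ)
    (h2 : LΦ - θ / 4 * n ≤ LU) (h3 : r ≤ θ * (n / 2 - r)) :
    ((n - r) / r) * (Real.log (r * m / (n - r)) - (r - 1)) - θ * (n - r) ≤ LU := by
  have hn : 0 < n := hr.trans hrn
  have hnr : 0 < n - r := by linarith
  have e : r * m / (n - r) = (r * m / n) * (n / (n - r)) := by field_simp
  have hlog : Real.log (r * m / (n - r)) ≤ Real.log (r * m / n) + r / (n - r) := by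
    rw [e, Real.log_mul (by positivity) (by positivity)]
    have := Real.log_le_sub_one_of_pos (x := n / (n - r)) (by positivity)
    have e2 : n / (n - r) - 1 = r / (n - r) := by field_simp; ring
    linarith
  have h4 : ((n - r) / r) * (Real.log (r * m / (n - r)) - (r - 1))
      ≤ ((n - r) / r) * (Real.log (r * m / n) + r / (n - r) - (r - 1)) := by
    gcongr
  have e3 : ((n - r) / r) * (Real.log (r * m / n) + r / (n - r) - (r - 1))
      = (n / r) * (Real.log (r * m / n) - (r - 1)) - Real.log (r * m / n) + 1 + (r - 1) := by
    field_simp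
    ring
  rw [e3] at h4
  linarith

theorem pm_filter_disj (W : Finset ℕ) (G S : Finset (Finset ℕ)) :
    (pmSet W G).filter (fun M => Disjoint M S) = pmSet W (G \ S) := by
  ext M
  simp only [pmSet, mem_filter, mem_powerset, subset_sdiff]
  tauto

theorem minus_sdiff (H S : Finset (Finset ℕ)) (U : Finset ℕ) :
    minus (H \ S) U = minus H U \ S := by
  ext A
  simp only [minus, mem_filter, mem_sdiff]
  tauto

theorem phiSub_sdiff (W : Finset ℕ) (H S : Finset (Finset ℕ)) (U : Finset ℕ) :
    phiSub W (H \ S) U = ((pmSet (W \ U) (minus H U)).filter (fun M => Disjoint M S)).card := by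
  rw [pm_filter_disj, phiSub, minus_sdiff, pmCount]

theorem phiSub_mono (W : Finset ℕ) (H S : Finset (Finset ℕ)) (U : Finset ℕ) :
    phiSub W (H \ S) U ≤ phiSub W H U := by
  rw [phiSub_sdiff]
  exact Finset.card_filter_le _ _

theorem phiSub_erase (W : Finset ℕ) (H S : Finset (Finset ℕ)) (A : Finset ℕ) (hA : A.Nonempty) :
    phiSub W (H \ S) A = phiSub W (H \ S.erase A) A := by
  have : minus (H \ S) A = minus (H \ S.erase A) A := by
    ext B
    simp only [minus, mem_filter, mem_sdiff, mem_erase, not_and]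
    constructor
    · rintro ⟨⟨h1, h2⟩, h3⟩
      exact ⟨⟨h1, fun _ => h2⟩, h3⟩
    · rintro ⟨⟨h1, h2⟩, h3⟩
      refine ⟨⟨h1, h2 ?_⟩, h3⟩
      rintro rfl
      rw [inter_self] at h3
      exact hA.ne_empty h3
  rw [phiSub, phiSub, this]

theorem codeg_minus (H : Finset (Finset ℕ)) (U : Finset ℕ) (x y : ℕ) :
    codeg (minus H U) x y ≤ codeg H x y := by
  unfold codeg minus
  exact Finset.card_le_card (Finset.filter_subset_filter _ (Finset.filter_subset _ _))

theorem pm_card_real {W : Finset ℕ} {G : Finset (Finset ℕ)} {r : ℕ} (hr : 0 < r)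
    (hG : ∀ A ∈ G, A.card = r) {M : Finset (Finset ℕ)} (hM : M ∈ pmSet W G) :
    (M.card : ℝ) = (W.card : ℝ) / r := by
  have h := pm_card_mul hG hM
  have hrR : (0:ℝ) < r := by exact_mod_cast hr
  rw [eq_div_iff hrR.ne']
  exact_mod_cast h

/-- overlap bound from the spread property -/
theorem lemV1 (W : Finset ℕ) (G : Finset (Finset ℕ)) (r : ℕ) (hr : 0 < r) (hG : ∀ A ∈ G, A.card = r)
    (hW : 0 < W.card) (m ηu ηv k0 : ℝ) (hm : 0 < m) (hηv : 0 < ηv) (hu : ηu ≤ ηv / 3)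
    (hk0 : (W.card : ℝ) / r ≤ k0) (hkm : k0 ≤ ηv ^ 2 / 9 * m)
    (hsp : ∀ Y ⊆ G, ∑ M ∈ pmSet W G, ((M ∩ Y).card : ℝ)
        ≤ ((W.card : ℝ) / r) * (Y.card / m + ηu) * pmCount W G) :
    ∑ M ∈ pmSet W G, ∑ M' ∈ pmSet W G, ((M ∩ M').card : ℝ) ≤ ηv * k0 * (pmCount W G : ℝ) ^ 2 := by
  have hrR : (0:ℝ) < r := by exact_mod_cast hr
  have hWR : (0:ℝ) < W.card := by exact_mod_cast hW
  have hkk : (0:ℝ) < (W.card : ℝ) / r := by positivity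
  have h := lemV0 (pmSet W G) G ((W.card : ℝ) / r) m ηu (3 / ηv)
    (fun M hM => ⟨(mem_pmSet_iff.1 hM).1, (pm_card_real hr hG hM).le⟩) hkk hm (by positivity) hsp
  refine h.trans ?_
  rw [show (((pmSet W G).card : ℕ) : ℝ) = (pmCount W G : ℝ) from rfl]
  gcongr ?_ * _
  have h1 : 3 / ηv * ((W.card : ℝ) / r) / m ≤ ηv / 3 := by
    rw [div_le_iff₀ hm]
    have : (W.card : ℝ) / r ≤ ηv ^ 2 / 9 * m := hk0.trans hkm
    calc 3 / ηv * ((W.card : ℝ) / r) ≤ 3 / ηv * (ηv ^ 2 / 9 * m) := by gcongr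
      _ = _ := by field_simp; ring
  have h2 : 1 / (3 / ηv) = ηv / 3 := by field_simp
  have h3 : 1 / (3 / ηv) + ηu + 3 / ηv * ((W.card : ℝ) / r) / m ≤ ηv := by
    rw [h2]; linarith
  calc (W.card : ℝ) / r * (1 / (3 / ηv) + ηu + 3 / ηv * ((W.card : ℝ) / r) / m)
      ≤ (W.card : ℝ) / r * ηv := by gcongr
    _ ≤ k0 * ηv := by gcongr
    _ = _ := by ring

/-- The spread property delivered by `lemU`. -/
def SpreadP (r : ℕ) (η θ c0 : ℝ) : Prop :=
  ∀ (W : Finset ℕ) (G : Finset (Finset ℕ)) (m : ℝ), (∀ A ∈ G, A.card = r ∧ A ⊆ W) → 0 < W.card →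
    0 < m → (G.card : ℝ) ≤ m → 0 < pmCount W G →
    (∀ x ∈ W, ∀ y ∈ W, x ≠ y → (codeg G x y : ℝ) ≤ c0 * (r * m / W.card)) →
    ((W.card : ℝ) / r) * (Real.log (r * m / W.card) - ((r : ℝ) - 1)) - θ * W.card
      ≤ Real.log (pmCount W G) →
    ∀ Y ⊆ G, ∑ M ∈ pmSet W G, ((M ∩ Y).card : ℝ)
      ≤ ((W.card : ℝ) / r) * (Y.card / m + η) * pmCount W G

/-- The concentration property delivered by `conc2`. -/
def ConcP (C' ρ lam ζ η : ℝ) : Prop :=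
  ∀ m s k0 : ℕ, 1 ≤ s → 1 ≤ k0 → (s : ℝ) * k0 ≤ C' * m → (s : ℝ) ≤ ζ * m → (k0 : ℝ) ≤ ζ * m →
    ∀ (E0 : Finset (Finset ℕ)) (k s0 : ℕ) (F : Finset (Finset (Finset ℕ))),
      (∀ M ∈ F, M ⊆ E0 ∧ M.card = k) → E0.card + s = m + s0 → s0 ≤ s → s ≤ s0 + 1 → k ≤ k0 →
      k0 ≤ k + 1 → ∑ M ∈ F, ∑ M' ∈ F, ((M ∩ M').card : ℝ) ≤ η * k0 * (F.card : ℝ) ^ 2 →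
      (((powersetCard s0 E0).filter (fun S =>
        lam * (Real.exp (-((s : ℝ) * k0 / m)) * F.card) <
          |((F.filter (fun M => Disjoint M S)).card : ℝ)
            - Real.exp (-((s : ℝ) * k0 / m)) * F.card|)).card : ℝ) ≤ ρ * (E0.card.choose s0 : ℝ)

theorem kn_mem {n r : ℕ} {H : Finset (Finset ℕ)} (hH : H ⊆ Kn n r) :
    ∀ A ∈ H, A.card = r ∧ A ⊆ range n := by
  intro A hA
  have := hH hA
  rw [Kn, mem_powersetCard] at this
  exact ⟨this.2, this.1⟩

/-- Spread for `H - U`, giving the overlap bound -/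
theorem overlapU (r n m : ℕ) (hr : 2 ≤ r) (H : Finset (Finset ℕ)) (hH : H ⊆ Kn n r)
    (hm : H.card = m) (hm0 : 0 < m) (ηu ηv θ c0 k0 : ℝ) (hU : SpreadP r ηu θ c0) (hc0 : 0 < c0)
    (hηv : 0 < ηv) (hu : ηu ≤ ηv / 3) (hn : 2 * r < n) (hk : k0 = (n : ℝ) / r)
    (hkm : k0 ≤ ηv ^ 2 / 9 * m) (hD : 0 ≤ Real.log (r * m / n)) (h3 : (r : ℝ) ≤ θ * ((n : ℝ) / 2 - r))
    (hlow : ((n : ℝ) / r) * (Real.log (r * m / n) - ((r : ℝ) - 1)) - θ / 4 * n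
      ≤ Real.log (pmCount (range n) H)) (hpos : 0 < pmCount (range n) H)
    (hcod : ∀ x ∈ range n, ∀ y ∈ range n, x ≠ y → (codeg H x y : ℝ) ≤ c0 * (r * m / n))
    (U : Finset ℕ) (hUr : U ∈ Kn n r)
    (hbig : Real.exp (-(θ / 4 * n)) * (pmCount (range n) H : ℝ) ≤ (phiSub (range n) H U : ℝ)) :
    ∑ M ∈ pmSet (range n \ U) (minus H U), ∑ M' ∈ pmSet (range n \ U) (minus H U),
      ((M ∩ M').card : ℝ) ≤ ηv * k0 * (pmCount (range n \ U) (minus H U) : ℝ) ^ 2 := by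
  have hHm := kn_mem hH
  rw [Kn, mem_powersetCard] at hUr
  have hrR : (0:ℝ) < r := by exact_mod_cast (by omega : 0 < r)
  have hmR : (0:ℝ) < m := by exact_mod_cast hm0
  have hnR : (2:ℝ) * r < n := by exact_mod_cast hn
  have hΦ : (0:ℝ) < pmCount (range n) H := by exact_mod_cast hpos
  have hcard : (range n \ U).card = n - r := by
    rw [card_sdiff_of_subset hUr.1, card_range, hUr.2]
  have hcardR : ((range n \ U).card : ℝ) = n - r := by
    rw [hcard, Nat.cast_sub (by omega)]
  have hG : ∀ A ∈ minus H U, A.card = r ∧ A ⊆ range n \ U := by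
    intro A hA
    rw [minus, mem_filter] at hA
    refine ⟨(hHm A hA.1).1, ?_⟩
    rw [subset_sdiff]
    exact ⟨(hHm A hA.1).2, disjoint_iff_inter_eq_empty.2 hA.2⟩
  have hW : 0 < (range n \ U).card := by omega
  have hposU : 0 < pmCount (range n \ U) (minus H U) := by
    have : (0:ℝ) < (phiSub (range n) H U : ℝ) := lt_of_lt_of_le (by positivity) hbig
    exact_mod_cast this
  refine lemV1 (range n \ U) (minus H U) r (by omega) (fun A hA => (hG A hA).1) hW m ηu ηv k0 hmR
    hηv hu ?_ hkm ?_
  · rw [hcardR, hk]; gcongr; linarith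
  · refine hU _ _ m hG hW hmR ?_ hposU ?_ ?_
    · rw [← hm]
      exact_mod_cast card_le_card (filter_subset _ _)
    · intro x hx y hy hxy
      rw [mem_sdiff] at hx hy
      refine le_trans ?_ ((hcod x hx.1 y hy.1 hxy).trans ?_)
      · exact_mod_cast codeg_minus H U x y
      · rw [hcardR]
        have : (0:ℝ) < n - r := by linarith
        gcongr
        linarith
    · rw [hcardR]
      refine lowU_num n r m θ (Real.log (pmCount (range n) H)) _ hrR (by linarith) hmR hD hlow ?_ h3
      have := Real.log_le_log (by positivity) hbig
      rw [Real.log_mul (by positivity) hΦ.ne', Real.log_exp] at this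
      have e : phiSub (range n) H U = pmCount (range n \ U) (minus H U) := rfl
      rw [e] at this
      linarith

open scoped Classical in
theorem edges_near (r n m : ℕ) (hr : 2 ≤ r) (H : Finset (Finset ℕ)) (hH : H ⊆ Kn n r)
    (hm : H.card = m) (hm0 : 0 < m) (hn : 0 < n) (ηu σ η1 : ℝ) (hσ : 0 < σ) (hu : ηu ≤ η1 * σ / 8)
    (hpos : 0 < pmCount (range n) H)
    (hsp : ∀ Y ⊆ H, ∑ M ∈ pmSet (range n) H, ((M ∩ Y).card : ℝ)
        ≤ ((n : ℝ) / r) * (Y.card / m + ηu) * pmCount (range n) H) :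
    ((H.filter (fun A => ¬nearB (σ / 4) (pmCount (range n) H : ℝ) (r * m / n)
      (phiSub (range n) H A : ℝ))).card : ℝ) ≤ η1 * m := by
  have hHm := kn_mem hH
  have hrR : (0:ℝ) < r := by exact_mod_cast (by omega : 0 < r)
  have hmR : (0:ℝ) < m := by exact_mod_cast hm0
  have hnR : (0:ℝ) < n := by exact_mod_cast hn
  have h := lemE0 (pmSet (range n) H) H ((n : ℝ) / r) ηu (σ / 4) (fun M hM =>
    ⟨(mem_pmSet_iff.1 hM).1, by
      have := pm_card_real (by omega : 0 < r) (fun A hA => (hHm A hA).1) hM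
      rwa [card_range] at this⟩) (by positivity) (by omega) (by positivity) hpos
      (by rw [hm]; exact hsp)
  rw [hm] at h
  have h2 : 2 * (ηu / (σ / 4)) * m ≤ η1 * m := by
    gcongr
    rw [← mul_div_assoc, div_le_iff₀ (by positivity)]
    linarith
  refine le_trans ?_ (h.trans h2)
  have : H.filter (fun A => ¬nearB (σ / 4) (pmCount (range n) H : ℝ) (r * m / n)
      (phiSub (range n) H A : ℝ)) ⊆ H.filter (fun A => ¬((1 - σ / 4) * ((pmSet (range n) H).card : ℝ) * (n / r / m) ≤
        (((pmSet (range n) H).filter (fun M => A ∈ M)).card : ℝ) ∧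
        (((pmSet (range n) H).filter (fun M => A ∈ M)).card : ℝ) ≤
         (1 + σ / 4) * ((pmSet (range n) H).card : ℝ) * (n / r / m))) := by
    intro A hA
    rw [mem_filter] at hA ⊢
    refine ⟨hA.1, ?_⟩
    have hA1 := hHm A hA.1
    rw [card_pm_mem (card_pos.1 (by omega)) hA1.2 hA.1]
    intro hc
    apply hA.2
    have e : ∀ x : ℝ, x / (r * m / n) = x * (n / r / m) := by
      intro x; field_simp
    unfold nearB
    rw [e, e]
    exact hc
  exact_mod_cast card_le_card this

open scoped Classical in
theorem perH_core (r n m s j k0 : ℕ) (hr : 2 ≤ r) (H : Finset (Finset ℕ)) (hH : H ⊆ Kn n r)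
    (hm : H.card = m) (hs : 1 ≤ s) (hsm : s ≤ m) (hn : 2 * r < n) (hk : n = k0 * r)
    (C' σ η η1 ρ lam ζ ηu ηv θ c0 : ℝ) (hU : SpreadP r ηu θ c0) (hC : ConcP C' ρ lam ζ ηv)
    (hσ : 0 < σ) (hσ1 : σ ≤ 1 / 2) (hl : lam = σ / 16) (hη : 0 < η) (hη0 : 0 ≤ η1) (hρ : 0 ≤ ρ)
    (hθ : 0 < θ)
    (hc0 : 0 < c0) (hηv : 0 < ηv) (hu : ηu ≤ ηv / 3) (hu1 : ηu ≤ η1 * σ / 8)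
    (hsk : (s : ℝ) * k0 ≤ C' * m) (hsz : (s : ℝ) ≤ ζ * m) (hkz : (k0 : ℝ) ≤ ζ * m)
    (hkm : (k0 : ℝ) ≤ ηv ^ 2 / 9 * m) (hD : 0 ≤ Real.log (r * m / n))
    (h3 : (r : ℝ) ≤ θ * ((n : ℝ) / 2 - r))
    (he : Real.exp (-(θ / 4 * n)) ≤ Real.exp (-((s : ℝ) * k0 / m)) / (4 * (r * m / n)))
    (hlow : ((n : ℝ) / r) * (Real.log (r * m / n) - ((r : ℝ) - 1)) - θ / 4 * n
      ≤ Real.log (pmCount (range n) H)) (hpos : 0 < pmCount (range n) H)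
    (hcod : ∀ x ∈ range n, ∀ y ∈ range n, x ≠ y → (codeg H x y : ℝ) ≤ c0 * (r * m / n))
    (hF : ¬ propF r (range n) H σ)
    (hj : η * s < j + 1) (hη1 : η1 ≤ σ / 4) (htot : ρ + 4 * ρ / σ + (η1 + ρ) / η ≤ 1 / 2) :
    (1 / 2 : ℝ) * (m.choose s : ℝ) ≤ (((powersetCard s H).filter
      (fun S => σ / 2 * (Kn n r).card ≤
        ((badSet (Kn n r) (fun H' => (pmCount (range n) H' : ℝ))
          (fun H' U => (phiSub (range n) H' U : ℝ)) (σ / 2) (r * m / n) (H \ S)).card : ℝ) ∧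
        (S ∩ badSet (Kn n r) (fun H' => (pmCount (range n) H' : ℝ))
          (fun H' U => (phiSub (range n) H' U : ℝ)) (σ / 2) (r * m / n) (H \ S)).card ≤ j)).card : ℝ)
      := by
  have hHm := kn_mem hH
  have hm0 : 0 < m := by omega
  have hrR : (0:ℝ) < r := by exact_mod_cast (by omega : 0 < r)
  have hmR : (0:ℝ) < m := by exact_mod_cast hm0
  have hnR : (0:ℝ) < n := by exact_mod_cast (by omega : 0 < n)
  have hkR : (k0 : ℝ) = (n : ℝ) / r := by
    rw [eq_div_iff hrR.ne']; exact_mod_cast hk.symm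
  have hk2 : 2 ≤ k0 := by
    by_contra h
    have : k0 ≤ 2 := by omega
    have := Nat.mul_le_mul_right r this
    omega
  have hΦ : (0:ℝ) < pmCount (range n) H := by exact_mod_cast hpos
  have hspH : ∀ Y ⊆ H, ∑ M ∈ pmSet (range n) H, ((M ∩ Y).card : ℝ)
        ≤ ((n : ℝ) / r) * (Y.card / m + ηu) * pmCount (range n) H := by
    have := hU (range n) H m hHm (by rw [card_range]; omega) hmR (by rw [hm]) hpos
      (by rw [card_range]; exact hcod) (by
        rw [card_range]
        have : θ / 4 * n ≤ θ * n := by nlinarith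
        linarith)
    rw [card_range] at this
    exact this
  have hcU : ∀ U ∈ Kn n r, ∀ M ∈ pmSet (range n \ U) (minus H U), M ⊆ H ∧ M.card = k0 - 1 := by
    intro U hUr M hM
    rw [Kn, mem_powersetCard] at hUr
    refine ⟨((mem_pmSet_iff.1 hM).1).trans (filter_subset _ _), ?_⟩
    have h := pm_card_mul (r := r) (fun A hA => (hHm A ((filter_subset _ _) hA)).1) hM
    rw [card_sdiff_of_subset hUr.1, card_range, hUr.2, hk] at h
    have : (k0 - 1) * r = k0 * r - r := by rw [Nat.sub_mul, one_mul]
    exact Nat.eq_of_mul_eq_mul_right (by omega) (h.trans this.symm)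
  have hov := overlapU r n m hr H hH hm hm0 ηu ηv θ c0 k0 hU hc0 hηv hu hn hkR hkm hD h3 hlow hpos
    hcod
  have hov0 : ∑ M ∈ pmSet (range n) H, ∑ M' ∈ pmSet (range n) H, ((M ∩ M').card : ℝ)
      ≤ ηv * k0 * (pmCount (range n) H : ℝ) ^ 2 := by
    refine lemV1 (range n) H r (by omega) (fun A hA => (hHm A hA).1) (by rw [card_range]; omega) m ηu ηv
      k0 hmR hηv hu (by rw [card_range, hkR]) hkm ?_
    rw [card_range]; exact hspH
  have hconc := hC m s k0 hs (by omega) hsk hsz hkz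
  refine half_lem (Kn n r) H hH (fun H' => (pmCount (range n) H' : ℝ))
    (fun H' U => (phiSub (range n) H' U : ℝ)) m s j hm hs hsm (r * m / n)
    (Real.exp (-((s : ℝ) * k0 / m))) σ lam (Real.exp (-(θ / 4 * n))) ρ η1 η hσ hσ1 hl
    (Real.exp_pos _) ?_ (by positivity) hη hη0 hρ hΦ (fun U => Nat.cast_nonneg _) ?_ he ?_ ?_ ?_ ?_ ?_
    ?_ hj hη1 htot
  · rw [Real.exp_le_one_iff]
    have : (0:ℝ) ≤ (s : ℝ) * k0 / m := by positivity
    linarith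
  · intro S U
    exact_mod_cast phiSub_mono _ _ _ _
  · exact edges_near r n m hr H hH hm hm0 (by omega) ηu σ η1 hσ hu1 hpos hspH
  · rw [propF, not_le, card_range] at hF
    have e1 : (Kn n r).card = n.choose r := by rw [Kn, card_powersetCard, card_range]
    rw [e1]
    refine hF.trans_le (le_of_eq ?_)
    congr 2
    ext U
    rw [mem_filter, mem_filter]
    simp only [Kn, nearB, avgDeg, hm, card_range]
  · have := hconc H k0 s (pmSet (range n) H) (fun M hM => ⟨(mem_pmSet_iff.1 hM).1, by
      have h := pm_card_mul (fun A hA => (hHm A hA).1) hM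
      rw [card_range, hk] at h
      exact Nat.eq_of_mul_eq_mul_right (by omega) h⟩) (by omega) le_rfl (by omega) le_rfl (by omega)
      hov0
    rw [hm] at this
    simp only [pm_filter_disj] at this
    refine le_trans (le_of_eq ?_) this
    congr 2
  · intro U hUr hbig
    have := hconc H (k0 - 1) s (pmSet (range n \ U) (minus H U)) (hcU U hUr) (by omega) le_rfl (by omega)
      (by omega) (by omega) (hov U hUr hbig)
    rw [hm] at this
    simp only [← phiSub_sdiff] at this
    refine le_trans (le_of_eq ?_) this
    congr 2
  · intro A hA hbig
    have hAr := hH hA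
    have hAne : A.Nonempty := card_pos.1 (by rw [(hHm A hA).1]; omega)
    have hec : (H.erase A).card = m - 1 := by rw [card_erase_of_mem hA, hm]
    have := hconc (H.erase A) (k0 - 1) (s - 1) (pmSet (range n \ A) (minus H A)) (fun M hM =>
      ⟨by
        rw [subset_erase]
        refine ⟨(hcU A hAr M hM).1, ?_⟩
        intro hAM
        have h1 := (mem_pmSet_iff.1 hM).1 hAM
        rw [minus, mem_filter, inter_self] at h1
        exact hAne.ne_empty h1.2, (hcU A hAr M hM).2⟩)
      (by omega) (by omega) (by omega) (by omega) (by omega) (hov A hAr hbig)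
    rw [hec] at this
    simp only [← phiSub_sdiff] at this
    refine le_trans (le_of_eq ?_) this
    congr 2
  · intro S A hA _
    have hAne : A.Nonempty := card_pos.1 (by rw [(hHm A hA).1]; omega)
    exact_mod_cast phiSub_erase _ _ _ _ hAne

set_option maxHeartbeats 2000000 in
open scoped Classical in
theorem perH (r : ℕ) (hr : 2 ≤ r) (δ : ℕ → ℝ) (hδ : Filter.Tendsto δ Filter.atTop (nhds 0))
    (σ η Cc : ℝ) (hσ : 0 < σ) (hσ1 : σ ≤ 1 / 2) (hη : 0 < η) (hCc : 0 < Cc) :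
    ∀ᶠ n : ℕ in Filter.atTop, r ∣ n → ∀ m : ℕ, ((n : ℝ) / r) * Real.log n ≤ m → m ≤ n.choose r →
      1 ≤ ⌈Cc * Real.log n⌉₊ ∧ ⌈Cc * Real.log n⌉₊ ≤ m ∧
      ∀ H ⊆ Kn n r, H.card = m → propA r n H (δ n) →
      (∀ x ∈ range n, ∀ y ∈ range n, x ≠ y → (codeg H x y : ℝ) ≤ δ n * avgDeg r (range n) H) →
      ¬ propF r (range n) H σ → ∀ j : ℕ, η * ⌈Cc * Real.log n⌉₊ < j + 1 →
      (1 / 2 : ℝ) * (m.choose ⌈Cc * Real.log n⌉₊ : ℝ) ≤ (((powersetCard ⌈Cc * Real.log n⌉₊ H).filter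
      (fun S => σ / 2 * (Kn n r).card ≤
        ((badSet (Kn n r) (fun H' => (pmCount (range n) H' : ℝ))
          (fun H' U => (phiSub (range n) H' U : ℝ)) (σ / 2) (r * m / n) (H \ S)).card : ℝ) ∧
        (S ∩ badSet (Kn n r) (fun H' => (pmCount (range n) H' : ℝ))
          (fun H' U => (phiSub (range n) H' U : ℝ)) (σ / 2) (r * m / n) (H \ S)).card ≤ j)).card : ℝ)
      := by
  obtain ⟨η1, hη1⟩ : ∃ η1 : ℝ, η1 = min (σ / 4) (η / 8) := ⟨_, rfl⟩
  have hη1p : 0 < η1 := by rw [hη1]; positivity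
  have hη1a : η1 ≤ σ / 4 := by rw [hη1]; exact min_le_left _ _
  have hη1b : η1 ≤ η / 8 := by rw [hη1]; exact min_le_right _ _
  obtain ⟨ρ, hρ⟩ : ∃ ρ : ℝ, ρ = min (1 / 16) (min (σ / 64) (η / 16)) := ⟨_, rfl⟩
  have hρp : 0 < ρ := by rw [hρ]; positivity
  have hρa : ρ ≤ 1 / 16 := by rw [hρ]; exact min_le_left _ _
  have hρb : ρ ≤ σ / 64 := by rw [hρ]; exact (min_le_right _ _).trans (min_le_left _ _)
  have hρc : ρ ≤ η / 16 := by rw [hρ]; exact (min_le_right _ _).trans (min_le_right _ _)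
  have htot : ρ + 4 * ρ / σ + (η1 + ρ) / η ≤ 1 / 2 := by
    have h1 : 4 * ρ / σ ≤ 1 / 16 := by rw [div_le_iff₀ hσ]; linarith
    have h2 : (η1 + ρ) / η ≤ 3 / 16 := by rw [div_le_iff₀ hη]; linarith
    linarith
  obtain ⟨C', hC'⟩ : ∃ C' : ℝ, C' = Cc + 1 := ⟨_, rfl⟩
  have hC'p : 0 < C' := by rw [hC']; positivity
  obtain ⟨ζ, hζ, ηv, hηv, hconc⟩ := conc2 C' ρ (σ / 16) hC'p hρp (by positivity)
  obtain ⟨ηu, hηu⟩ : ∃ ηu : ℝ, ηu = min (η1 * σ / 8) (ηv / 3) := ⟨_, rfl⟩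
  have hηup : 0 < ηu := by rw [hηu]; positivity
  have hηua : ηu ≤ η1 * σ / 8 := by rw [hηu]; exact min_le_left _ _
  have hηub : ηu ≤ ηv / 3 := by rw [hηu]; exact min_le_right _ _
  obtain ⟨θ, hθ, c0, hc0, hU⟩ := lemU r hr ηu hηup
  obtain ⟨d0, hd0, hlemH⟩ := lemH r hr (θ / 4) (by positivity)
  have hlogT : Filter.Tendsto (fun n : ℕ => Real.log n) Filter.atTop Filter.atTop :=
    Real.tendsto_log_atTop.comp tendsto_natCast_atTop_atTop
  have E1 : ∀ᶠ n : ℕ in Filter.atTop, δ n < min d0 c0 := hδ.eventually_lt_const (by positivity)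
  have E2 : ∀ᶠ n : ℕ in Filter.atTop, max 1 (max (1 / ζ) (9 / ηv ^ 2)) ≤ Real.log n :=
    hlogT.eventually_ge_atTop _
  have E3 : ∀ᶠ n : ℕ in Filter.atTop, max (C' * r / min ζ 1) (max (2 * r + 1) (2 * (r / θ + r))) ≤ (n : ℝ) :=
    tendsto_natCast_atTop_atTop.eventually_ge_atTop _
  have E4 : ∀ᶠ n : ℕ in Filter.atTop, 4 * (n : ℝ) ^ r * Real.exp C' ≤ Real.exp (θ / 4 * n) := by
    have h := (isLittleO_pow_exp_pos_mul_atTop (k := r) (b := θ / 4) (by positivity)).bound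
      (c := 1 / (4 * Real.exp C')) (by positivity)
    have h2 := tendsto_natCast_atTop_atTop.eventually (f := (Nat.cast : ℕ → ℝ)) h
    filter_upwards [h2] with n hn
    rw [Real.norm_of_nonneg (by positivity), Real.norm_of_nonneg (by positivity), one_div_mul_eq_div,
      le_div_iff₀ (by positivity)] at hn
    linarith
  filter_upwards [hlemH, E1, E2, E3, E4] with n hlemH E1 E2 E3 E4 hdiv m hmlow hmup
  obtain ⟨k0, hk⟩ := hdiv
  have hrR : (0:ℝ) < r := by exact_mod_cast (by omega : 0 < r)
  rw [max_le_iff, max_le_iff] at E2 E3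
  obtain ⟨E2a, E2b, E2c⟩ := E2
  obtain ⟨E3a, E3b, E3c⟩ := E3
  have hn : 2 * r < n := by
    have : ((2 * r + 1 : ℕ) : ℝ) ≤ n := by push_cast; exact E3b
    have : 2 * r + 1 ≤ n := by exact_mod_cast this
    omega
  have hnR : (0:ℝ) < n := by linarith
  have hkR : (k0 : ℝ) = (n : ℝ) / r := by
    rw [eq_div_iff hrR.ne', mul_comm]; exact_mod_cast hk.symm
  have hnr : 0 < (n : ℝ) / r := by positivity
  have hmR : 0 < (m : ℝ) := lt_of_lt_of_le (by positivity) hmlow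
  obtain ⟨L, hL⟩ : ∃ L : ℝ, L = Real.log n := ⟨_, rfl⟩
  rw [← hL] at E2a E2b E2c hmlow ⊢
  have hLp : 0 < L := by linarith
  obtain ⟨s, hs⟩ : ∃ s : ℕ, s = ⌈Cc * L⌉₊ := ⟨_, rfl⟩
  rw [← hs]
  have hs1 : 1 ≤ s := by rw [hs]; exact Nat.one_le_ceil_iff.2 (by positivity)
  have hsC : (s : ℝ) ≤ C' * L := by
    have := (Nat.ceil_lt_add_one (a := Cc * L) (by positivity)).le
    rw [← hs] at this
    rw [hC']; linarith
  have hsmin : (s : ℝ) ≤ min ζ 1 * m := by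
    have hmin : 0 < min ζ 1 := by positivity
    rw [div_le_iff₀ hmin] at E3a
    have h1 : C' ≤ min ζ 1 * ((n : ℝ) / r) := by
      rw [← mul_div_assoc, le_div_iff₀ hrR]; linarith
    calc (s : ℝ) ≤ C' * L := hsC
      _ ≤ min ζ 1 * ((n : ℝ) / r) * L := by gcongr
      _ = min ζ 1 * ((n : ℝ) / r * L) := by ring
      _ ≤ _ := by gcongr
  have hsm : s ≤ m := by
    have : (s : ℝ) ≤ m := hsmin.trans (by
      have := min_le_right ζ 1
      nlinarith)
    exact_mod_cast this
  refine ⟨hs1, hsm, ?_⟩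
  intro H hH hm hA hcod hF j hj
  have hδ1 : δ n ≤ d0 := (E1.le).trans (min_le_left _ _)
  have hδ2 : δ n ≤ c0 := (E1.le).trans (min_le_right _ _)
  obtain ⟨hpos, hlow⟩ := hlemH ⟨k0, hk⟩ H hH (by rw [hm, ← hL]; exact hmlow) (δ n) hδ1 hA
  rw [hm] at hlow
  have hsk : (s : ℝ) * k0 ≤ C' * m := by
    calc (s : ℝ) * k0 ≤ C' * L * k0 := by gcongr
      _ = C' * ((n : ℝ) / r * L) := by rw [hkR]; ring
      _ ≤ _ := by gcongr
  have hDL : L ≤ r * m / n := by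
    rw [le_div_iff₀ hnR]
    have : (n : ℝ) / r * L * r ≤ m * r := by gcongr
    have e : (n : ℝ) / r * L * r = L * n := by field_simp
    linarith
  refine perH_core r n m s j k0 hr H hH hm hs1 hsm hn (by rw [hk, mul_comm]) C' σ η η1 ρ (σ / 16) ζ ηu ηv θ c0
    hU hconc hσ hσ1 rfl hη hη1p.le hρp.le hθ hc0 hηv hηub hηua hsk ?_ ?_ ?_ ?_ ?_ ?_ hlow hpos ?_ hF hj
    hη1a htot
  · exact hsmin.trans (by gcongr; exact min_le_left _ _)
  · rw [hkR]
    rw [div_le_iff₀ hζ] at E2b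
    calc (n : ℝ) / r = (n : ℝ) / r * 1 := by ring
      _ ≤ (n : ℝ) / r * (L * ζ) := by gcongr
      _ = ζ * ((n : ℝ) / r * L) := by ring
      _ ≤ _ := by gcongr
  · rw [hkR]
    rw [div_le_iff₀ (by positivity)] at E2c
    have : 1 ≤ L * (ηv ^ 2 / 9) := by linarith
    calc (n : ℝ) / r = (n : ℝ) / r * 1 := by ring
      _ ≤ (n : ℝ) / r * (L * (ηv ^ 2 / 9)) := by gcongr
      _ = ηv ^ 2 / 9 * ((n : ℝ) / r * L) := by ring
      _ ≤ _ := by gcongr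
  · exact Real.log_nonneg (E2a.trans hDL)
  · have : r / θ ≤ (n : ℝ) / 2 - r := by linarith
    rw [div_le_iff₀ hθ] at this
    linarith
  · have hDp : (0:ℝ) < r * m / n := by positivity
    rw [le_div_iff₀ (by positivity), Real.exp_neg, Real.exp_neg, inv_mul_le_iff₀ (Real.exp_pos _),
      ← div_eq_mul_inv, le_div_iff₀ (Real.exp_pos _)]
    refine le_trans ?_ E4
    have h1 : (r : ℝ) * m / n ≤ (n : ℝ) ^ r := by
      have h2 : (m : ℝ) ≤ (n : ℝ) ^ r := by
        have := hmup.trans (Nat.choose_le_pow n r)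
        exact_mod_cast this
      have h3 : (r : ℝ) * m / n ≤ m := by
        have h4 : (r : ℝ) ≤ n := by linarith
        rw [div_le_iff₀ hnR, mul_comm]
        gcongr
      linarith
    have h2 : (s : ℝ) * k0 / m ≤ C' := by rw [div_le_iff₀ hmR]; exact hsk
    gcongr
  · intro x hx y hy hxy
    refine (hcod x hx y hy hxy).trans ?_
    rw [avgDeg, hm, card_range]
    gcongr

theorem propF_mono (r : ℕ) (W : Finset ℕ) (G : Finset (Finset ℕ)) (σ σ' : ℝ) (h : σ' ≤ σ)
    (hF : propF r W G σ') : propF r W G σ := by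
  unfold propF at *
  refine le_trans ?_ (hF.trans (by gcongr))
  have hD : 0 ≤ avgDeg r W G := by unfold avgDeg; positivity
  norm_cast
  apply card_le_card
  intro U hU
  rw [mem_filter] at hU ⊢
  refine ⟨hU.1, fun hc => hU.2 ⟨le_trans ?_ hc.1, hc.2.trans ?_⟩⟩
  · gcongr
  · gcongr

open scoped Classical in
theorem final_thm (r : ℕ) (hr : 3 ≤ r) (ε : ℝ) (hε : 0 < ε) (K : ℝ)
    (δ : ℕ → ℝ)
    (hδ : Filter.Tendsto δ Filter.atTop (nhds 0)) :
    ∀ σ : ℝ, 0 < σ → ∀ k : ℝ, 0 < k → ∃ n₀ : ℕ, ∀ n : ℕ, n₀ ≤ n → r ∣ n →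
      ∀ m : ℕ, (1 + ε) * ((n : ℝ) / r) * Real.log n < m → m ≤ n.choose r →
      (((Finset.powersetCard m (Kn n r)).filter
          (fun H => propA r n H (δ n) ∧ propR r (Finset.range n) H (δ n) K ∧
            ¬propF r (Finset.range n) H σ)).card : ℝ) /
        ((Finset.powersetCard m (Kn n r)).card : ℝ) ≤ (n : ℝ) ^ (-k) := by
  intro σ0 hσ0 k hk
  obtain ⟨σ, hσdef⟩ : ∃ σ : ℝ, σ = min σ0 (1 / 2) := ⟨_, rfl⟩
  have hσ : 0 < σ := by rw [hσdef]; positivity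
  have hσ1 : σ ≤ 1 / 2 := by rw [hσdef]; exact min_le_right _ _
  have hσ2 : σ ≤ σ0 := by rw [hσdef]; exact min_le_left _ _
  obtain ⟨ll, hll⟩ : ∃ ll : ℝ, ll = Real.log (1 / (σ / 8)) := ⟨_, rfl⟩
  have hllp : 0 ≤ ll := by
    rw [hll]
    apply Real.log_nonneg
    rw [le_div_iff₀ (by positivity)]
    linarith
  obtain ⟨η, hη⟩ : ∃ η : ℝ, η = σ / (16 * (ll + 1)) := ⟨_, rfl⟩
  have hηp : 0 < η := by rw [hη]; positivity
  have hηll : η * (ll + 1) = σ / 16 := by rw [hη]; field_simp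
  have hη1 : η ≤ 1 / 2 := by nlinarith
  obtain ⟨Cc, hCc⟩ : ∃ Cc : ℝ, Cc = 8 * (k + 1) / σ := ⟨_, rfl⟩
  have hCcp : 0 < Cc := by rw [hCc]; positivity
  obtain ⟨n₀, hn₀⟩ := Filter.eventually_atTop.1
    ((perH r (by omega) δ hδ σ η Cc hσ hσ1 hηp hCcp).and (Filter.eventually_ge_atTop 2))
  refine ⟨n₀, fun n hn hdiv m hmlow hmup => ?_⟩
  obtain ⟨hper, hn2⟩ := hn₀ n hn
  have hnR : (2:ℝ) ≤ n := by exact_mod_cast hn2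
  have hL : 0 < Real.log n := Real.log_pos (by linarith)
  have hrR : (0:ℝ) < r := by exact_mod_cast (by omega : 0 < r)
  obtain ⟨hs1, hsm, hper⟩ := hper hdiv m (by
    have : 0 ≤ ε * (((n : ℝ) / r) * Real.log n) := by positivity
    nlinarith) hmup
  have hsC := Nat.le_ceil (Cc * Real.log n)
  generalize hs : ⌈Cc * Real.log n⌉₊ = s at *
  have hsR : (0:ℝ) < s := by exact_mod_cast hs1
  have hKn : (Kn n r).card = n.choose r := by rw [Kn, card_powersetCard, card_range]
  obtain ⟨j, hjdef⟩ : ∃ j : ℕ, j = ⌊η * s⌋₊ := ⟨_, rfl⟩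
  have hj1 : (j : ℝ) ≤ η * s := by rw [hjdef]; exact Nat.floor_le (by positivity)
  have hj2 : η * s < j + 1 := by rw [hjdef]; exact Nat.lt_floor_add_one _
  have hjs : j ≤ s := by
    have : (j : ℝ) ≤ s := by nlinarith
    exact_mod_cast this
  have hcm := count_main (Kn n r) m s j hjs hs1 hsm (by rw [hKn]; exact hmup)
    ((powersetCard m (Kn n r)).filter
          (fun H => propA r n H (δ n) ∧ propR r (Finset.range n) H (δ n) K ∧
            ¬propF r (Finset.range n) H σ0)) (filter_subset _ _)
    (badSet (Kn n r) (fun H' => (pmCount (range n) H' : ℝ))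
          (fun H' U => (phiSub (range n) H' U : ℝ)) (σ / 2) (r * m / n))
    (fun H' => filter_subset _ _) (σ / 2) (by positivity) (by
      intro H hH
      rw [mem_filter, mem_powersetCard] at hH
      obtain ⟨⟨hH1, hH2⟩, hA, hR, hF⟩ := hH
      have := hper H hH1 hH2 hA hR.2.2 (fun h => hF (propF_mono r _ _ _ _ hσ2 h)) j hj2
      convert this using 3)
  have hch := choose_le_y s j hjs (σ / 8) (by positivity)
  rw [← hll] at hch
  rw [card_powersetCard, hKn]
  rw [hKn] at hcm
  have hpos : (0:ℝ) < ((n.choose r).choose m : ℝ) := by exact_mod_cast Nat.choose_pos hmup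
  rw [div_le_iff₀ hpos]
  refine hcm.trans ?_
  have hsub : ((s - j : ℕ) : ℝ) = s - j := by rw [Nat.cast_sub hjs]
  have hmain : (s.choose j : ℝ) * Real.exp (-(((s - j : ℕ) : ℝ) * (σ / 2))) ≤ Real.exp (-(σ / 8 * s)) := by
    calc (s.choose j : ℝ) * Real.exp (-(((s - j : ℕ) : ℝ) * (σ / 2)))
        ≤ Real.exp (σ / 8 * s) * Real.exp (j * ll) * Real.exp (-(((s - j : ℕ) : ℝ) * (σ / 2))) := by
          gcongr
      _ = Real.exp (σ / 8 * s + j * ll + -(((s - j : ℕ) : ℝ) * (σ / 2))) := by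
          rw [Real.exp_add, Real.exp_add]
      _ ≤ _ := by
          rw [Real.exp_le_exp, hsub]
          have h1 : (j : ℝ) * (ll + 1) ≤ η * s * (ll + 1) := by gcongr
          have h2 : η * s * (ll + 1) = σ / 16 * s := by rw [← hηll]; ring
          have h3 : (j : ℝ) * (σ / 2) ≤ j * 1 := by gcongr; linarith
          nlinarith
  have hexp : 2 * Real.exp (-(σ / 8 * s)) ≤ (n : ℝ) ^ (-k) := by
    have h1 : (k + 1) * Real.log n ≤ σ / 8 * s := by
      calc (k + 1) * Real.log n = σ / 8 * (Cc * Real.log n) := by rw [hCc]; field_simp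
        _ ≤ _ := by gcongr
    have h2 : Real.exp (-(σ / 8 * s)) ≤ Real.exp (-((k + 1) * Real.log n)) := by
      rw [Real.exp_le_exp]; linarith
    have h3 : Real.exp (-((k + 1) * Real.log n)) = (n : ℝ) ^ (-k) * (n : ℝ)⁻¹ := by
      rw [Real.rpow_def_of_pos (by linarith)]
      have : (n : ℝ)⁻¹ = Real.exp (-Real.log n) := by
        rw [Real.exp_neg, Real.exp_log (by linarith)]
      rw [this, ← Real.exp_add]
      ring_nf
    have h4 : (2:ℝ) * (n : ℝ)⁻¹ ≤ 1 := by
      rw [← div_eq_mul_inv, div_le_one (by linarith)]; exact hnR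
    have h5 : (0:ℝ) < (n : ℝ) ^ (-k) := Real.rpow_pos_of_pos (by linarith) _
    nlinarith
  calc 2 * ((n.choose r).choose m : ℝ) * (s.choose j : ℝ) * Real.exp (-(((s - j : ℕ) : ℝ) * (σ / 2)))
      = 2 * ((n.choose r).choose m : ℝ) * ((s.choose j : ℝ) * Real.exp (-(((s - j : ℕ) : ℝ) * (σ / 2)))) := by
        ring
    _ ≤ 2 * ((n.choose r).choose m : ℝ) * Real.exp (-(σ / 8 * s)) := by gcongr
    _ = 2 * Real.exp (-(σ / 8 * s)) * ((n.choose r).choose m : ℝ) := by ring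
    _ ≤ _ := by gcongr

open scoped Classical in
/-- **Lemma 7.2 (Lemma F).** `{H ⊨ A∧R} ⟹* {H ⊨ F}`: for the uniform random
`m`-edge `r`-graph on `[n]`, the probability of satisfying `A(δ(n))` and
`R(δ(n),K)` while failing `F(σ)` is at most `n^{−k}`, for every fixed `k`. -/
theorem lemma_F (r : ℕ) (hr : 3 ≤ r) (ε : ℝ) (hε : 0 < ε) (K : ℝ) (hK : 1 ≤ K)
    (δ : ℕ → ℝ) (hδpos : ∀ n, 0 < δ n)
    (hδ : Filter.Tendsto δ Filter.atTop (nhds 0)) :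
    ∀ σ : ℝ, 0 < σ → ∀ k : ℝ, 0 < k → ∃ n₀ : ℕ, ∀ n : ℕ, n₀ ≤ n → r ∣ n →
      ∀ m : ℕ, (1 + ε) * ((n : ℝ) / r) * Real.log n < m → m ≤ n.choose r →
      (((Finset.powersetCard m (Kn n r)).filter
          (fun H => propA r n H (δ n) ∧ propR r (Finset.range n) H (δ n) K ∧
            ¬propF r (Finset.range n) H σ)).card : ℝ) /
        ((Finset.powersetCard m (Kn n r)).card : ℝ) ≤ (n : ℝ) ^ (-k) := by
  exact final_thm r hr ε hε K δ hδ
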